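/- For every integer p ≥ 1, setting m = 2^{p+1} − 1, one has H(m,m) ≥ (m+1)·ln(m+1)/(2 ln 2) + 1. -/

import Mathlib

open Filter Polynomial

/-- `Γ` is a periodic orbit of the planar vector field `V`: the image of a
nonconstant periodic solution of `γ' = V ∘ γ`. -/
def IsPeriodicOrbit (V : ℝ × ℝ → ℝ × ℝ) (Γ : Set (ℝ × ℝ)) : Prop :=
  ∃ γ : ℝ → ℝ × ℝ,
    (∀ t : ℝ, HasDerivAt γ (V (γ t)) t) ∧
    (∃ T : ℝ, 0 < T ∧ Function.Periodic γ T) ∧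
    (∃ t₁ t₂ : ℝ, γ t₁ ≠ γ t₂) ∧
    Γ = Set.range γ

/-- `Γ` is a limit cycle of `V`: a periodic orbit which is isolated among
periodic orbits. -/
def IsLimitCycle (V : ℝ × ℝ → ℝ × ℝ) (Γ : Set (ℝ × ℝ)) : Prop :=
  IsPeriodicOrbit V Γ ∧
  ∃ U : Set (ℝ × ℝ), IsOpen U ∧ Γ ⊆ U ∧
    ∀ Γ' : Set (ℝ × ℝ), IsPeriodicOrbit V Γ' → Γ' ⊆ U → Γ' = Γ

/-- The Liénard vector field `ẋ = y, ẏ = -g(x) - ε f(x) y`. -/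
def lienard (f g : Polynomial ℝ) (ε : ℝ) : ℝ × ℝ → ℝ × ℝ :=
  fun p => (p.2, -(g.eval p.1) - ε * (f.eval p.1) * p.2)

/-- `HGe n m c` formalizes `H(n,m) ≥ c`: there are polynomials `f, g` with
`deg f ≤ n`, `deg g ≤ m` and `ε₀ > 0` such that for every `0 < ε ≤ ε₀` the
Liénard system has at least `c` pairwise distinct limit cycles. -/
def HGe (n m : ℕ) (c : ℝ) : Prop :=
  ∃ f g : Polynomial ℝ, f.natDegree ≤ n ∧ g.natDegree ≤ m ∧
    ∃ ε₀ : ℝ, 0 < ε₀ ∧ ∀ ε : ℝ, 0 < ε → ε ≤ ε₀ →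
      ∃ S : Finset (Set (ℝ × ℝ)),
        (∀ Γ ∈ S, IsLimitCycle (lienard f g ε) Γ) ∧ c ≤ (S.card : ℝ)

section UniformEstimates

open Set Topology

variable {R : ℝ × ℝ × ℝ → ℝ} {E₀ : ℝ}

lemma exists_pos_of_eventually_nhds_pair {P : ℝ → ℝ → Prop} {x₀ y₀ : ℝ}
    (h : ∀ᶠ z : ℝ × ℝ in 𝓝 (x₀, y₀), P z.1 z.2) :
    ∃ δ > 0, ∀ x y, |x - x₀| < δ → |y - y₀| < δ → P x y := by
  obtain ⟨δ, hδ, hb⟩ := Metric.eventually_nhds_iff.1 h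
  refine ⟨δ, hδ, fun x y hx hy => hb (y := (x, y)) ?_⟩
  simp only [Prod.dist_eq, Real.dist_eq]
  exact max_lt hx hy

lemma continuousAt_uniform (hR : ∀ θ, ContDiffAt ℝ 1 R (θ, E₀, 0)) {K : Set ℝ}
    (hK : IsCompact K) :
    ∃ δ > 0, ∀ E ε, |E - E₀| < δ → |ε - 0| < δ → ∀ θ ∈ K, ContinuousAt R (θ, E, ε) := by
  apply exists_pos_of_eventually_nhds_pair (P := fun E ε => ∀ θ ∈ K, ContinuousAt R (θ, E, ε))
  refine hK.eventually_forall_of_forall_eventually (x₀ := (E₀, (0 : ℝ)))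
    (P := fun z θ => ContinuousAt R (θ, z.1, z.2)) fun θ _ => ?_
  have h : ∀ᶠ p in 𝓝 (θ, E₀, (0 : ℝ)), ContinuousAt R p :=
    ((hR θ).eventually (by simp)).mono fun p hp => hp.continuousAt
  have hc : Tendsto (fun z : (ℝ × ℝ) × ℝ => (z.2, z.1.1, z.1.2)) (𝓝 ((E₀, 0), θ))
      (𝓝 (θ, E₀, 0)) := by
    have : Continuous (fun z : (ℝ × ℝ) × ℝ => (z.2, z.1.1, z.1.2)) := by fun_prop
    exact this.tendsto ((E₀, 0), θ)
  exact hc.eventually h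

lemma exists_uniform_strict (hR : ∀ θ, ContDiffAt ℝ 1 R (θ, E₀, 0)) {K : Set ℝ}
    (hK : IsCompact K) :
    ∃ ρ : ℝ → ℝ, Continuous ρ ∧ ∀ κ > 0, ∃ δ > 0, ∀ θ ∈ K, ∀ E₁ E₂ ε,
      |E₁ - E₀| < δ → |E₂ - E₀| < δ → |ε| < δ →
      |R (θ, E₁, ε) - R (θ, E₂, ε) - ρ θ * (E₁ - E₂)| ≤ κ * |E₁ - E₂| := by
  have hρ : Continuous (fun θ => fderiv ℝ R (θ, E₀, 0) (0, 1, 0)) := by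
    rw [continuous_iff_continuousAt]
    intro θ
    have h1 : ContinuousAt (fderiv ℝ R) (θ, E₀, 0) :=
      ((hR θ).fderiv_right (m := 0) (by norm_num)).continuousAt
    have h2 : ContinuousAt (fun θ : ℝ => (θ, E₀, (0 : ℝ))) θ := by fun_prop
    exact (ContinuousAt.comp (f := fun θ : ℝ => (θ, E₀, (0 : ℝ))) h1 h2).clm_apply
      continuousAt_const
  refine ⟨_, hρ, fun κ hκ => ?_⟩
  have key : ∀ᶠ z : ℝ × ℝ × ℝ in 𝓝 (E₀, E₀, 0), ∀ θ ∈ K,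
      |R (θ, z.1, z.2.2) - R (θ, z.2.1, z.2.2)
        - fderiv ℝ R (θ, E₀, 0) (0, 1, 0) * (z.1 - z.2.1)| ≤ κ * |z.1 - z.2.1| := by
    refine hK.eventually_forall_of_forall_eventually (x₀ := (E₀, E₀, (0 : ℝ)))
      (P := fun z θ => |R (θ, z.1, z.2.2) - R (θ, z.2.1, z.2.2)
        - fderiv ℝ R (θ, E₀, 0) (0, 1, 0) * (z.1 - z.2.1)| ≤ κ * |z.1 - z.2.1|)
      fun θ _ => ?_
    have hs := ((hR θ).hasStrictFDerivAt (by norm_num)).isLittleO.def (half_pos hκ)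
    have hc : Tendsto (fun z : (ℝ × ℝ × ℝ) × ℝ =>
        ((z.2, z.1.1, z.1.2.2), (z.2, z.1.2.1, z.1.2.2))) (𝓝 ((E₀, E₀, 0), θ))
        (𝓝 ((θ, E₀, 0), (θ, E₀, 0))) := by
      have : Continuous (fun z : (ℝ × ℝ × ℝ) × ℝ =>
        ((z.2, z.1.1, z.1.2.2), (z.2, z.1.2.1, z.1.2.2))) := by fun_prop
      exact this.tendsto ((E₀, E₀, 0), θ)
    have hρ' : ∀ᶠ z : (ℝ × ℝ × ℝ) × ℝ in 𝓝 ((E₀, E₀, 0), θ),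
        |fderiv ℝ R (z.2, E₀, 0) (0, 1, 0) - fderiv ℝ R (θ, E₀, 0) (0, 1, 0)| < κ / 2 := by
      have h3 : Tendsto (fun z : (ℝ × ℝ × ℝ) × ℝ => fderiv ℝ R (z.2, E₀, 0) (0, 1, 0))
          (𝓝 ((E₀, E₀, 0), θ)) (𝓝 (fderiv ℝ R (θ, E₀, 0) (0, 1, 0))) :=
        (hρ.comp continuous_snd).tendsto ((E₀, E₀, (0 : ℝ)), θ)
      have := Metric.tendsto_nhds.1 h3 _ (half_pos hκ)
      simpa [Real.dist_eq] using this
    filter_upwards [hc.eventually hs, hρ'] with z hz hz'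
    obtain ⟨⟨x, y, e⟩, t⟩ := z
    simp only [Prod.mk_sub_mk, sub_self] at hz hz' ⊢
    have e1 : fderiv ℝ R (θ, E₀, 0) (0, x - y, 0) =
        fderiv ℝ R (θ, E₀, 0) (0, 1, 0) * (x - y) := by
      have : ((0 : ℝ), x - y, (0 : ℝ)) = (x - y) • ((0 : ℝ), (1 : ℝ), (0 : ℝ)) := by simp
      rw [this, map_smul, smul_eq_mul, mul_comm]
    have e2 : ‖((0 : ℝ), x - y, (0 : ℝ))‖ = |x - y| := by
      simp [Prod.norm_def]
    rw [e1, e2, Real.norm_eq_abs] at hz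
    set A := fderiv ℝ R (θ, E₀, 0) (0, 1, 0)
    set B := fderiv ℝ R (t, E₀, 0) (0, 1, 0)
    have : R (t, x, e) - R (t, y, e) - B * (x - y) =
      (R (t, x, e) - R (t, y, e) - A * (x - y)) - (B - A) * (x - y) := by ring
    rw [this]
    calc _ ≤ |R (t, x, e) - R (t, y, e) - A * (x - y)| + |(B - A) * (x - y)| := abs_sub _ _
      _ ≤ κ / 2 * |x - y| + κ / 2 * |x - y| := by
        rw [abs_mul]; gcongr
      _ = _ := by ring
  obtain ⟨δ, hδ, hb⟩ := Metric.eventually_nhds_iff.1 key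
  refine ⟨δ, hδ, fun θ hθ x y e hx hy he => hb (y := (x, y, e)) ?_ θ hθ⟩
  simp only [Prod.dist_eq, Real.dist_eq, sub_zero]
  exact max_lt hx (max_lt hy he)

end UniformEstimates

section ScalarReturn

open Set Topology MeasureTheory intervalIntegral

lemma sq_le_of_mul_deriv_le {v v' σ : ℝ → ℝ} {T : ℝ} (hT : 0 ≤ T) (hσ : Continuous σ)
    (hv : ∀ θ ∈ Icc 0 T, HasDerivAt v (v' θ) θ)
    (h : ∀ θ ∈ Icc 0 T, v θ * v' θ ≤ σ θ * v θ ^ 2) :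
    v T ^ 2 ≤ v 0 ^ 2 * Real.exp (2 * ∫ θ in (0 : ℝ)..T, σ θ) := by
  have hI : ∀ θ, HasDerivAt (fun θ => ∫ s in (0 : ℝ)..θ, σ s) (σ θ) θ := fun θ =>
    integral_hasDerivAt_right (hσ.intervalIntegrable _ _)
      hσ.aestronglyMeasurable.stronglyMeasurableAtFilter hσ.continuousAt
  have hd : ∀ θ ∈ Icc 0 T, HasDerivAt
      (fun θ => v θ ^ 2 * Real.exp (-(2 * ∫ s in (0 : ℝ)..θ, σ s)))
      (2 * (v θ * v' θ - σ θ * v θ ^ 2) * Real.exp (-(2 * ∫ s in (0 : ℝ)..θ, σ s))) θ := by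
    intro θ hθ
    have h1 := ((hv θ hθ).pow 2).mul (((hI θ).const_mul 2).neg.exp)
    refine h1.congr_deriv ?_
    simp only [Nat.cast_ofNat, Nat.add_one_sub_one, pow_one, Pi.neg_apply, Pi.pow_apply]
    ring
  have hanti : AntitoneOn (fun θ => v θ ^ 2 * Real.exp (-(2 * ∫ s in (0 : ℝ)..θ, σ s)))
      (Icc 0 T) := by
    refine antitoneOn_of_hasDerivWithinAt_nonpos (convex_Icc 0 T)
      (fun θ hθ => (hd θ hθ).continuousAt.continuousWithinAt)
      (fun θ hθ => (hd θ (interior_subset hθ)).hasDerivWithinAt) fun θ hθ => ?_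
    have := h θ (interior_subset hθ)
    exact mul_nonpos_of_nonpos_of_nonneg (by linarith) (Real.exp_pos _).le
  have := hanti (left_mem_Icc.2 hT) (right_mem_Icc.2 hT) hT
  simp only [integral_same, mul_zero, neg_zero, Real.exp_zero, mul_one] at this
  rw [Real.exp_neg, ← div_eq_mul_inv, div_le_iff₀ (Real.exp_pos _)] at this
  exact this

lemma le_sq_of_le_mul_deriv {v v' σ : ℝ → ℝ} {T : ℝ} (hT : 0 ≤ T) (hσ : Continuous σ)
    (hv : ∀ θ ∈ Icc 0 T, HasDerivAt v (v' θ) θ)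
    (h : ∀ θ ∈ Icc 0 T, σ θ * v θ ^ 2 ≤ v θ * v' θ) :
    v 0 ^ 2 * Real.exp (2 * ∫ θ in (0 : ℝ)..T, σ θ) ≤ v T ^ 2 := by
  have hr : ∀ θ ∈ Icc 0 T, T - θ ∈ Icc 0 T := fun θ hθ =>
    ⟨by linarith [hθ.2], by linarith [hθ.1]⟩
  have := sq_le_of_mul_deriv_le (v := fun θ => v (T - θ)) (v' := fun θ => -v' (T - θ))
    (σ := fun θ => -σ (T - θ)) hT (by fun_prop)
    (fun θ hθ => by
      have h1 := (hv _ (hr θ hθ)).comp θ ((hasDerivAt_id θ).const_sub T)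
      exact h1.congr_deriv (by simp))
    (fun θ hθ => by have := h _ (hr θ hθ); linarith)
  simp only [sub_self, sub_zero, intervalIntegral.integral_neg, mul_neg,
    integral_comp_sub_left] at this
  rw [Real.exp_neg, ← div_eq_mul_inv, le_div_iff₀ (Real.exp_pos _)] at this
  exact this

variable {R : ℝ × ℝ × ℝ → ℝ} {E₀ : ℝ}

/-- `u` solves `u' = ε R(θ, u, ε)` on `s` and stays within `δ` of `E₀`. -/
def SolvesOn (R : ℝ × ℝ × ℝ → ℝ) (E₀ ε δ : ℝ) (u : ℝ → ℝ) (s : Set ℝ) : Prop :=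
  ∀ θ ∈ s, HasDerivAt u (ε * R (θ, u θ, ε)) θ ∧ |u θ - E₀| < δ

lemma SolvesOn.mono {ε δ : ℝ} {u : ℝ → ℝ} {s t : Set ℝ} (h : SolvesOn R E₀ ε δ u s)
    (hts : t ⊆ s) : SolvesOn R E₀ ε δ u t := fun θ hθ => h θ (hts hθ)

lemma exists_bounds (hR : ∀ θ, ContDiffAt ℝ 1 R (θ, E₀, 0)) {K : Set ℝ} (hK : IsCompact K) :
    ∃ δ > 0, ∃ M > 0, ∃ L > 0, (∀ θ ∈ K, ∀ E ε, |E - E₀| ≤ δ → |ε| ≤ δ →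
      ContinuousAt R (θ, E, ε) ∧ |R (θ, E, ε)| ≤ M) ∧
      ∀ θ ∈ K, ∀ E₁ E₂ ε, |E₁ - E₀| ≤ δ → |E₂ - E₀| ≤ δ → |ε| ≤ δ →
        |R (θ, E₁, ε) - R (θ, E₂, ε)| ≤ L * |E₁ - E₂| := by
  obtain ⟨δ₁, hδ₁, h1⟩ := continuousAt_uniform hR hK
  obtain ⟨ρ, hρ, h2⟩ := exists_uniform_strict hR hK
  obtain ⟨δ₂, hδ₂, h2⟩ := h2 1 one_pos
  obtain ⟨C, hC⟩ := hK.exists_bound_of_continuousOn hρ.continuousOn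
  set δ := min δ₁ δ₂ / 2 with hδ
  have hδ0 : 0 < δ := by positivity
  have hl1 : δ < δ₁ := by
    have := min_le_left δ₁ δ₂; have : 0 < min δ₁ δ₂ := by positivity
    linarith
  have hl2 : δ < δ₂ := by
    have := min_le_right δ₁ δ₂; have : 0 < min δ₁ δ₂ := by positivity
    linarith
  have hcpt : IsCompact (K ×ˢ (Icc (E₀ - δ) (E₀ + δ) ×ˢ Icc (-δ) δ)) :=
    hK.prod (isCompact_Icc.prod isCompact_Icc)
  have hcont : ContinuousOn R (K ×ˢ (Icc (E₀ - δ) (E₀ + δ) ×ˢ Icc (-δ) δ)) := by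
    rintro ⟨θ, E, ε⟩ ⟨h₁, h₂, h₃⟩
    refine (h1 E ε ?_ ?_ θ h₁).continuousWithinAt
    · exact lt_of_le_of_lt (abs_le.2 ⟨by linarith [h₂.1], by linarith [h₂.2]⟩) hl1
    · rw [sub_zero]; exact lt_of_le_of_lt (abs_le.2 ⟨by linarith [h₃.1], by linarith [h₃.2]⟩) hl1
  obtain ⟨M, hM⟩ := hcpt.exists_bound_of_continuousOn hcont
  refine ⟨δ, hδ0, max M 1, by positivity, max C 0 + 1, by positivity, ?_, ?_⟩
  · intro θ hθ E ε hE hε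
    refine ⟨h1 E ε (by linarith) (by rw [sub_zero]; linarith) θ hθ, ?_⟩
    rw [abs_le] at hE hε
    exact (hM (θ, E, ε) ⟨hθ, ⟨by linarith [hE.1], by linarith [hE.2]⟩,
      ⟨by linarith [hε.1], by linarith [hε.2]⟩⟩).trans (le_max_left _ _)
  · intro θ hθ E₁ E₂ ε h₁ h₂ hε
    have h3 := h2 θ hθ E₁ E₂ ε (by linarith) (by linarith) (by linarith)
    have h4 := hC θ hθ
    rw [Real.norm_eq_abs] at h4
    calc _ = |(R (θ, E₁, ε) - R (θ, E₂, ε) - ρ θ * (E₁ - E₂)) + ρ θ * (E₁ - E₂)| := by ring_nf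
      _ ≤ 1 * |E₁ - E₂| + |ρ θ| * |E₁ - E₂| :=
        (abs_add_le _ _).trans (add_le_add h3 (abs_mul _ _).le)
      _ ≤ _ := by
        nlinarith [le_max_left C 0, abs_nonneg (E₁ - E₂), le_max_right C 0]

lemma exists_solvesOn {a b δ M L ε η : ℝ} (hM : 0 < M) (hL : 0 < L)
    (hb : ∀ θ ∈ Icc a b, ∀ E ε, |E - E₀| ≤ δ → |ε| ≤ δ →
      ContinuousAt R (θ, E, ε) ∧ |R (θ, E, ε)| ≤ M)
    (hl : ∀ θ ∈ Icc a b, ∀ E₁ E₂ ε, |E₁ - E₀| ≤ δ → |E₂ - E₀| ≤ δ → |ε| ≤ δ →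
        |R (θ, E₁, ε) - R (θ, E₂, ε)| ≤ L * |E₁ - E₂|)
    (hε0 : 0 ≤ ε) (hε : ε ≤ δ) (hη : 0 < η) (hηδ : η ≤ δ / 2) (hεη : ε * M * (b - a) ≤ η / 2)
    {θ₀ e : ℝ} (hθ₀ : θ₀ ∈ Icc a b) (he : |e - E₀| ≤ δ / 2) :
    ∃ u : ℝ → ℝ, u θ₀ = e ∧ ∀ θ ∈ Ioo a b,
      HasDerivAt u (ε * R (θ, u θ, ε)) θ ∧ |u θ - e| < η := by
  have hεa : |ε| ≤ δ := by rwa [abs_of_nonneg hε0]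
  have hball : ∀ x ∈ Metric.closedBall e η, |x - E₀| ≤ δ := by
    intro x hx
    rw [Metric.mem_closedBall, Real.dist_eq] at hx
    calc |x - E₀| = |(x - e) + (e - E₀)| := by ring_nf
      _ ≤ |x - e| + |e - E₀| := abs_add_le _ _
      _ ≤ δ := by linarith
  have hc1 : ((η.toNNReal : NNReal) : ℝ) = η := Real.coe_toNNReal _ hη.le
  have hc2 : (((ε * M).toNNReal : NNReal) : ℝ) = ε * M := Real.coe_toNNReal _ (by positivity)
  have hc3 : (((ε * L).toNNReal : NNReal) : ℝ) = ε * L := Real.coe_toNNReal _ (by positivity)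
  have hPL : IsPicardLindelof (fun θ x => ε * R (θ, x, ε)) (⟨θ₀, hθ₀⟩ : Icc a b) e
      η.toNNReal 0 (ε * M).toNNReal (ε * L).toNNReal := by
    refine ⟨?_, ?_, ?_, ?_⟩ <;> simp only [hc1, hc2]
    · intro t ht
      refine LipschitzOnWith.of_dist_le_mul fun x hx y hy => ?_
      rw [Real.dist_eq, Real.dist_eq, ← mul_sub, abs_mul, abs_of_nonneg hε0]
      rw [hc3, mul_assoc]
      exact mul_le_mul_of_nonneg_left (hl t ht x y ε (hball x hx) (hball y hy) hεa) hε0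
    · intro x hx t ht
      have h1 := (hb t ht x ε (hball x hx) hεa).1
      have h2 : ContinuousAt (fun t : ℝ => (t, x, ε)) t := by fun_prop
      exact (continuousAt_const.mul
        (ContinuousAt.comp (f := fun t : ℝ => (t, x, ε)) h1 h2)).continuousWithinAt
    · intro t ht x hx
      rw [Real.norm_eq_abs, abs_mul, abs_of_nonneg hε0]
      exact mul_le_mul_of_nonneg_left (hb t ht x ε (hball x hx) hεa).2 hε0
    · simp only [NNReal.coe_zero, sub_zero]
      have : max (b - θ₀) (θ₀ - a) ≤ b - a := max_le (by linarith [hθ₀.1]) (by linarith [hθ₀.2])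
      have := mul_le_mul_of_nonneg_left this (by positivity : 0 ≤ ε * M)
      linarith
  obtain ⟨u, hu0, hu⟩ := hPL.exists_eq_forall_mem_Icc_hasDerivWithinAt₀
  simp only at hu0
  -- the solution cannot leave the ball
  have hcont : ContinuousOn u (Icc a b) := fun t ht => (hu t ht).continuousWithinAt
  have hsub : ∀ θ₁ ∈ Icc a b, (∀ θ ∈ uIcc θ₀ θ₁, |u θ - e| ≤ η) → |u θ₁ - e| ≤ η / 2 := by
    intro θ₁ hθ₁ h
    have hss : uIcc θ₀ θ₁ ⊆ Icc a b := by
      rw [uIcc]; exact Icc_subset_Icc (le_min hθ₀.1 hθ₁.1) (max_le hθ₀.2 hθ₁.2)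
    have := Convex.norm_image_sub_le_of_norm_hasDerivWithin_le (f := u) (C := ε * M)
      (s := uIcc θ₀ θ₁) (x := θ₀) (y := θ₁)
      (fun x hx => (hu x (hss hx)).mono hss) (fun x hx => ?_) (convex_uIcc _ _) left_mem_uIcc
      right_mem_uIcc
    · rw [hu0] at this
      rw [Real.norm_eq_abs] at this
      refine this.trans (le_trans ?_ hεη)
      refine mul_le_mul_of_nonneg_left ?_ (by positivity)
      rw [Real.norm_eq_abs, abs_le]
      constructor <;> linarith [hθ₀.1, hθ₀.2, hθ₁.1, hθ₁.2]
    · rw [Real.norm_eq_abs, abs_mul, abs_of_nonneg hε0]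
      refine mul_le_mul_of_nonneg_left (hb x (hss hx) _ _ (hball _ ?_) hεa).2 hε0
      simpa [Real.dist_eq] using h x hx
  have hmain : ∀ θ₁ ∈ Icc a b, |u θ₁ - e| < η := by
    by_contra! hcon
    obtain ⟨θ₁, hθ₁, hbad⟩ := hcon
    have hss : uIcc θ₀ θ₁ ⊆ Icc a b := by
      rw [uIcc]; exact Icc_subset_Icc (le_min hθ₀.1 hθ₁.1) (max_le hθ₀.2 hθ₁.2)
    -- a nearest point where the deviation is `η`
    set S := uIcc θ₀ θ₁ ∩ (fun θ => |u θ - e|) ⁻¹' Ici η with hS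
    have hSc : IsCompact S := by
      refine isCompact_uIcc.of_isClosed_subset ?_ inter_subset_left
      exact ((hcont.mono hss).sub continuousOn_const).abs.preimage_isClosed_of_isClosed
        isClosed_Icc isClosed_Ici
    obtain ⟨θ₂, hθ₂, hmin⟩ := hSc.exists_isMinOn ⟨θ₁, right_mem_uIcc, hbad⟩
      (f := fun θ => |θ - θ₀|) (by fun_prop)
    have hθ₂η : η ≤ |u θ₂ - e| := hθ₂.2
    have hlt : ∀ θ ∈ uIcc θ₀ θ₂, θ ≠ θ₂ → |u θ - e| < η := by
      intro θ hθ hne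
      by_contra! hge
      have hmem : θ ∈ S := ⟨uIcc_subset_uIcc_left hθ₂.1 hθ, hge⟩
      have h1 : |θ₂ - θ₀| ≤ |θ - θ₀| := hmin hmem
      rcases le_total θ₀ θ₂ with h | h
      · rw [uIcc_of_le h] at hθ
        rw [abs_of_nonneg (by linarith), abs_of_nonneg (by linarith [hθ.1])] at h1
        exact hne (le_antisymm hθ.2 (by linarith))
      · rw [uIcc_of_ge h] at hθ
        rw [abs_of_nonpos (by linarith), abs_of_nonpos (by linarith [hθ.2])] at h1
        exact hne (le_antisymm (by linarith) hθ.1)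
    have hθ₂ne : θ₀ ≠ θ₂ := by
      rintro rfl; rw [hu0] at hθ₂η; simp at hθ₂η; linarith
    have hle : |u θ₂ - e| ≤ η := by
      have hcd : ContinuousOn (fun θ => |u θ - e|) (uIcc θ₀ θ₂) :=
        ((hcont.mono hss).mono (uIcc_subset_uIcc_left hθ₂.1)).sub continuousOn_const |>.abs
      have hcl : θ₂ ∈ closure (uIoo θ₀ θ₂) := by
        rw [uIoo, closure_Ioo (by simpa using hθ₂ne)]; exact right_mem_uIcc
      refine ContinuousWithinAt.closure_le (s := uIoo θ₀ θ₂) (f := fun θ => |u θ - e|)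
        (g := fun _ => η) hcl ?_ continuousWithinAt_const ?_
      · exact (hcd _ right_mem_uIcc).mono uIoo_subset_uIcc_self
      · intro y hy
        refine (hlt y (uIoo_subset_uIcc_self hy) ?_).le
        rintro rfl
        rw [uIoo] at hy
        rcases le_total θ₀ y with h | h
        · simp [h] at hy
        · simp [h] at hy
    have := hsub θ₂ (hss hθ₂.1) (fun θ hθ => by
      by_cases h : θ = θ₂
      · rw [h]; exact hle
      · exact (hlt θ hθ h).le)
    linarith
  refine ⟨u, hu0, fun θ hθ => ⟨?_, hmain θ ⟨hθ.1.le, hθ.2.le⟩⟩⟩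
  exact (hu θ ⟨hθ.1.le, hθ.2.le⟩).hasDerivAt (Icc_mem_nhds hθ.1 hθ.2)

end ScalarReturn

section PeriodicScalar

open Set Topology MeasureTheory intervalIntegral

lemma exists_periodic_extension {u : ℝ → ℝ} {g : ℝ → ℝ → ℝ} {T : ℝ} (hT : 0 < T)
    (hg : ∀ θ x, g (θ + T) x = g θ x)
    (hu : ∀ θ ∈ Ioo (-T) (2 * T), HasDerivAt u (g θ (u θ)) θ)
    (hper : ∀ θ ∈ Ioo (-T) T, u (θ + T) = u θ) :
    ∃ U : ℝ → ℝ, (∀ θ, U (θ + T) = U θ) ∧ (∀ θ, HasDerivAt U (g θ (U θ)) θ) ∧ U 0 = u 0 ∧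
      ∀ θ, ∃ θ' ∈ Ico 0 T, U θ = u θ' := by
  set U : ℝ → ℝ := fun θ => u (Int.fract (θ / T) * T) with hU
  have hgz : ∀ (n : ℤ) θ x, g (θ - n * T) x = g θ x := by
    intro n θ x
    have hp : Function.Periodic (fun θ => g θ x) T := fun θ => hg θ x
    exact hp.sub_int_mul_eq n
  have hfr : ∀ θ, Int.fract (θ / T) * T ∈ Ico 0 T := fun θ =>
    ⟨mul_nonneg (Int.fract_nonneg _) hT.le, by nlinarith [Int.fract_lt_one (θ / T)]⟩
  have hloc : ∀ (n : ℤ) θ, θ - n * T ∈ Ioo (-T) T → U θ = u (θ - n * T) := by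
    intro n θ hθ
    have h1 : Int.fract (θ / T) * T = θ - ⌊θ / T⌋ * T := by
      rw [Int.fract, sub_mul, div_mul_cancel₀ _ hT.ne']
    simp only [hU, h1]
    have h2 := hfr θ
    rw [h1] at h2
    have h3 : (n : ℝ) * T - ⌊θ / T⌋ * T < 2 * T := by linarith [h2.2, hθ.1, hθ.2]
    have h4 : -T < (n : ℝ) * T - ⌊θ / T⌋ * T := by linarith [h2.1, hθ.2]
    have h5 : ((n - ⌊θ / T⌋ : ℤ) : ℝ) < ((2 : ℤ) : ℝ) := by
      push_cast; exact lt_of_mul_lt_mul_right (by linarith) hT.le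
    have h6 : ((-1 : ℤ) : ℝ) < ((n - ⌊θ / T⌋ : ℤ) : ℝ) := by
      push_cast; exact lt_of_mul_lt_mul_right (by linarith) hT.le
    have h5 := Int.cast_lt.1 h5
    have h6 := Int.cast_lt.1 h6
    have : n = ⌊θ / T⌋ ∨ n = ⌊θ / T⌋ + 1 := by omega
    rcases this with h | h
    · rw [h]
    · have := hper _ hθ
      rw [h] at this ⊢
      rw [← this]; congr 1; push_cast; ring
  refine ⟨U, fun θ => ?_, fun θ => ?_, by simp [hU], fun θ => ⟨_, hfr θ, rfl⟩⟩
  · simp only [hU]; rw [add_div, div_self hT.ne', Int.fract_add_one]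
  · have h1 : Int.fract (θ / T) * T = θ - ⌊θ / T⌋ * T := by
      rw [Int.fract, sub_mul, div_mul_cancel₀ _ hT.ne']
    have h2 := hfr θ
    rw [h1] at h2
    have hmem : θ - ⌊θ / T⌋ * T ∈ Ioo (-T) T := ⟨by linarith [h2.1], h2.2⟩
    have hev : U =ᶠ[𝓝 θ] fun s => u (s - ⌊θ / T⌋ * T) := by
      have hc : ContinuousAt (fun s : ℝ => s - ⌊θ / T⌋ * T) θ := by fun_prop
      filter_upwards [hc.eventually (isOpen_Ioo.mem_nhds hmem)] with s hs
      exact hloc _ _ hs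
    have hd := hu _ ⟨hmem.1, by linarith [hmem.2]⟩
    rw [hgz] at hd
    have hcomp := hd.comp θ ((hasDerivAt_id θ).sub_const (⌊θ / T⌋ * T))
    rw [mul_one] at hcomp
    rw [hloc _ _ hmem]
    exact hcomp.congr_of_eventuallyEq hev

variable {R : ℝ × ℝ × ℝ → ℝ} {E₀ : ℝ}

lemma uniform_near {K : Set ℝ} (hK : IsCompact K) {e : ℝ}
    (hc : ∀ θ ∈ K, ContinuousAt R (θ, e, 0)) {κ : ℝ} (hκ : 0 < κ) :
    ∃ δ > 0, ∀ E ε, |E - e| < δ → |ε - 0| < δ → ∀ θ ∈ K,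
      |R (θ, E, ε) - R (θ, e, 0)| ≤ κ := by
  apply exists_pos_of_eventually_nhds_pair
    (P := fun E ε => ∀ θ ∈ K, |R (θ, E, ε) - R (θ, e, 0)| ≤ κ)
  refine hK.eventually_forall_of_forall_eventually (x₀ := (e, (0 : ℝ)))
    (P := fun z θ => |R (θ, z.1, z.2) - R (θ, e, 0)| ≤ κ) fun θ hθ => ?_
  have h1 : Tendsto (fun z : (ℝ × ℝ) × ℝ => R (z.2, z.1.1, z.1.2)) (𝓝 ((e, 0), θ))
      (𝓝 (R (θ, e, 0))) := by
    have : Continuous (fun z : (ℝ × ℝ) × ℝ => (z.2, z.1.1, z.1.2)) := by fun_prop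
    exact (hc θ hθ).tendsto.comp (this.tendsto ((e, 0), θ))
  have h2 : Tendsto (fun z : (ℝ × ℝ) × ℝ => R (z.2, e, 0)) (𝓝 ((e, 0), θ))
      (𝓝 (R (θ, e, 0))) := by
    have : Continuous (fun z : (ℝ × ℝ) × ℝ => (z.2, e, (0 : ℝ))) := by fun_prop
    exact (hc θ hθ).tendsto.comp (this.tendsto ((e, 0), θ))
  have h3 := (h1.sub h2).abs
  simp only [sub_self, abs_zero] at h3
  exact (h3.eventually (gt_mem_nhds hκ)).mono fun z hz => le_of_lt hz

lemma hasDerivAt_integral_uniform {K : Set ℝ} {a b : ℝ} (hab : a ≤ b) (hsub : Icc a b ⊆ K)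
    {ρ : ℝ → ℝ} (hρ : Continuous ρ) {δ₁ : ℝ} (hδ₁ : 0 < δ₁)
    (hc : ∀ θ ∈ K, ∀ E, |E - E₀| ≤ δ₁ → ContinuousAt R (θ, E, 0))
    (hs : ∀ κ > 0, ∃ δ > 0, ∀ θ ∈ K, ∀ E₁ E₂ ε,
      |E₁ - E₀| < δ → |E₂ - E₀| < δ → |ε| < δ →
      |R (θ, E₁, ε) - R (θ, E₂, ε) - ρ θ * (E₁ - E₂)| ≤ κ * |E₁ - E₂|) :
    HasDerivAt (fun E => ∫ θ in a..b, R (θ, E, 0)) (∫ θ in a..b, ρ θ) E₀ := by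
  have hii : ∀ E, |E - E₀| ≤ δ₁ → IntervalIntegrable (fun θ => R (θ, E, 0)) volume a b := by
    intro E hE
    refine ContinuousOn.intervalIntegrable fun θ hθ => ?_
    rw [uIcc_of_le hab] at hθ
    have h2 : ContinuousAt (fun t : ℝ => (t, E, (0 : ℝ))) θ := by fun_prop
    exact (ContinuousAt.comp (f := fun t : ℝ => (t, E, (0 : ℝ)))
      (hc θ (hsub hθ) E hE) h2).continuousWithinAt
  rw [hasDerivAt_iff_isLittleO, Asymptotics.isLittleO_iff]
  intro c hc0
  obtain ⟨δ, hδ, h⟩ := hs (c / (b - a + 1)) (by have : 0 ≤ b - a := by linarith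
                                                positivity)
  have hnear : ∀ᶠ E in 𝓝 E₀, |E - E₀| < min δ δ₁ := by
    have := Metric.ball_mem_nhds E₀ (lt_min hδ hδ₁)
    filter_upwards [this] with E hE
    simpa [Real.dist_eq] using hE
  filter_upwards [hnear] with E hE
  have hE1 : |E - E₀| < δ := lt_of_lt_of_le hE (min_le_left _ _)
  have hE2 : |E - E₀| ≤ δ₁ := (lt_of_lt_of_le hE (min_le_right _ _)).le
  have h0 : |E₀ - E₀| ≤ δ₁ := by simpa using hδ₁.le
  have e1 : (∫ θ in a..b, R (θ, E, 0)) - (∫ θ in a..b, R (θ, E₀, 0))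
      - (E - E₀) • (∫ θ in a..b, ρ θ) =
      ∫ θ in a..b, (R (θ, E, 0) - R (θ, E₀, 0) - ρ θ * (E - E₀)) := by
    rw [integral_sub ((hii E hE2).sub (hii E₀ h0))
      (show IntervalIntegrable (fun θ => ρ θ * (E - E₀)) volume a b from
        (hρ.mul continuous_const).intervalIntegrable _ _), integral_sub (hii E hE2) (hii E₀ h0),
      intervalIntegral.integral_mul_const, smul_eq_mul, mul_comm]
  rw [e1]
  have := norm_integral_le_of_norm_le_const (a := a) (b := b)
    (f := fun θ => R (θ, E, 0) - R (θ, E₀, 0) - ρ θ * (E - E₀))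
    (C := c / (b - a + 1) * |E - E₀|) (fun θ hθ => by
      rw [uIoc_of_le hab] at hθ
      exact h θ (hsub ⟨hθ.1.le, hθ.2⟩) E E₀ 0 hE1 (by simpa using hδ) (by simpa using hδ))
  refine this.trans ?_
  have hba : 0 ≤ b - a := by linarith
  rw [abs_of_nonneg hba, Real.norm_eq_abs]
  rw [div_mul_eq_mul_div, div_mul_eq_mul_div, div_le_iff₀ (by linarith)]
  nlinarith [mul_nonneg hc0.le (abs_nonneg (E - E₀))]

lemma sign_near_simple_zero {F : ℝ → ℝ} {D x₀ : ℝ} (hF : HasDerivAt F D x₀) (h0 : F x₀ = 0)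
    (hD : D ≠ 0) : ∀ᶠ s in 𝓝[>] (0 : ℝ), 0 < D * F (x₀ + s) ∧ D * F (x₀ - s) < 0 := by
  have h1 := (hF.const_mul D)
  have hpos : 0 < D * D := mul_self_pos.2 hD
  have h2 := (hasDerivAt_iff_tendsto_slope.1 h1).eventually (lt_mem_nhds hpos)
  rw [eventually_nhdsWithin_iff] at h2
  have hp : Tendsto (fun s : ℝ => x₀ + s) (𝓝 0) (𝓝 x₀) := by
    have : Continuous fun s : ℝ => x₀ + s := by fun_prop
    simpa using this.tendsto 0
  have hm : Tendsto (fun s : ℝ => x₀ - s) (𝓝 0) (𝓝 x₀) := by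
    have : Continuous fun s : ℝ => x₀ - s := by fun_prop
    simpa using this.tendsto 0
  filter_upwards [nhdsWithin_le_nhds (hp.eventually h2), nhdsWithin_le_nhds (hm.eventually h2),
    self_mem_nhdsWithin] with s h3 h4 hs
  rw [mem_Ioi] at hs
  have h3 := h3 (by simp [hs.ne'])
  have h4 := h4 (by simp [hs.ne'])
  simp only [slope_def_field, h0, mul_zero, sub_zero, add_sub_cancel_left] at h3 h4
  refine ⟨by rwa [lt_div_iff₀ hs, zero_mul] at h3, ?_⟩
  have : x₀ - s - x₀ = -s := by ring
  rw [this, div_neg, ← neg_div, lt_div_iff₀ hs] at h4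
  linarith

end PeriodicScalar

section ScalarMain

open Set Topology MeasureTheory intervalIntegral Real

variable {R : ℝ × ℝ × ℝ → ℝ} {E₀ : ℝ}

set_option maxHeartbeats 1600000 in
theorem exists_isolated_periodic_scalar (hR : ∀ θ, ContDiffAt ℝ 1 R (θ, E₀, 0))
    (hper : ∀ θ E ε, R (θ + 2 * π, E, ε) = R (θ, E, ε))
    (h0 : ∫ θ in (0 : ℝ)..2 * π, R (θ, E₀, 0) = 0) {D : ℝ}
    (hD : HasDerivAt (fun E => ∫ θ in (0 : ℝ)..2 * π, R (θ, E, 0)) D E₀) (hD0 : D ≠ 0)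
    {δ₀ : ℝ} (hδ₀ : 0 < δ₀) :
    ∃ η > 0, η ≤ δ₀ ∧ ∃ ε₀ > 0, ∀ ε, 0 < ε → ε ≤ ε₀ →
      (∀ θ₀ ∈ Icc (-2 * π) (2 * π), ∀ e, |e - E₀| ≤ η →
        ∃ u : ℝ → ℝ, u θ₀ = e ∧ SolvesOn R E₀ ε δ₀ u (Icc (-2 * π) (4 * π))) ∧
      ∃ us : ℝ → ℝ, (∀ θ, us (θ + 2 * π) = us θ) ∧
        (∀ θ, HasDerivAt us (ε * R (θ, us θ, ε)) θ ∧ |us θ - E₀| < η) ∧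
        ∀ K : Set ℝ, IsCompact K → K.Nonempty → K ⊆ Icc (E₀ - η) (E₀ + η) →
          (∀ e ∈ K, ∀ u : ℝ → ℝ, u 0 = e → SolvesOn R E₀ ε δ₀ u (Icc 0 (2 * π)) →
            u (2 * π) ∈ K) → us 0 ∈ K := by
  have hπ := Real.pi_pos
  have hJ : IsCompact (Icc (-3 * π) (5 * π)) := isCompact_Icc
  obtain ⟨δ₁, hδ₁, M, hM, L, hL, hb, hl⟩ := exists_bounds hR hJ
  obtain ⟨ρ, hρ, hs⟩ := exists_uniform_strict hR hJ
  have hsubJ : Icc 0 (2 * π) ⊆ Icc (-3 * π) (5 * π) :=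
    Icc_subset_Icc (by linarith) (by linarith)
  have hρD : ∫ θ in (0 : ℝ)..2 * π, ρ θ = D := by
    refine (hasDerivAt_integral_uniform (by positivity) hsubJ hρ hδ₁ ?_ hs).unique hD
    exact fun θ hθ E hE => (hb θ hθ E 0 hE (by simpa using hδ₁.le)).1
  set κ := |D| / (4 * π) with hκ
  have hκ0 : 0 < κ := by have := abs_pos.2 hD0; positivity
  obtain ⟨δ₂, hδ₂, hs⟩ := hs κ hκ0
  -- the radius of the tube
  set δ := min δ₀ (min δ₁ δ₂) with hδ
  have hδpos : 0 < δ := by positivity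
  have hδle0 : δ ≤ δ₀ := min_le_left _ _
  have hδle1 : δ ≤ δ₁ := (min_le_right _ _).trans (min_le_left _ _)
  have hδle2 : δ ≤ δ₂ := (min_le_right _ _).trans (min_le_right _ _)
  set F : ℝ → ℝ := fun E => ∫ θ in (0 : ℝ)..2 * π, R (θ, E, 0) with hF
  obtain ⟨s, hs0, hslt, hsp, hsm⟩ : ∃ s, 0 < s ∧ s < δ / 4 ∧ 0 < D * F (E₀ + s) ∧
      D * F (E₀ - s) < 0 := by
    have h1 := sign_near_simple_zero hD h0 hD0
    have h2 : ∀ᶠ s in 𝓝[>] (0 : ℝ), s < δ / 4 :=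
      nhdsWithin_le_nhds (gt_mem_nhds (by positivity))
    obtain ⟨s, ⟨h3, h4⟩, h5⟩ := ((h1.and h2).and self_mem_nhdsWithin).exists
    exact ⟨s, h5, h4, h3.1, h3.2⟩
  -- closeness of the first return map to its averaged approximation
  set μ := min |F (E₀ + s)| |F (E₀ - s)| / (4 * π) with hμ
  have hμ0 : 0 < μ := by
    have h1 : 0 < |F (E₀ + s)| := abs_pos.2 (right_ne_zero_of_mul hsp.ne')
    have h2 : 0 < |F (E₀ - s)| := abs_pos.2 (right_ne_zero_of_mul hsm.ne)
    have := lt_min h1 h2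
    positivity
  have hcn : ∀ e, |e - E₀| ≤ δ₁ → ∀ θ ∈ Icc (-3 * π) (5 * π), ContinuousAt R (θ, e, 0) :=
    fun e he θ hθ => (hb θ hθ e 0 he (by simpa using hδ₁.le)).1
  have habsp : |E₀ + s - E₀| = s := by rw [add_sub_cancel_left, abs_of_pos hs0]
  have habsm : |E₀ - s - E₀| = s := by
    rw [show E₀ - s - E₀ = -s by ring, abs_neg, abs_of_pos hs0]
  obtain ⟨δ₃, hδ₃, h3⟩ := uniform_near hJ (hcn (E₀ + s) (by rw [habsp]; linarith)) hμ0
  obtain ⟨δ₄, hδ₄, h4⟩ := uniform_near hJ (hcn (E₀ - s) (by rw [habsm]; linarith)) hμ0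
  set ν := min s (min δ₃ δ₄) with hν
  have hνpos : 0 < ν := by positivity
  have hνs : ν ≤ s := min_le_left _ _
  have hν3 : ν ≤ δ₃ := (min_le_right _ _).trans (min_le_left _ _)
  have hν4 : ν ≤ δ₄ := (min_le_right _ _).trans (min_le_right _ _)
  refine ⟨2 * s, by positivity, by linarith, min (ν / (2 * (M * (8 * π)))) (min (δ / 2) (ν / 2)),
    by positivity, fun ε hε hεle => ?_⟩
  have hε1 : ε * M * (5 * π - -3 * π) ≤ ν / 2 := by
    have := hεle.trans (min_le_left _ _)
    rw [le_div_iff₀ (by positivity)] at this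
    linarith
  have hε2 : ε ≤ δ / 2 := (hεle.trans (min_le_right _ _)).trans (min_le_left _ _)
  have hε3 : ε ≤ ν / 2 := (hεle.trans (min_le_right _ _)).trans (min_le_right _ _)
  have hεabs : |ε| = ε := abs_of_pos hε
  have hsol : ∀ θ₀ ∈ Icc (-2 * π) (2 * π), ∀ e, |e - E₀| ≤ 2 * s →
      ∃ u : ℝ → ℝ, u θ₀ = e ∧ SolvesOn R E₀ ε δ u (Icc (-2 * π) (4 * π)) ∧
        ∀ θ ∈ Icc (-2 * π) (4 * π), |u θ - e| < ν := by
    intro θ₀ hθ₀ e he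
    obtain ⟨u, hu0, hu⟩ := exists_solvesOn (R := R) (E₀ := E₀) (δ := δ) (η := ν) hM hL
      (fun θ hθ E ε' h1 h2 => hb θ hθ E ε' (h1.trans hδle1) (h2.trans hδle1))
      (fun θ hθ E₁ E₂ ε' h1 h2 h3 => hl θ hθ E₁ E₂ ε' (h1.trans hδle1) (h2.trans hδle1)
        (h3.trans hδle1)) hε.le (by linarith) hνpos (by linarith) hε1
      (θ₀ := θ₀) (e := e) ⟨by linarith [hθ₀.1], by linarith [hθ₀.2]⟩ (by linarith)
    have hmem : ∀ θ ∈ Icc (-2 * π) (4 * π), θ ∈ Ioo (-3 * π) (5 * π) := fun θ hθ =>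
      ⟨by linarith [hθ.1], by linarith [hθ.2]⟩
    refine ⟨u, hu0, fun θ hθ => ⟨(hu θ (hmem θ hθ)).1, ?_⟩, fun θ hθ => (hu θ (hmem θ hθ)).2⟩
    have := (hu θ (hmem θ hθ)).2
    calc |u θ - E₀| = |(u θ - e) + (e - E₀)| := by ring_nf
      _ ≤ |u θ - e| + |e - E₀| := abs_add_le _ _
      _ < δ := by linarith
  -- comparison of two solutions
  have hcmp : ∀ u₁ u₂ : ℝ → ℝ, SolvesOn R E₀ ε δ u₁ (Icc 0 (2 * π)) →
      SolvesOn R E₀ ε δ u₂ (Icc 0 (2 * π)) →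
      (u₁ (2 * π) - u₂ (2 * π)) ^ 2 ≤
        (u₁ 0 - u₂ 0) ^ 2 * Real.exp (2 * (ε * (D + |D| / 2))) ∧
      (u₁ 0 - u₂ 0) ^ 2 * Real.exp (2 * (ε * (D - |D| / 2))) ≤
        (u₁ (2 * π) - u₂ (2 * π)) ^ 2 := by
    intro u₁ u₂ hu₁ hu₂
    have hest : ∀ θ ∈ Icc 0 (2 * π), |R (θ, u₁ θ, ε) - R (θ, u₂ θ, ε) - ρ θ * (u₁ θ - u₂ θ)| ≤
        κ * |u₁ θ - u₂ θ| := fun θ hθ =>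
      hs θ (hsubJ hθ) _ _ ε ((hu₁ θ hθ).2.trans_le hδle2) ((hu₂ θ hθ).2.trans_le hδle2)
        (by rw [hεabs]; linarith)
    have hprod : ∀ θ ∈ Icc 0 (2 * π), |(u₁ θ - u₂ θ) *
        (R (θ, u₁ θ, ε) - R (θ, u₂ θ, ε) - ρ θ * (u₁ θ - u₂ θ))| ≤ κ * (u₁ θ - u₂ θ) ^ 2 := by
      intro θ hθ
      rw [abs_mul, ← sq_abs (u₁ θ - u₂ θ)]
      nlinarith [hest θ hθ, abs_nonneg (u₁ θ - u₂ θ)]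
    have hdv : ∀ θ ∈ Icc 0 (2 * π), HasDerivAt (fun θ => u₁ θ - u₂ θ)
        (ε * R (θ, u₁ θ, ε) - ε * R (θ, u₂ θ, ε)) θ := fun θ hθ =>
      (hu₁ θ hθ).1.sub (hu₂ θ hθ).1
    have hκπ : κ * (2 * π) = |D| / 2 := by rw [hκ]; field_simp; norm_num
    have hint : ∀ k : ℝ, ∫ θ in (0 : ℝ)..2 * π, ε * (ρ θ + k) = ε * (D + k * (2 * π)) := by
      intro k
      rw [intervalIntegral.integral_const_mul, integral_add (hρ.intervalIntegrable _ _)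
        (continuous_const.intervalIntegrable _ _), hρD,
        intervalIntegral.integral_const, smul_eq_mul]
      ring
    constructor
    · have := sq_le_of_mul_deriv_le (v := fun θ => u₁ θ - u₂ θ)
        (σ := fun θ => ε * (ρ θ + κ)) (T := 2 * π) (by positivity) (by fun_prop) hdv
        (fun θ hθ => by
          have := (abs_le.1 (hprod θ hθ)).2
          nlinarith [mul_le_mul_of_nonneg_left this hε.le])
      rwa [hint, hκπ] at this
    · have := le_sq_of_le_mul_deriv (v := fun θ => u₁ θ - u₂ θ)
        (σ := fun θ => ε * (ρ θ + -κ)) (T := 2 * π) (by positivity) (by fun_prop) hdv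
        (fun θ hθ => by
          have := (abs_le.1 (hprod θ hθ)).1
          nlinarith [mul_le_mul_of_nonneg_left this hε.le])
      rwa [hint, neg_mul, hκπ, ← sub_eq_add_neg] at this
  have hJ2 : Icc 0 (2 * π) ⊆ Icc (-2 * π) (4 * π) :=
    Icc_subset_Icc (by linarith) (by linarith)
  have h0mem : (0 : ℝ) ∈ Icc (-2 * π) (2 * π) := ⟨by linarith, by linarith⟩
  choose! U hU0 hUs hUν using hsol 0 h0mem
  have hends : ∀ e, |e - E₀| = s → (∀ E ε, |E - e| < ν → |ε - 0| < ν →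
      ∀ θ ∈ Icc (-3 * π) (5 * π), |R (θ, E, ε) - R (θ, e, 0)| ≤ μ) → 2 * π * μ < |F e| →
      0 < (D * F e) * (D * (U e (2 * π) - e)) := by
    intro e he hnear hlt
    have he2 : |e - E₀| ≤ 2 * s := by linarith
    have hcR : ∀ θ ∈ Icc 0 (2 * π), ContinuousAt (fun θ => R (θ, U e θ, ε)) θ := by
      intro θ hθ
      have h1 := (hb θ (hsubJ hθ) (U e θ) ε
        ((hUs e he2 θ (hJ2 hθ)).2.le.trans hδle1) (by rw [hεabs]; linarith)).1
      have h2 : ContinuousAt (fun θ => (θ, U e θ, ε)) θ :=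
        continuousAt_id.prodMk ((hUs e he2 θ (hJ2 hθ)).1.continuousAt.prodMk continuousAt_const)
      exact ContinuousAt.comp (f := fun θ => (θ, U e θ, ε)) h1 h2
    have hcR0 : ∀ θ ∈ Icc 0 (2 * π), ContinuousAt (fun θ => R (θ, e, 0)) θ := by
      intro θ hθ
      have h1 := hcn e (by linarith) θ (hsubJ hθ)
      have h2 : ContinuousAt (fun θ : ℝ => (θ, e, (0 : ℝ))) θ := by fun_prop
      exact ContinuousAt.comp (f := fun θ : ℝ => (θ, e, (0 : ℝ))) h1 h2
    have hui : uIcc 0 (2 * π) = Icc 0 (2 * π) := uIcc_of_le (by positivity)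
    have hi1 : IntervalIntegrable (fun θ => R (θ, U e θ, ε)) volume 0 (2 * π) :=
      ContinuousOn.intervalIntegrable fun θ hθ => (hcR θ (hui ▸ hθ)).continuousWithinAt
    have hi2 : IntervalIntegrable (fun θ => R (θ, e, 0)) volume 0 (2 * π) :=
      ContinuousOn.intervalIntegrable fun θ hθ => (hcR0 θ (hui ▸ hθ)).continuousWithinAt
    have hftc : U e (2 * π) - e = ε * ∫ θ in (0 : ℝ)..2 * π, R (θ, U e θ, ε) := by
      rw [← intervalIntegral.integral_const_mul, integral_eq_sub_of_hasDerivAt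
        (fun θ hθ => (hUs e he2 θ (hJ2 (hui ▸ hθ))).1) (hi1.const_mul ε), hU0 e he2]
    have hdiff : |(∫ θ in (0 : ℝ)..2 * π, R (θ, U e θ, ε)) - F e| ≤ 2 * π * μ := by
      rw [hF, ← integral_sub hi1 hi2]
      have := norm_integral_le_of_norm_le_const (a := 0) (b := 2 * π) (C := μ)
        (f := fun θ => R (θ, U e θ, ε) - R (θ, e, 0)) (fun θ hθ => by
          rw [uIoc_of_le (by positivity)] at hθ
          have hθ' : θ ∈ Icc 0 (2 * π) := ⟨hθ.1.le, hθ.2⟩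
          exact hnear _ ε (hUν e he2 θ (hJ2 hθ')) (by rw [sub_zero, hεabs]; linarith) θ
            (hsubJ hθ'))
      rw [Real.norm_eq_abs, sub_zero, abs_of_pos (by positivity : 0 < 2 * π)] at this
      linarith
    set I := ∫ θ in (0 : ℝ)..2 * π, R (θ, U e θ, ε)
    have hFI : 0 < F e * I := by
      have h5 := abs_le.1 (hdiff.trans hlt.le)
      rcases abs_cases (F e) with ⟨h6, h7⟩ | ⟨h6, h7⟩
      · have h8 : 0 < F e := by rw [← h6]; exact lt_of_le_of_lt (by positivity) hlt
        have := (abs_le.1 hdiff).1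
        exact mul_pos h8 (by linarith)
      · have := (abs_le.1 hdiff).2
        exact mul_pos_of_neg_of_neg h7 (by linarith)
    rw [hftc]
    have : (D * F e) * (D * (ε * I)) = D ^ 2 * ε * (F e * I) := by ring
    rw [this]
    positivity
  have hμlt : 2 * π * μ < |F (E₀ + s)| ∧ 2 * π * μ < |F (E₀ - s)| := by
    have h1 : 0 < |F (E₀ + s)| := abs_pos.2 (right_ne_zero_of_mul hsp.ne')
    have h2 : 0 < |F (E₀ - s)| := abs_pos.2 (right_ne_zero_of_mul hsm.ne)
    have h3 : 2 * π * μ = min |F (E₀ + s)| |F (E₀ - s)| / 2 := by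
      rw [hμ]; field_simp; norm_num
    have := lt_min h1 h2
    rw [h3]
    constructor
    · linarith [min_le_left |F (E₀ + s)| |F (E₀ - s)|]
    · linarith [min_le_right |F (E₀ + s)| |F (E₀ - s)|]
  have hPp : 0 < D * (U (E₀ + s) (2 * π) - (E₀ + s)) :=
    (mul_pos_iff_of_pos_left hsp).1 (hends (E₀ + s) habsp
      (fun E ε h1 h2 => h3 E ε (h1.trans_le hν3) (h2.trans_le hν3)) hμlt.1)
  have hPm : D * (U (E₀ - s) (2 * π) - (E₀ - s)) < 0 := by
    have := hends (E₀ - s) habsm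
      (fun E ε h1 h2 => h4 E ε (h1.trans_le hν4) (h2.trans_le hν4)) hμlt.2
    by_contra! hcon
    exact absurd this (not_lt.2 (mul_nonpos_of_nonpos_of_nonneg hsm.le hcon))
  have hPc : ContinuousOn (fun e => D * (U e (2 * π) - e)) (Icc (E₀ - s) (E₀ + s)) := by
    refine continuousOn_const.mul (ContinuousOn.sub ?_ continuousOn_id)
    refine LipschitzOnWith.continuousOn
      (K := (Real.exp (ε * (D + |D| / 2))).toNNReal) ?_
    refine LipschitzOnWith.of_dist_le_mul fun e₁ he₁ e₂ he₂ => ?_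
    have h1 : |e₁ - E₀| ≤ 2 * s := abs_le.2 ⟨by linarith [he₁.1], by linarith [he₁.2]⟩
    have h2 : |e₂ - E₀| ≤ 2 * s := abs_le.2 ⟨by linarith [he₂.1], by linarith [he₂.2]⟩
    have := (hcmp _ _ ((hUs e₁ h1).mono hJ2) ((hUs e₂ h2).mono hJ2)).1
    rw [hU0 e₁ h1, hU0 e₂ h2, two_mul (ε * _), Real.exp_add, ← sq, ← mul_pow] at this
    rw [Real.coe_toNNReal _ (Real.exp_pos _).le, Real.dist_eq, Real.dist_eq]
    have h5 := sq_le_sq.1 this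
    rw [abs_mul, abs_of_pos (Real.exp_pos _)] at h5
    linarith
  obtain ⟨es, hes, hzero⟩ := intermediate_value_Icc (by linarith) hPc
    (show (0 : ℝ) ∈ Icc _ _ from ⟨hPm.le, hPp.le⟩)
  have hesabs : |es - E₀| ≤ s := abs_le.2 ⟨by linarith [hes.1], by linarith [hes.2]⟩
  have hes2 : |es - E₀| ≤ 2 * s := by linarith
  have hfix : U es (2 * π) = es := by
    have := (mul_eq_zero.1 hzero).resolve_left hD0
    linarith
  -- periodicity of the solution through the fixed point
  have hgper : ∀ θ x, ε * R (θ + 2 * π, x, ε) = ε * R (θ, x, ε) := fun θ x => by rw [hper]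
  have huper : ∀ θ ∈ Ioo (-(2 * π)) (2 * π), U es (θ + 2 * π) = U es θ := by
    have huniq := ODE_solution_unique_of_mem_Ioo (a := -(2 * π)) (b := 2 * π) (t₀ := 0)
      (v := fun θ x => ε * R (θ, x, ε)) (s := fun _ => {x | |x - E₀| < δ})
      (K := (ε * L).toNNReal) (f := fun θ => U es (θ + 2 * π)) (g := U es) ?_
      ⟨by linarith, by linarith⟩ ?_ ?_ ?_
    · exact fun θ hθ => huniq hθ
    · intro t ht
      refine LipschitzOnWith.of_dist_le_mul fun x hx y hy => ?_
      rw [Real.dist_eq, Real.dist_eq, ← mul_sub, abs_mul, hεabs,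
        Real.coe_toNNReal _ (by positivity), mul_assoc]
      exact mul_le_mul_of_nonneg_left (hl t ⟨by linarith [ht.1], by linarith [ht.2]⟩ x y ε
        (hx.le.trans hδle1) (hy.le.trans hδle1) (by rw [hεabs]; linarith)) hε.le
    · intro t ht
      have := hUs es hes2 (t + 2 * π) ⟨by linarith [ht.1], by linarith [ht.2]⟩
      refine ⟨?_, this.2⟩
      have h6 := this.1.comp t ((hasDerivAt_id t).add_const (2 * π))
      rw [mul_one, hgper] at h6
      exact h6
    · intro t ht
      exact hUs es hes2 t ⟨by linarith [ht.1], by linarith [ht.2]⟩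
    · simp only [zero_add]; rw [hfix, hU0 es hes2]
  obtain ⟨us, hus1, hus2, hus3, hus4⟩ := exists_periodic_extension (u := U es)
    (g := fun θ x => ε * R (θ, x, ε)) (T := 2 * π) (by positivity) hgper
    (fun θ hθ => (hUs es hes2 θ ⟨by linarith [hθ.1], by linarith [hθ.2]⟩).1) huper
  rw [hU0 es hes2] at hus3
  refine ⟨fun θ₀ hθ₀ e he => ?_, us, hus1, fun θ => ⟨hus2 θ, ?_⟩, ?_⟩
  · obtain ⟨u, hu, hu', -⟩ := hsol θ₀ hθ₀ e he
    exact ⟨u, hu, fun θ hθ => ⟨(hu' θ hθ).1, (hu' θ hθ).2.trans_le hδle0⟩⟩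
  · obtain ⟨θ', hθ', h⟩ := hus4 θ
    have := hUν es hes2 θ' ⟨by linarith [hθ'.1], by linarith [hθ'.2]⟩
    rw [h]
    calc |U es θ' - E₀| = |(U es θ' - es) + (es - E₀)| := by ring_nf
      _ ≤ |U es θ' - es| + |es - E₀| := abs_add_le _ _
      _ < 2 * s := by linarith
  · intro K hK hKne hKsub hKmap
    rw [hus3]
    have hKs : ∀ e ∈ K, |e - E₀| ≤ 2 * s := fun e he =>
      abs_le.2 ⟨by linarith [(hKsub he).1], by linarith [(hKsub he).2]⟩
    have hKP : ∀ e ∈ K, U e (2 * π) ∈ K := fun e he =>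
      hKmap e he (U e) (hU0 e (hKs e he)) fun θ hθ =>
        ⟨(hUs e (hKs e he) θ (hJ2 hθ)).1, (hUs e (hKs e he) θ (hJ2 hθ)).2.trans_le hδle0⟩
    have hcmpK : ∀ e ∈ K, (U e (2 * π) - es) ^ 2 ≤
        (e - es) ^ 2 * Real.exp (2 * (ε * (D + |D| / 2))) ∧
        (e - es) ^ 2 * Real.exp (2 * (ε * (D - |D| / 2))) ≤ (U e (2 * π) - es) ^ 2 := by
      intro e he
      have := hcmp (U e) (U es) ((hUs e (hKs e he)).mono hJ2) ((hUs es hes2).mono hJ2)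
      rwa [hfix, hU0 e (hKs e he), hU0 es hes2] at this
    have hcf : ContinuousOn (fun e => (e - es) ^ 2) K := by fun_prop
    rcases lt_or_gt_of_ne hD0 with hneg | hpos
    · obtain ⟨e, he, hmin⟩ := hK.exists_isMinOn hKne hcf
      have h1 := (hcmpK e he).1
      have h2 : (e - es) ^ 2 ≤ (U e (2 * π) - es) ^ 2 := hmin (hKP e he)
      have h3 : Real.exp (2 * (ε * (D + |D| / 2))) < 1 := by
        rw [Real.exp_lt_one_iff, abs_of_neg hneg]; nlinarith
      have h4 : e = es := by
        by_contra hne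
        have : 0 < (e - es) ^ 2 := by have := sub_ne_zero.2 hne; positivity
        nlinarith
      rwa [← h4]
    · obtain ⟨e, he, hmax⟩ := hK.exists_isMaxOn hKne hcf
      have h1 := (hcmpK e he).2
      have h2 : (U e (2 * π) - es) ^ 2 ≤ (e - es) ^ 2 := hmax (hKP e he)
      have h3 : 1 < Real.exp (2 * (ε * (D - |D| / 2))) := by
        rw [Real.one_lt_exp_iff, abs_of_pos hpos]
        have := mul_pos hε hpos; nlinarith
      have h4 : e = es := by
        by_contra hne
        have : 0 < (e - es) ^ 2 := by have := sub_ne_zero.2 hne; positivity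
        nlinarith
      rwa [← h4]

end ScalarMain

section PolarLimitCycle

open Set Topology MeasureTheory intervalIntegral Real

lemma exists_lipschitzOnWith_closedBall {V : ℝ × ℝ → ℝ × ℝ} (hV : ContDiff ℝ 1 V) (r : ℝ) :
    ∃ K, LipschitzOnWith K V (Metric.closedBall 0 r) :=
  (hV.locallyLipschitz.locallyLipschitzOn (s := _)).exists_lipschitzOnWith_of_compact
    (isCompact_closedBall _ _)

lemma Function.Periodic.isCompact_range_of_continuous {X : Type*} [TopologicalSpace X]
    {γ : ℝ → X} {T : ℝ} (hT : 0 < T) (hγ : Function.Periodic γ T) (hc : Continuous γ) :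
    IsCompact (range γ) := by
  rw [← hγ.image_Icc hT 0]
  exact isCompact_Icc.image hc

/-- A reparametrized solution curve starting on a periodic orbit stays on it. -/
lemma mem_range_of_reparam {V : ℝ × ℝ → ℝ × ℝ} (hV : ContDiff ℝ 1 V) {γ : ℝ → ℝ × ℝ}
    (hγ : ∀ t, HasDerivAt γ (V (γ t)) t) {T : ℝ} (hT : 0 < T) (hper : Function.Periodic γ T)
    {a b : ℝ} (hab : a ≤ b) {c : ℝ → ℝ × ℝ} {ω : ℝ → ℝ} (hω : ContinuousOn ω (Icc a b))
    (hc : ∀ θ ∈ Icc a b, HasDerivAt c (ω θ • V (c θ)) θ) {t₀ : ℝ} (h0 : γ t₀ = c a) :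
    ∀ θ ∈ Icc a b, c θ ∈ range γ := by
  have hγc : Continuous γ := continuous_iff_continuousAt.2 fun t => (hγ t).continuousAt
  have hcc : ContinuousOn c (Icc a b) := fun θ hθ => (hc θ hθ).continuousAt.continuousWithinAt
  set ω' : ℝ → ℝ := IccExtend hab ((Icc a b).domRestrict ω) with hω'
  have hω'c : Continuous ω' := hω.domRestrict.Icc_extend'
  have hωω' : ∀ θ ∈ Icc a b, ω' θ = ω θ := fun θ hθ => by
    rw [hω', IccExtend_of_mem hab _ hθ]; rfl
  obtain ⟨r₁, hr₁⟩ := (hper.isCompact_range_of_continuous hT hγc).isBounded.subset_closedBall 0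
  obtain ⟨r₂, hr₂⟩ := (isCompact_Icc.image_of_continuousOn hcc).isBounded.subset_closedBall 0
  obtain ⟨K, hK⟩ := exists_lipschitzOnWith_closedBall hV (max r₁ r₂)
  obtain ⟨C, hC⟩ := isCompact_Icc.exists_bound_of_continuousOn (hω'c.continuousOn (s := Icc a b))
  set σ : ℝ → ℝ := fun θ => t₀ + ∫ s in a..θ, ω' s with hσ
  have hσd : ∀ θ, HasDerivAt σ (ω' θ) θ := fun θ =>
    (integral_hasDerivAt_right (hω'c.intervalIntegrable _ _)
      hω'c.aestronglyMeasurable.stronglyMeasurableAtFilter hω'c.continuousAt).const_add t₀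
  have hγσ : ∀ θ, HasDerivAt (fun θ => γ (σ θ)) (ω' θ • V (γ (σ θ))) θ := fun θ =>
    (hγ (σ θ)).scomp θ (hσd θ)
  have heq := ODE_solution_unique_of_mem_Icc_right (f := fun θ => γ (σ θ)) (g := c)
    (v := fun θ x => ω' θ • V x) (s := fun _ => Metric.closedBall 0 (max r₁ r₂))
    (a := a) (b := b) (K := C.toNNReal * K) ?_
    (fun θ _ => (hγσ θ).continuousAt.continuousWithinAt)
    (fun θ _ => (hγσ θ).hasDerivWithinAt)
    (fun θ _ => Metric.closedBall_subset_closedBall (le_max_left _ _) (hr₁ (mem_range_self _)))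
    hcc (fun θ hθ => ?_)
    (fun θ hθ => Metric.closedBall_subset_closedBall (le_max_right _ _)
      (hr₂ (mem_image_of_mem _ (Ico_subset_Icc_self hθ)))) (by simp [hσ, h0])
  · exact fun θ hθ => ⟨σ θ, heq hθ⟩
  · intro t ht
    refine LipschitzOnWith.of_dist_le_mul fun x hx y hy => ?_
    have h1 := hK.dist_le_mul x hx y hy
    have h2 := hC t (Ico_subset_Icc_self ht)
    have h3 : 0 ≤ C := (norm_nonneg _).trans h2
    rw [dist_smul₀, NNReal.coe_mul, Real.coe_toNNReal _ h3, mul_assoc]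
    exact mul_le_mul h2 h1 dist_nonneg h3
  · have := hc θ (Ico_subset_Icc_self hθ)
    rw [← hωω' θ (Ico_subset_Icc_self hθ)] at this
    exact this.hasDerivWithinAt

lemma range_eq_of_common_point {V : ℝ × ℝ → ℝ × ℝ} (hV : ContDiff ℝ 1 V) {γ₁ γ₂ : ℝ → ℝ × ℝ}
    (hγ₁ : ∀ t, HasDerivAt γ₁ (V (γ₁ t)) t) (hγ₂ : ∀ t, HasDerivAt γ₂ (V (γ₂ t)) t)
    {T₁ T₂ : ℝ} (hT₁ : 0 < T₁) (hT₂ : 0 < T₂) (hp₁ : Function.Periodic γ₁ T₁)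
    (hp₂ : Function.Periodic γ₂ T₂) {t₁ t₂ : ℝ} (h : γ₁ t₁ = γ₂ t₂) :
    range γ₁ = range γ₂ := by
  have hc₁ : Continuous γ₁ := continuous_iff_continuousAt.2 fun t => (hγ₁ t).continuousAt
  have hc₂ : Continuous γ₂ := continuous_iff_continuousAt.2 fun t => (hγ₂ t).continuousAt
  obtain ⟨r₁, hr₁⟩ := (hp₁.isCompact_range_of_continuous hT₁ hc₁).isBounded.subset_closedBall 0
  obtain ⟨r₂, hr₂⟩ := (hp₂.isCompact_range_of_continuous hT₂ hc₂).isBounded.subset_closedBall 0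
  obtain ⟨K, hK⟩ := exists_lipschitzOnWith_closedBall hV (max r₁ r₂)
  have heq : γ₁ = fun t => γ₂ (t + (t₂ - t₁)) := by
    refine ODE_solution_unique_univ (v := fun _ => V) (K := K) (t₀ := t₁)
      (s := fun _ => Metric.closedBall 0 (max r₁ r₂)) (fun _ => hK)
      (fun t => ⟨hγ₁ t, Metric.closedBall_subset_closedBall (le_max_left _ _)
        (hr₁ (mem_range_self _))⟩)
      (fun t => ⟨?_, Metric.closedBall_subset_closedBall (le_max_right _ _)
        (hr₂ (mem_range_self _))⟩) ?_
    · have := (hγ₂ (t + (t₂ - t₁))).scomp t ((hasDerivAt_id t).add_const (t₂ - t₁))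
      rw [one_smul] at this
      exact this
    · simp [h]
  rw [heq]
  exact (Equiv.addRight (t₂ - t₁)).surjective.range_comp γ₂

/-- Reparametrize a periodic curve, tangent to `V` up to a positive factor, into a solution. -/
lemma exists_solution_of_reparam {V : ℝ × ℝ → ℝ × ℝ} {c : ℝ → ℝ × ℝ} {ω : ℝ → ℝ} {T : ℝ}
    (hT : 0 < T) (hω : Continuous ω) (hpos : ∀ θ, 0 < ω θ) (hωp : ∀ θ, ω (θ + T) = ω θ)
    (hcp : ∀ θ, c (θ + T) = c θ) (hc : ∀ θ, HasDerivAt c (ω θ • V (c θ)) θ) :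
    ∃ γ : ℝ → ℝ × ℝ, (∀ t, HasDerivAt γ (V (γ t)) t) ∧
      (∃ T' : ℝ, 0 < T' ∧ Function.Periodic γ T') ∧ range γ = range c := by
  set τ : ℝ → ℝ := fun θ => ∫ s in (0 : ℝ)..θ, ω s with hτ
  have hτd : ∀ θ, HasDerivAt τ (ω θ) θ := fun θ =>
    integral_hasDerivAt_right (hω.intervalIntegrable _ _)
      hω.aestronglyMeasurable.stronglyMeasurableAtFilter hω.continuousAt
  have hτc : Continuous τ := continuous_iff_continuousAt.2 fun t => (hτd t).continuousAt
  have hmono : StrictMono τ := strictMono_of_deriv_pos fun θ => by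
    rw [(hτd θ).deriv]; exact hpos θ
  set P := ∫ s in (0 : ℝ)..T, ω s with hP
  have hPpos : 0 < P := by
    have := hmono hT
    simpa [hτ] using this
  have hτT : ∀ θ, τ (θ + T) = τ θ + P := by
    intro θ
    simp only [hτ, hP]
    have h1 := (show Function.Periodic ω T from hωp).intervalIntegral_add_eq θ 0
    rw [zero_add] at h1
    rw [← h1, integral_add_adjacent_intervals (hω.intervalIntegrable _ _)
      (hω.intervalIntegrable _ _)]
  have hτn : ∀ (n : ℕ) θ, τ (θ + n * T) = τ θ + n * P := by
    intro n
    induction n with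
    | zero => simp
    | succ n ih => intro θ; push_cast; rw [add_mul, ← add_assoc, one_mul, hτT, ih]; ring
  have hsurj : Function.Surjective τ := by
    refine hτc.surjective ?_ ?_
    · rw [hmono.monotone.tendsto_atTop_atTop_iff]
      intro b
      obtain ⟨n, hn⟩ := exists_nat_gt (b / P)
      refine ⟨0 + n * T, ?_⟩
      rw [hτn]
      rw [div_lt_iff₀ hPpos] at hn
      simp only [hτ, integral_same]; linarith
    · rw [hmono.monotone.tendsto_atBot_atBot_iff]
      intro b
      obtain ⟨n, hn⟩ := exists_nat_gt (-b / P)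
      refine ⟨-(n * T), ?_⟩
      have := hτn n (-(n * T))
      rw [div_lt_iff₀ hPpos] at hn
      simp only [neg_add_cancel] at this
      have h0 : τ 0 = 0 := by simp [hτ]
      linarith
  set e := (hmono.orderIsoOfSurjective τ hsurj) with he
  set ι : ℝ → ℝ := fun t => e.symm t with hι
  have hτι : ∀ t, τ (ι t) = t := fun t => e.apply_symm_apply t
  have hιτ : ∀ t, ι (τ t) = t := fun t => e.symm_apply_apply t
  have hιc : Continuous ι := e.symm.continuous
  have hιd : ∀ t, HasDerivAt ι (ω (ι t))⁻¹ t := fun t =>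
    HasDerivAt.of_local_left_inverse hιc.continuousAt (hτd (ι t)) (hpos _).ne'
      (Eventually.of_forall hτι)
  have hιP : ∀ t, ι (t + P) = ι t + T := by
    intro t
    rw [← hιτ (ι t + T), hτT, hτι]
  refine ⟨fun t => c (ι t), fun t => ?_, ⟨P, hPpos, fun t => ?_⟩, ?_⟩
  · have := (hc (ι t)).scomp t (hιd t)
    rw [smul_smul, inv_mul_cancel₀ (hpos _).ne', one_smul] at this
    exact this
  · simp only [hιP, hcp]
  · exact e.symm.surjective.range_comp c

end PolarLimitCycle

section PolarLimitCycleExists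

open Set Topology MeasureTheory intervalIntegral Real

/-- If generalized polar coordinates `z = Φ (θ, E)` transform the perturbed field into
`E' = ε R(θ, E, ε)`, then a simple zero `E₀` of the averaged function produces a limit cycle. -/
theorem exists_limitCycle_of_polar {V : ℝ → ℝ × ℝ → ℝ × ℝ} (hV : ∀ ε, ContDiff ℝ 1 (V ε))
    {Φ : ℝ × ℝ → ℝ × ℝ} {H : ℝ × ℝ → ℝ} (hH : Continuous H) {U₀ : Set (ℝ × ℝ)} (hU₀ : IsOpen U₀)
    {R w : ℝ × ℝ × ℝ → ℝ} {E₀ δ₀ : ℝ} (hδ₀ : 0 < δ₀)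
    (hR : ∀ θ, ContDiffAt ℝ 1 R (θ, E₀, 0))
    (hper : ∀ θ E ε, R (θ + 2 * π, E, ε) = R (θ, E, ε))
    (h0 : ∫ θ in (0 : ℝ)..2 * π, R (θ, E₀, 0) = 0) {D : ℝ}
    (hD : HasDerivAt (fun E => ∫ θ in (0 : ℝ)..2 * π, R (θ, E, 0)) D E₀) (hD0 : D ≠ 0)
    (hΦ : ∀ θ E, |E - E₀| < δ₀ → Φ (θ, E) ∈ U₀ ∧ H (Φ (θ, E)) = E ∧ ContinuousAt Φ (θ, E))
    (hΦper : ∀ θ E, Φ (θ + 2 * π, E) = Φ (θ, E))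
    (hsurj : ∀ z ∈ U₀, |H z - E₀| < δ₀ → ∃ θ, Φ (θ, H z) = z)
    (hw : ∀ θ E ε, |E - E₀| < δ₀ → |ε| < δ₀ → ContinuousAt w (θ, E, ε) ∧ 0 < w (θ, E, ε))
    (hwper : ∀ θ E ε, w (θ + 2 * π, E, ε) = w (θ, E, ε))
    (hflow : ∀ (u : ℝ → ℝ) θ ε, |ε| < δ₀ → |u θ - E₀| < δ₀ →
      HasDerivAt u (ε * R (θ, u θ, ε)) θ →
      HasDerivAt (fun θ => Φ (θ, u θ)) (w (θ, u θ, ε) • V ε (Φ (θ, u θ))) θ)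
    (hne : ∀ E E', |E - E₀| < δ₀ → |E' - E₀| < δ₀ → Φ (π / 2, E) ≠ Φ (-(π / 2), E')) :
    ∃ ε₀ > 0, ∀ ε, 0 < ε → ε ≤ ε₀ →
      ∃ Γ, IsLimitCycle (V ε) Γ ∧ Γ ⊆ U₀ ∩ {z | |H z - E₀| < δ₀} := by
  obtain ⟨η, hη, hηδ, ε₁, hε₁, hmain⟩ := exists_isolated_periodic_scalar hR hper h0 hD hD0
    (half_pos hδ₀)
  have hηδ' : η < δ₀ := by linarith
  refine ⟨min ε₁ (δ₀ / 2), by positivity, fun ε hε hεle => ?_⟩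
  have hεδ : |ε| < δ₀ := by
    rw [abs_of_pos hε]; linarith [hεle.trans (min_le_right _ _)]
  obtain ⟨hloc, us, husper, hus, hK⟩ := hmain ε hε (hεle.trans (min_le_left _ _))
  have husc : Continuous us := continuous_iff_continuousAt.2 fun t => (hus t).1.continuousAt
  have husδ : ∀ θ, |us θ - E₀| < δ₀ := fun θ => (hus θ).2.trans hηδ'
  obtain ⟨γ, hγ, ⟨T, hT, hγT⟩, hγr⟩ := exists_solution_of_reparam (V := V ε)
    (c := fun θ => Φ (θ, us θ)) (ω := fun θ => w (θ, us θ, ε)) two_pi_pos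
    (continuous_iff_continuousAt.2 fun θ =>
      (hw θ (us θ) ε (husδ θ) hεδ).1.comp (f := fun θ => (θ, us θ, ε)) (by fun_prop))
    (fun θ => (hw θ (us θ) ε (husδ θ) hεδ).2)
    (fun θ => by rw [husper, hwper]) (fun θ => by rw [husper, hΦper])
    (fun θ => hflow us θ ε hεδ (husδ θ) (hus θ).1)
  have hγmem : ∀ θ, Φ (θ, us θ) ∈ range γ := fun θ => hγr ▸ mem_range_self θ
  have hsub : ∀ ρ, η ≤ ρ → range γ ⊆ U₀ ∩ {z | |H z - E₀| < ρ} := by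
    intro ρ hρ
    rw [hγr]
    rintro _ ⟨θ, rfl⟩
    obtain ⟨h1, h2, -⟩ := hΦ θ (us θ) (husδ θ)
    refine ⟨h1, ?_⟩
    simp only [mem_ofPred_eq, h2]
    exact (hus θ).2.trans_le hρ
  refine ⟨range γ, ⟨⟨γ, hγ, ⟨T, hT, hγT⟩, ?_, rfl⟩, U₀ ∩ {z | |H z - E₀| < η}, ?_,
    hsub η le_rfl, ?_⟩, hsub δ₀ hηδ'.le⟩
  · obtain ⟨t₁, ht₁⟩ := hγmem (π / 2)
    obtain ⟨t₂, ht₂⟩ := hγmem (-(π / 2))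
    exact ⟨t₁, t₂, by rw [ht₁, ht₂]; exact hne _ _ (husδ _) (husδ _)⟩
  · exact hU₀.inter (isOpen_lt (by fun_prop) continuous_const)
  rintro Γ' ⟨γ', hγ', ⟨T', hT', hγT'⟩, -, rfl⟩ hΓU
  have hγ'c : Continuous γ' := continuous_iff_continuousAt.2 fun t => (hγ' t).continuousAt
  have hfollow : ∀ (u : ℝ → ℝ) (a b : ℝ), a ≤ b → SolvesOn R E₀ ε (δ₀ / 2) u (Icc a b) →
      Φ (a, u a) ∈ range γ' → Φ (b, u b) ∈ range γ' ∧ |u b - E₀| < η := by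
    intro u a b hab hu ⟨t₀, ht₀⟩
    have huδ : ∀ θ ∈ Icc a b, |u θ - E₀| < δ₀ := fun θ hθ => by linarith [(hu θ hθ).2]
    have hmem := mem_range_of_reparam (hV ε) hγ' hT' hγT' hab (c := fun θ => Φ (θ, u θ))
      (ω := fun θ => w (θ, u θ, ε))
      (fun θ hθ => ((hw θ (u θ) ε (huδ θ hθ) hεδ).1.comp (f := fun θ => (θ, u θ, ε))
        (continuousAt_id.prodMk ((hu θ hθ).1.continuousAt.prodMk
          continuousAt_const))).continuousWithinAt)
      (fun θ hθ => hflow u θ ε hεδ (huδ θ hθ) (hu θ hθ).1) ht₀ b (right_mem_Icc.2 hab)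
    refine ⟨hmem, ?_⟩
    have := (hΓU hmem).2
    simpa only [mem_ofPred_eq, (hΦ b (u b) (huδ b (right_mem_Icc.2 hab))).2.1] using this
  have hK0 : us 0 ∈ Icc (E₀ - η) (E₀ + η) ∩ (fun e => Φ (0, e)) ⁻¹' range γ' := by
    refine hK _ ?_ ?_ inter_subset_left ?_
    · refine isCompact_Icc.of_isClosed_subset ?_ inter_subset_left
      refine ContinuousOn.preimage_isClosed_of_isClosed ?_ isClosed_Icc
        (hγT'.isCompact_range_of_continuous hT' hγ'c).isClosed
      intro e he
      have : |e - E₀| < δ₀ := by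
        rw [abs_lt]; constructor <;> linarith [he.1, he.2]
      exact ((hΦ 0 e this).2.2.comp (f := fun e => ((0 : ℝ), e))
        (by fun_prop)).continuousWithinAt
    · obtain ⟨hz1, hz2⟩ := hΓU (mem_range_self 0)
      obtain ⟨θ, hθ⟩ := hsurj _ hz1 (hz2.trans hηδ')
      obtain ⟨θ₀, hθ₀, hθθ₀⟩ := Function.Periodic.exists_mem_Ioc
        (f := fun θ => Φ (θ, H (γ' 0))) (fun θ => hΦper θ _) two_pi_pos θ (-(2 * π))
      have hπ := pi_pos
      rw [neg_add_cancel] at hθ₀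
      obtain ⟨u, hu0, hu⟩ := hloc θ₀ ⟨by linarith [hθ₀.1], by linarith [hθ₀.2]⟩ (H (γ' 0)) hz2.le
      obtain ⟨h1, h2⟩ := hfollow u θ₀ 0 hθ₀.2
        (hu.mono (Icc_subset_Icc (by linarith [hθ₀.1]) (by linarith)))
        (by rw [hu0]; exact ⟨0, hθ.symm.trans hθθ₀⟩)
      rw [abs_lt] at h2
      exact ⟨u 0, ⟨by linarith, by linarith⟩, h1⟩
    · intro e he u hu0 hu
      obtain ⟨h1, h2⟩ := hfollow u 0 (2 * π) two_pi_pos.le hu (by rw [hu0]; exact he.2)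
      rw [abs_lt] at h2
      refine ⟨⟨by linarith, by linarith⟩, ?_⟩
      have := hΦper 0 (u (2 * π))
      rw [zero_add] at this
      rw [mem_preimage, ← this]; exact h1
  obtain ⟨t₂, ht₂⟩ := hγmem 0
  obtain ⟨t₁, ht₁⟩ := hK0.2
  exact range_eq_of_common_point (hV ε) hγ' hγ hT' hT hγT' hγT (ht₁.trans ht₂.symm)

end PolarLimitCycleExists

/-- A potential well of `G`: `G` decreases on `[a, c]`, increases on `[d, b]`, and the levels in
`(lo, hi)` are all crossed exactly once on each side. -/
structure IsWell (G : ℝ[X]) (a c d b lo hi : ℝ) : Prop where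
  a_lt_c : a < c
  c_le_d : c ≤ d
  d_lt_b : d < b
  lo_lt_hi : lo < hi
  deriv_neg : ∀ x ∈ Set.Ico a c, (derivative G).eval x < 0
  deriv_pos : ∀ x ∈ Set.Ioc d b, 0 < (derivative G).eval x
  lt_lo : ∀ x ∈ Set.Icc c d, G.eval x < lo
  hi_lt_left : hi < G.eval a
  hi_lt_right : hi < G.eval b

/-- The turning points `α E < β E` of a well, together with the factorization
`G x - E = (x - α E) (x - β E) Q (x, α E, β E)`. -/
structure WellChart (G : ℝ[X]) (a b lo hi : ℝ) where
  α : ℝ → ℝ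
  β : ℝ → ℝ
  Q : ℝ × ℝ × ℝ → ℝ
  a_lt : ∀ E ∈ Set.Ioo lo hi, a < α E
  lt_b : ∀ E ∈ Set.Ioo lo hi, β E < b
  α_lt_β : ∀ E ∈ Set.Ioo lo hi, ∀ E' ∈ Set.Ioo lo hi, α E < β E'
  eval_α : ∀ E ∈ Set.Ioo lo hi, G.eval (α E) = E
  eval_β : ∀ E ∈ Set.Ioo lo hi, G.eval (β E) = E
  lt_eval_left : ∀ E ∈ Set.Ioo lo hi, ∀ x ∈ Set.Ico a (α E), E < G.eval x
  lt_eval_right : ∀ E ∈ Set.Ioo lo hi, ∀ x ∈ Set.Ioc (β E) b, E < G.eval x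
  eval_lt : ∀ E ∈ Set.Ioo lo hi, ∀ x ∈ Set.Ioo (α E) (β E), G.eval x < E
  deriv_α_neg : ∀ E ∈ Set.Ioo lo hi, (derivative G).eval (α E) < 0
  deriv_β_pos : ∀ E ∈ Set.Ioo lo hi, 0 < (derivative G).eval (β E)
  hasDerivAt_α : ∀ E ∈ Set.Ioo lo hi, HasDerivAt α ((derivative G).eval (α E))⁻¹ E
  hasDerivAt_β : ∀ E ∈ Set.Ioo lo hi, HasDerivAt β ((derivative G).eval (β E))⁻¹ E
  contDiff_Q : ContDiff ℝ 1 Q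
  factor : ∀ E ∈ Set.Ioo lo hi, ∀ x,
    G.eval x - E = (x - α E) * (x - β E) * Q (x, α E, β E)
  deriv_α : ∀ E ∈ Set.Ioo lo hi,
    (derivative G).eval (α E) = (α E - β E) * Q (α E, α E, β E)
  deriv_β : ∀ E ∈ Set.Ioo lo hi,
    (derivative G).eval (β E) = (β E - α E) * Q (β E, α E, β E)

section Chart

open Set Topology

lemma exists_dividedDifference (p : ℝ[X]) :
    ∃ D : ℝ × ℝ → ℝ, ∃ Q : ℝ × ℝ × ℝ → ℝ, ContDiff ℝ 1 Q ∧
      (∀ x y, p.eval x - p.eval y = (x - y) * D (x, y)) ∧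
      ∀ x y z, D (x, z) - D (y, z) = (x - y) * Q (x, y, z) := by
  induction p using Polynomial.induction_on' with
  | add p q hp hq =>
    obtain ⟨D, Q, h1, h2, h3⟩ := hp
    obtain ⟨D', Q', h1', h2', h3'⟩ := hq
    refine ⟨fun z => D z + D' z, fun z => Q z + Q' z, h1.add h1', fun x y => ?_, fun x y z => ?_⟩
    · rw [eval_add, eval_add]; linear_combination h2 x y + h2' x y
    · linear_combination h3 x y z + h3' x y z
  | monomial n a =>
    suffices ∃ D : ℝ × ℝ → ℝ, ∃ Q : ℝ × ℝ × ℝ → ℝ, ContDiff ℝ 1 D ∧ ContDiff ℝ 1 Q ∧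
      (∀ x y, a * x ^ n - a * y ^ n = (x - y) * D (x, y)) ∧
      ∀ x y z, D (x, z) - D (y, z) = (x - y) * Q (x, y, z) by
      obtain ⟨D, Q, -, h1, h2, h3⟩ := this
      exact ⟨D, Q, h1, fun x y => by simpa [eval_monomial] using h2 x y, h3⟩
    induction n with
    | zero => exact ⟨0, 0, contDiff_const, contDiff_const, by simp, by simp⟩
    | succ n ih =>
      obtain ⟨D, Q, h0, h1, h2, h3⟩ := ih
      refine ⟨fun z => z.1 * D z + a * z.2 ^ n, fun z => z.1 * Q z + D z.2, by fun_prop,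
        by fun_prop, fun x y => ?_, fun x y z => ?_⟩
      · linear_combination x * h2 x y
      · linear_combination x * h3 x y z

lemma hasDerivAt_sub_mul {F : ℝ → ℝ} {y : ℝ} (hF : DifferentiableAt ℝ F y) :
    HasDerivAt (fun x => (x - y) * F x) (F y) y := by
  have := ((hasDerivAt_id y).sub_const y).mul hF.hasDerivAt
  simp only [id, sub_self, zero_mul, one_mul, add_zero] at this
  exact this

/-- The decreasing branch of the inverse of `F`. -/
lemma exists_inverse_branch {F F' : ℝ → ℝ} {a c lo hi : ℝ} (hac : a < c)
    (hF : ∀ x, HasDerivAt F (F' x) x) (hneg : ∀ x ∈ Ico a c, F' x < 0) (hlo : F c < lo)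
    (hhi : hi < F a) :
    ∃ α : ℝ → ℝ, ∀ E ∈ Ioo lo hi, α E ∈ Ioo a c ∧ F (α E) = E ∧ HasDerivAt α (F' (α E))⁻¹ E := by
  have hFc : Continuous F := continuous_iff_continuousAt.2 fun t => (hF t).continuousAt
  have hanti : StrictAntiOn F (Icc a c) := by
    refine strictAntiOn_of_deriv_neg (convex_Icc _ _) hFc.continuousOn fun x hx => ?_
    rw [interior_Icc] at hx
    rw [(hF x).deriv]
    exact hneg x ⟨hx.1.le, hx.2⟩
  have hex : ∀ E, ∃ x, E ∈ Ioo lo hi → x ∈ Ioo a c ∧ F x = E := by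
    intro E
    by_cases hE : E ∈ Ioo lo hi
    · obtain ⟨x, hx, hxE⟩ := intermediate_value_Ioo' hac.le hFc.continuousOn
        (⟨hlo.trans hE.1, hE.2.trans hhi⟩ : E ∈ Ioo (F c) (F a))
      exact ⟨x, fun _ => ⟨hx, hxE⟩⟩
    · exact ⟨0, fun h => absurd h hE⟩
  choose α hα using hex
  refine ⟨α, fun E hE => ⟨(hα E hE).1, (hα E hE).2, ?_⟩⟩
  have hcont : ContinuousAt α E := by
    have hmaps : ∀ E' ∈ Ioo lo hi, ∀ x ∈ Icc a c, (x < α E' ↔ E' < F x) := fun E' hE' x hx => by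
      conv_rhs => rw [← (hα E' hE').2]
      exact (hanti.lt_iff_gt (Ioo_subset_Icc_self (hα E' hE').1) hx).symm
    have hmaps' : ∀ E' ∈ Ioo lo hi, ∀ x ∈ Icc a c, (α E' < x ↔ F x < E') := fun E' hE' x hx => by
      conv_rhs => rw [← (hα E' hE').2]
      exact (hanti.lt_iff_gt hx (Ioo_subset_Icc_self (hα E' hE').1)).symm
    have hmem := isOpen_Ioo.mem_nhds hE
    have hαE := (hα E hE).1
    refine tendsto_order.2 ⟨fun x hx => ?_, fun x hx => ?_⟩
    · have hx' : max x a ∈ Icc a c := ⟨le_max_right _ _, max_le (hx.le.trans hαE.2.le) hac.le⟩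
      have h1 := (hmaps E hE _ hx').1 (max_lt hx hαE.1)
      filter_upwards [hmem, Iio_mem_nhds h1] with E' h2 h3
      exact (le_max_left _ _).trans_lt ((hmaps E' h2 _ hx').2 h3)
    · have hx' : min x c ∈ Icc a c := ⟨le_min (hαE.1.le.trans hx.le) hac.le, min_le_right _ _⟩
      have h1 := (hmaps' E hE _ hx').1 (lt_min hx hαE.2)
      filter_upwards [hmem, Ioi_mem_nhds h1] with E' h2 h3
      exact ((hmaps' E' h2 _ hx').2 h3).trans_le (min_le_left _ _)
  refine HasDerivAt.of_local_left_inverse hcont (hF _)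
    (hneg _ (Ioo_subset_Ico_self (hα E hE).1)).ne ?_
  filter_upwards [isOpen_Ioo.mem_nhds hE] with E' hE'
  exact (hα E' hE').2

theorem IsWell.nonempty_chart {G : ℝ[X]} {a c d b lo hi : ℝ} (h : IsWell G a c d b lo hi) :
    Nonempty (WellChart G a b lo hi) := by
  have hac := h.a_lt_c
  have hcd := h.c_le_d
  have hdb := h.d_lt_b
  obtain ⟨α, hα⟩ := exists_inverse_branch hac (fun x => G.hasDerivAt x) h.deriv_neg
    (h.lt_lo c (left_mem_Icc.2 hcd)) h.hi_lt_left
  obtain ⟨β, hβ⟩ := exists_inverse_branch (F := fun x => G.eval (-x))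
    (F' := fun x => -(derivative G).eval (-x)) (a := -b) (c := -d) (neg_lt_neg hdb)
    (fun x => by
      have := (G.hasDerivAt (-x)).comp x (hasDerivAt_neg x)
      rw [mul_neg_one] at this
      exact this)
    (fun x hx => neg_neg_of_pos (h.deriv_pos (-x) ⟨by linarith [hx.2], by linarith [hx.1]⟩))
    (by rw [neg_neg]; exact h.lt_lo d (right_mem_Icc.2 hcd)) (by rw [neg_neg]; exact h.hi_lt_right)
  have hβ' : ∀ E ∈ Ioo lo hi, -β E ∈ Ioo d b := fun E hE =>
    ⟨by linarith [(hβ E hE).1.2], by linarith [(hβ E hE).1.1]⟩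
  obtain ⟨D, Q, hQ, hD, hDQ⟩ := exists_dividedDifference G
  have hanti : StrictAntiOn (fun x => G.eval x) (Icc a c) := by
    refine strictAntiOn_of_deriv_neg (convex_Icc _ _) G.continuous.continuousOn fun x hx => ?_
    rw [interior_Icc] at hx
    rw [Polynomial.deriv]
    exact h.deriv_neg x ⟨hx.1.le, hx.2⟩
  have hmono : StrictMonoOn (fun x => G.eval x) (Icc d b) := by
    refine strictMonoOn_of_deriv_pos (convex_Icc _ _) G.continuous.continuousOn fun x hx => ?_
    rw [interior_Icc] at hx
    rw [Polynomial.deriv]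
    exact h.deriv_pos x ⟨hx.1, hx.2.le⟩
  have hlt : ∀ E ∈ Ioo lo hi, ∀ E' ∈ Ioo lo hi, α E < -β E' := fun E hE E' hE' => by
    linarith [(hα E hE).1.2, (hβ' E' hE').1]
  have hfac : ∀ E ∈ Ioo lo hi, ∀ x,
      G.eval x - E = (x - α E) * (x - -β E) * Q (x, α E, -β E) := by
    intro E hE x
    have h1 := hD (α E) (-β E)
    rw [(hα E hE).2.1, (hβ E hE).2.1, sub_self] at h1
    have h2 : D (α E, -β E) = 0 := by
      rcases mul_eq_zero.1 h1.symm with h | h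
      · linarith [hlt E hE E hE]
      · exact h
    have h3 := hDQ x (α E) (-β E)
    have h4 := hD x (-β E)
    rw [(hβ E hE).2.1] at h4
    rw [h4]
    linear_combination (x + β E) * (h3 + h2)
  have hev : ∀ E ∈ Ioo lo hi, (fun x => G.eval x) =
      fun x => (x - α E) * ((x - -β E) * Q (x, α E, -β E)) + E := fun E hE => by
    ext x; linarith [hfac E hE x]
  have hev' : ∀ E ∈ Ioo lo hi, (fun x => G.eval x) =
      fun x => (x - -β E) * ((x - α E) * Q (x, α E, -β E)) + E := fun E hE => by
    ext x; linarith [hfac E hE x]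
  have hQd : ∀ y z, Differentiable ℝ fun x => Q (x, y, z) := fun y z =>
    (hQ.differentiable one_ne_zero).comp (by fun_prop)
  refine ⟨⟨α, fun E => -β E, Q, fun E hE => (hα E hE).1.1, fun E hE => (hβ' E hE).2,
    hlt, fun E hE => (hα E hE).2.1, fun E hE => (hβ E hE).2.1, ?_, ?_, ?_,
    fun E hE => h.deriv_neg _ (Ioo_subset_Ico_self (hα E hE).1),
    fun E hE => h.deriv_pos _ (Ioo_subset_Ioc_self (hβ' E hE)), fun E hE => (hα E hE).2.2, ?_,
    hQ, hfac, ?_, ?_⟩⟩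
  · intro E hE x hx
    have := hanti ⟨hx.1, hx.2.le.trans (hα E hE).1.2.le⟩ (Ioo_subset_Icc_self (hα E hE).1) hx.2
    simpa only [(hα E hE).2.1] using this
  · intro E hE x hx
    have := hmono (Ioo_subset_Icc_self (hβ' E hE)) ⟨(hβ' E hE).1.le.trans hx.1.le, hx.2⟩ hx.1
    simpa only [(hβ E hE).2.1] using this
  · intro E hE x hx
    rcases le_or_gt x c with hxc | hxc
    · have := hanti (Ioo_subset_Icc_self (hα E hE).1) ⟨(hα E hE).1.1.le.trans hx.1.le, hxc⟩ hx.1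
      simpa only [(hα E hE).2.1] using this
    rcases le_or_gt d x with hxd | hxd
    · have := hmono ⟨hxd, hx.2.le.trans (hβ' E hE).2.le⟩ (Ioo_subset_Icc_self (hβ' E hE)) hx.2
      simpa only [(hβ E hE).2.1] using this
    · exact (h.lt_lo x ⟨hxc.le, hxd.le⟩).trans hE.1
  · intro E hE
    have := (hβ E hE).2.2.neg
    rw [← inv_neg, neg_neg] at this
    exact this
  · intro E hE
    have h1 := (hasDerivAt_sub_mul (y := α E) (F := fun x => (x - -β E) * Q (x, α E, -β E))
      ((differentiableAt_id.sub_const _).mul (hQd _ _ _))).add_const E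
    rw [← hev E hE] at h1
    exact (G.hasDerivAt _).unique h1
  · intro E hE
    have h1 := (hasDerivAt_sub_mul (y := -β E) (F := fun x => (x - α E) * Q (x, α E, -β E))
      ((differentiableAt_id.sub_const _).mul (hQd _ _ _))).add_const E
    rw [← hev' E hE] at h1
    exact (G.hasDerivAt _).unique h1

end Chart

namespace WellChart

open Set Topology Real

variable {G : ℝ[X]} {a b lo hi : ℝ} (C : WellChart G a b lo hi) (f : ℝ[X])

/-- Half the distance between the turning points. -/
noncomputable def r (E : ℝ) : ℝ := (C.β E - C.α E) / 2

/-- The abscissa of the polar chart. -/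
noncomputable def xcoord (z : ℝ × ℝ) : ℝ := (C.α z.2 + C.β z.2) / 2 + C.r z.2 * sin z.1

/-- The ordinate of the polar chart is `q * cos θ`. -/
noncomputable def q (z : ℝ × ℝ) : ℝ := C.r z.2 * √(2 * C.Q (C.xcoord z, C.α z.2, C.β z.2))

/-- The polar chart `(θ, E) ↦ (x, y)`. -/
noncomputable def Φ (z : ℝ × ℝ) : ℝ × ℝ := (C.xcoord z, C.q z * cos z.1)

/-- The derivative of the abscissa with respect to the energy. -/
noncomputable def dX (z : ℝ × ℝ) : ℝ :=
  (((derivative G).eval (C.α z.2))⁻¹ + ((derivative G).eval (C.β z.2))⁻¹) / 2 +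
    (((derivative G).eval (C.β z.2))⁻¹ - ((derivative G).eval (C.α z.2))⁻¹) / 2 * sin z.1

/-- The denominator appearing when the angle is used as independent variable. -/
noncomputable def den (z : ℝ × ℝ × ℝ) : ℝ :=
  1 + z.2.2 * (C.dX (z.1, z.2.1) * f.eval (C.xcoord (z.1, z.2.1)) * C.q (z.1, z.2.1) * cos z.1)

/-- The time change `dt/dθ`. -/
noncomputable def w (z : ℝ × ℝ × ℝ) : ℝ := C.r z.2.1 / (C.q (z.1, z.2.1) * C.den f z)

/-- The right-hand side of the energy equation `dE/dθ = ε R`. -/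
noncomputable def R (z : ℝ × ℝ × ℝ) : ℝ :=
  -(f.eval (C.xcoord (z.1, z.2.1)) * C.q (z.1, z.2.1) * C.r z.2.1 * cos z.1 ^ 2) / C.den f z

variable {C f} {θ E ε : ℝ}

lemma r_pos (hE : E ∈ Ioo lo hi) : 0 < C.r E := by
  have := C.α_lt_β E hE E hE
  unfold r; linarith

lemma xcoord_mem (hE : E ∈ Ioo lo hi) : C.xcoord (θ, E) ∈ Icc (C.α E) (C.β E) := by
  have h1 := r_pos (C := C) hE
  have h2 := neg_one_le_sin θ
  have h3 := sin_le_one θ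
  have h4 : C.β E = C.α E + 2 * C.r E := by unfold r; ring
  simp only [xcoord, h4]
  constructor <;> nlinarith

lemma Q_pos (hE : E ∈ Ioo lo hi) {x : ℝ} (hx : x ∈ Icc (C.α E) (C.β E)) :
    0 < C.Q (x, C.α E, C.β E) := by
  have hlt := C.α_lt_β E hE E hE
  rcases hx.1.eq_or_lt with h1 | h1
  · have h := C.deriv_α E hE
    have h' := C.deriv_α_neg E hE
    rw [h] at h'
    rw [← h1]
    exact pos_of_mul_neg_right h' (by linarith)
  rcases hx.2.eq_or_lt with h2 | h2
  · have h := C.deriv_β E hE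
    have h' := C.deriv_β_pos E hE
    rw [h] at h'
    rw [h2]
    exact pos_of_mul_pos_right h' (by linarith)
  · have h := C.factor E hE x
    have h' := C.eval_lt E hE x ⟨h1, h2⟩
    have h3 : (x - C.α E) * (x - C.β E) < 0 := mul_neg_of_pos_of_neg (by linarith) (by linarith)
    by_contra! hQ
    nlinarith [mul_nonneg_of_nonpos_of_nonpos h3.le hQ]

lemma q_pos (hE : E ∈ Ioo lo hi) : 0 < C.q (θ, E) :=
  mul_pos (r_pos hE) (sqrt_pos.2 (mul_pos two_pos (Q_pos hE (xcoord_mem hE))))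

lemma q_sq (hE : E ∈ Ioo lo hi) :
    C.q (θ, E) ^ 2 = C.r E ^ 2 * (2 * C.Q (C.xcoord (θ, E), C.α E, C.β E)) := by
  simp only [q]
  rw [mul_pow, sq_sqrt (mul_pos two_pos (Q_pos hE (xcoord_mem hE))).le]

lemma energy (hE : E ∈ Ioo lo hi) :
    (C.q (θ, E) * cos θ) ^ 2 / 2 + G.eval (C.xcoord (θ, E)) = E := by
  have h1 := C.factor E hE (C.xcoord (θ, E))
  have h2 := q_sq (C := C) (θ := θ) hE
  have h3 : (C.xcoord (θ, E) - C.α E) * (C.xcoord (θ, E) - C.β E) = -(C.r E ^ 2 * cos θ ^ 2) := by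
    rw [cos_sq']
    simp only [xcoord, r]; ring
  rw [h3] at h1
  rw [mul_pow, h2]
  linear_combination h1

lemma contDiffAt_α (hE : E ∈ Ioo lo hi) : ContDiffAt ℝ 1 C.α E := by
  rw [contDiffAt_one_iff]
  refine ⟨fun E => ContinuousLinearMap.toSpanSingleton ℝ ((derivative G).eval (C.α E))⁻¹,
    Ioo lo hi, isOpen_Ioo.mem_nhds hE, fun E hE => ?_, fun E hE => (C.hasDerivAt_α E hE).hasFDerivAt⟩
  have h1 : ContinuousAt (fun E => ((derivative G).eval (C.α E))⁻¹) E :=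
    ((derivative G).continuous.continuousAt.comp (C.hasDerivAt_α E hE).continuousAt).inv₀
      (C.deriv_α_neg E hE).ne
  exact ((ContinuousLinearMap.toSpanSingletonCLE (𝕜 := ℝ) (E := ℝ)).continuous.continuousAt.comp
    h1).continuousWithinAt

lemma contDiffAt_β (hE : E ∈ Ioo lo hi) : ContDiffAt ℝ 1 C.β E := by
  rw [contDiffAt_one_iff]
  refine ⟨fun E => ContinuousLinearMap.toSpanSingleton ℝ ((derivative G).eval (C.β E))⁻¹,
    Ioo lo hi, isOpen_Ioo.mem_nhds hE, fun E hE => ?_, fun E hE => (C.hasDerivAt_β E hE).hasFDerivAt⟩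
  have h1 : ContinuousAt (fun E => ((derivative G).eval (C.β E))⁻¹) E :=
    ((derivative G).continuous.continuousAt.comp (C.hasDerivAt_β E hE).continuousAt).inv₀
      (C.deriv_β_pos E hE).ne'
  exact ((ContinuousLinearMap.toSpanSingletonCLE (𝕜 := ℝ) (E := ℝ)).continuous.continuousAt.comp
    h1).continuousWithinAt

lemma _root_.Polynomial.contDiff_eval (p : ℝ[X]) : ContDiff ℝ 1 (fun x => p.eval x) := by
  simpa using p.contDiff_aeval (𝕜 := ℝ) 1

lemma contDiffAt_xcoord (hE : E ∈ Ioo lo hi) : ContDiffAt ℝ 1 C.xcoord (θ, E) := by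
  have h1 : ContDiffAt ℝ 1 (fun z : ℝ × ℝ => C.α z.2) (θ, E) :=
    (contDiffAt_α hE).comp (θ, E) contDiffAt_snd
  have h2 : ContDiffAt ℝ 1 (fun z : ℝ × ℝ => C.β z.2) (θ, E) :=
    (contDiffAt_β hE).comp (θ, E) contDiffAt_snd
  have h3 : ContDiffAt ℝ 1 (fun z : ℝ × ℝ => sin z.1) (θ, E) :=
    contDiff_sin.contDiffAt.comp (θ, E) contDiffAt_fst
  exact ((h1.add h2).div_const 2).add (((h2.sub h1).div_const 2).mul h3)

lemma contDiffAt_q (hE : E ∈ Ioo lo hi) : ContDiffAt ℝ 1 C.q (θ, E) := by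
  have h1 : ContDiffAt ℝ 1 (fun z : ℝ × ℝ => C.α z.2) (θ, E) :=
    (contDiffAt_α hE).comp (θ, E) contDiffAt_snd
  have h2 : ContDiffAt ℝ 1 (fun z : ℝ × ℝ => C.β z.2) (θ, E) :=
    (contDiffAt_β hE).comp (θ, E) contDiffAt_snd
  have h4 : ContDiffAt ℝ 1 (fun z : ℝ × ℝ => 2 * C.Q (C.xcoord z, C.α z.2, C.β z.2)) (θ, E) :=
    contDiffAt_const.mul
      (C.contDiff_Q.contDiffAt.comp (θ, E) ((contDiffAt_xcoord hE).prodMk (h1.prodMk h2)))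
  exact ((h2.sub h1).div_const 2).mul
    (h4.sqrt (mul_pos two_pos (Q_pos hE (xcoord_mem hE))).ne')

lemma contDiffAt_dX (hE : E ∈ Ioo lo hi) : ContDiffAt ℝ 1 C.dX (θ, E) := by
  have h1 : ContDiffAt ℝ 1 (fun z : ℝ × ℝ => ((derivative G).eval (C.α z.2))⁻¹) (θ, E) :=
    ((derivative G).contDiff_eval.contDiffAt.comp (θ, E)
      ((contDiffAt_α hE).comp (θ, E) contDiffAt_snd)).inv (C.deriv_α_neg E hE).ne
  have h2 : ContDiffAt ℝ 1 (fun z : ℝ × ℝ => ((derivative G).eval (C.β z.2))⁻¹) (θ, E) :=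
    ((derivative G).contDiff_eval.contDiffAt.comp (θ, E)
      ((contDiffAt_β hE).comp (θ, E) contDiffAt_snd)).inv (C.deriv_β_pos E hE).ne'
  have h3 : ContDiffAt ℝ 1 (fun z : ℝ × ℝ => sin z.1) (θ, E) :=
    contDiff_sin.contDiffAt.comp (θ, E) contDiffAt_fst
  exact ((h1.add h2).div_const 2).add (((h2.sub h1).div_const 2).mul h3)

lemma contDiffAt_den (hE : E ∈ Ioo lo hi) : ContDiffAt ℝ 1 (C.den f) (θ, E, ε) := by
  have hp : ContDiffAt ℝ 1 (fun z : ℝ × ℝ × ℝ => (z.1, z.2.1)) (θ, E, ε) := by fun_prop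
  have h1 := (contDiffAt_xcoord (C := C) (θ := θ) hE).comp (θ, E, ε) hp
  have h2 := (contDiffAt_q (C := C) (θ := θ) hE).comp (θ, E, ε) hp
  have h3 := (contDiffAt_dX (C := C) (θ := θ) hE).comp (θ, E, ε) hp
  have h4 := f.contDiff_eval.contDiffAt.comp (θ, E, ε) h1
  have h5 : ContDiffAt ℝ 1 (fun z : ℝ × ℝ × ℝ => cos z.1) (θ, E, ε) :=
    contDiff_cos.contDiffAt.comp (θ, E, ε) contDiffAt_fst
  have h6 : ContDiffAt ℝ 1 (fun z : ℝ × ℝ × ℝ => z.2.2) (θ, E, ε) := by fun_prop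
  exact contDiffAt_const.add (h6.mul (((h3.mul h4).mul h2).mul h5))

lemma contDiffAt_R (hE : E ∈ Ioo lo hi) (hd : C.den f (θ, E, ε) ≠ 0) :
    ContDiffAt ℝ 1 (C.R f) (θ, E, ε) := by
  have hp : ContDiffAt ℝ 1 (fun z : ℝ × ℝ × ℝ => (z.1, z.2.1)) (θ, E, ε) := by fun_prop
  have h1 := (contDiffAt_xcoord (C := C) (θ := θ) hE).comp (θ, E, ε) hp
  have h2 := (contDiffAt_q (C := C) (θ := θ) hE).comp (θ, E, ε) hp
  have h4 := f.contDiff_eval.contDiffAt.comp (θ, E, ε) h1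
  have h5 : ContDiffAt ℝ 1 (fun z : ℝ × ℝ × ℝ => cos z.1) (θ, E, ε) :=
    contDiff_cos.contDiffAt.comp (θ, E, ε) contDiffAt_fst
  have hp2 : ContDiffAt ℝ 1 (fun z : ℝ × ℝ × ℝ => z.2.1) (θ, E, ε) := by fun_prop
  have h6 : ContDiffAt ℝ 1 (fun z : ℝ × ℝ × ℝ => C.r z.2.1) (θ, E, ε) :=
    ContDiffAt.comp (g := C.r) (θ, E, ε)
      (((contDiffAt_β (C := C) hE).sub (contDiffAt_α hE)).div_const 2) hp2
  exact (((h4.mul h2).mul h6).mul (h5.pow 2)).neg.div (contDiffAt_den hE) hd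

lemma continuousAt_w (hE : E ∈ Ioo lo hi) (hd : C.den f (θ, E, ε) ≠ 0) :
    ContinuousAt (C.w f) (θ, E, ε) := by
  have hp : ContDiffAt ℝ 1 (fun z : ℝ × ℝ × ℝ => (z.1, z.2.1)) (θ, E, ε) := by fun_prop
  have h2 := (contDiffAt_q (C := C) (θ := θ) hE).comp (θ, E, ε) hp
  have hp2 : ContDiffAt ℝ 1 (fun z : ℝ × ℝ × ℝ => z.2.1) (θ, E, ε) := by fun_prop
  have h6 : ContDiffAt ℝ 1 (fun z : ℝ × ℝ × ℝ => C.r z.2.1) (θ, E, ε) :=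
    ContDiffAt.comp (g := C.r) (θ, E, ε)
      (((contDiffAt_β (C := C) hE).sub (contDiffAt_α hE)).div_const 2) hp2
  exact (h6.div (h2.mul (contDiffAt_den hE)) (mul_ne_zero (q_pos hE).ne' hd)).continuousAt

lemma contDiffAt_Φ (hE : E ∈ Ioo lo hi) : ContDiffAt ℝ 1 C.Φ (θ, E) := by
  have h5 : ContDiffAt ℝ 1 (fun z : ℝ × ℝ => cos z.1) (θ, E) :=
    contDiff_cos.contDiffAt.comp (θ, E) contDiffAt_fst
  exact (contDiffAt_xcoord hE).prodMk ((contDiffAt_q hE).mul h5)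

lemma xcoord_periodic : C.xcoord (θ + 2 * π, E) = C.xcoord (θ, E) := by simp [xcoord]

lemma q_periodic : C.q (θ + 2 * π, E) = C.q (θ, E) := by simp [q, xcoord_periodic]

lemma den_periodic : C.den f (θ + 2 * π, E, ε) = C.den f (θ, E, ε) := by
  simp [den, xcoord_periodic, q_periodic, dX]

lemma exists_den_pos (hE : E ∈ Ioo lo hi) :
    ∃ δ > 0, ∀ θ E' ε, |E' - E| < δ → |ε| < δ → E' ∈ Ioo lo hi ∧ 0 < C.den f (θ, E', ε) := by
  have h := isCompact_Icc.eventually_forall_of_forall_eventually (x₀ := ((E, 0) : ℝ × ℝ))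
    (K := Icc 0 (2 * π)) (P := fun z θ => 0 < C.den f (θ, z)) (fun θ _ => by
      have hc : ContinuousAt (fun z : (ℝ × ℝ) × ℝ => C.den f (z.2, z.1)) ((E, 0), θ) :=
        ContinuousAt.comp (f := fun z : (ℝ × ℝ) × ℝ => (z.2, z.1)) (x := ((E, 0), θ))
          (contDiffAt_den (f := f) hE).continuousAt (by fun_prop)
      exact hc.eventually (lt_mem_nhds (by simp [den])))
  have h' : ∀ᶠ z : ℝ × ℝ in 𝓝 (E, 0), z.1 ∈ Ioo lo hi :=
    continuousAt_fst.eventually (isOpen_Ioo.mem_nhds hE)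
  obtain ⟨δ, hδ, hδ'⟩ := Metric.eventually_nhds_iff.1 (h.and h')
  refine ⟨δ, hδ, fun θ E' ε h1 h2 => ?_⟩
  have h3 : dist ((E', ε) : ℝ × ℝ) (E, 0) < δ := by
    rw [Prod.dist_eq, Real.dist_eq, Real.dist_eq, sub_zero]; exact max_lt h1 h2
  refine ⟨(hδ' h3).2, ?_⟩
  obtain ⟨θ₀, hθ₀, he⟩ := Function.Periodic.exists_mem_Ico₀ (f := fun θ => C.den f (θ, E', ε))
    (fun θ => den_periodic) two_pi_pos θ
  rw [he]
  exact (hδ' h3).1 θ₀ (Ico_subset_Icc_self hθ₀)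

lemma R_periodic : C.R f (θ + 2 * π, E, ε) = C.R f (θ, E, ε) := by
  simp [R, xcoord_periodic, q_periodic, den_periodic]

lemma w_periodic : C.w f (θ + 2 * π, E, ε) = C.w f (θ, E, ε) := by
  simp [w, q_periodic, den_periodic]

lemma Φ_periodic : C.Φ (θ + 2 * π, E) = C.Φ (θ, E) := by
  simp [Φ, xcoord_periodic, q_periodic]

lemma exists_Φ_eq {z : ℝ × ℝ} (hz : z.1 ∈ Ioo a b)
    (hE : z.2 ^ 2 / 2 + G.eval z.1 ∈ Ioo lo hi) :
    ∃ θ, C.Φ (θ, z.2 ^ 2 / 2 + G.eval z.1) = z := by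
  obtain ⟨x, y⟩ := z
  simp only at hz hE ⊢
  generalize hEE : y ^ 2 / 2 + G.eval x = E at hE ⊢
  have hr := r_pos (C := C) hE
  have h1 : C.α E ≤ x := by
    by_contra! h
    nlinarith [C.lt_eval_left E hE x ⟨hz.1.le, h⟩]
  have h2 : x ≤ C.β E := by
    by_contra! h
    nlinarith [C.lt_eval_right E hE x ⟨h, hz.2.le⟩]
  set s := (x - (C.α E + C.β E) / 2) / C.r E with hs
  have hs1 : -1 ≤ s := by
    rw [hs, le_div_iff₀ hr]; simp only [r]; linarith
  have hs2 : s ≤ 1 := by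
    rw [hs, div_le_iff₀ hr]; simp only [r]; linarith
  have key : ∀ θ, sin θ = s → 0 ≤ cos θ * y → C.Φ (θ, E) = (x, y) := by
    intro θ hθ hy
    have hX : C.xcoord (θ, E) = x := by
      simp only [xcoord, hθ, hs]; field_simp; ring
    have hen := energy (C := C) (θ := θ) hE
    rw [hX] at hen
    have hsq : (C.q (θ, E) * cos θ) ^ 2 = y ^ 2 := by linarith
    have hq := q_pos (C := C) (θ := θ) hE
    simp only [Φ, hX, Prod.mk.injEq, true_and]
    rcases sq_eq_sq_iff_eq_or_eq_neg.1 hsq with h | h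
    · exact h
    · have : y ^ 2 ≤ 0 := by
        have : 0 ≤ C.q (θ, E) * (cos θ * y) := mul_nonneg hq.le hy
        rw [← mul_assoc, h] at this
        nlinarith
      have hy0 : y = 0 := by nlinarith
      rw [h, hy0, neg_zero]
  have hcos : 0 ≤ cos (arcsin s) := cos_nonneg_of_neg_pi_div_two_le_of_le
    (neg_pi_div_two_le_arcsin s) (arcsin_le_pi_div_two s)
  rcases le_or_gt 0 y with hy | hy
  · exact ⟨arcsin s, key _ (sin_arcsin hs1 hs2) (mul_nonneg hcos hy)⟩
  · refine ⟨π - arcsin s, key _ (by rw [sin_pi_sub, sin_arcsin hs1 hs2]) ?_⟩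
    rw [cos_pi_sub]; nlinarith

lemma hasDerivAt_flow {u : ℝ → ℝ} (hE : u θ ∈ Ioo lo hi) (hd : C.den f (θ, u θ, ε) ≠ 0)
    (hu : HasDerivAt u (ε * C.R f (θ, u θ, ε)) θ) :
    HasDerivAt (fun θ => C.Φ (θ, u θ))
      (C.w f (θ, u θ, ε) • lienard f (derivative G) ε (C.Φ (θ, u θ))) θ := by
  have hq := q_pos (C := C) (θ := θ) hE
  have hX : HasDerivAt (fun θ => C.xcoord (θ, u θ))
      (C.w f (θ, u θ, ε) * (C.q (θ, u θ) * cos θ)) θ := by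
    have h1 := (C.hasDerivAt_α _ hE).comp θ hu
    have h2 := (C.hasDerivAt_β _ hE).comp θ hu
    have h3 := ((h1.add h2).div_const 2).add (((h2.sub h1).div_const 2).mul (hasDerivAt_sin θ))
    refine h3.congr_deriv ?_
    have hd' : C.den f (θ, u θ, ε) = 1 + ε * (C.dX (θ, u θ) * f.eval (C.xcoord (θ, u θ)) *
      C.q (θ, u θ) * cos θ) := rfl
    have e1 : C.w f (θ, u θ, ε) * (C.q (θ, u θ) * cos θ) =
        C.r (u θ) * cos θ / C.den f (θ, u θ, ε) := by
      simp only [w]; field_simp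
    rw [e1, eq_div_iff hd]
    have e2 : C.R f (θ, u θ, ε) * C.den f (θ, u θ, ε) =
        -(f.eval (C.xcoord (θ, u θ)) * C.q (θ, u θ) * C.r (u θ) * cos θ ^ 2) := by
      simp only [R]; field_simp
    trans C.dX (θ, u θ) * ε * (C.R f (θ, u θ, ε) * C.den f (θ, u θ, ε)) +
      C.r (u θ) * cos θ * C.den f (θ, u θ, ε)
    · simp only [dX, r, Pi.sub_apply, Function.comp_apply]; ring
    · rw [e2, hd']; ring
  have hqd : DifferentiableAt ℝ (fun θ => C.q (θ, u θ)) θ :=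
    DifferentiableAt.comp (f := fun θ => (θ, u θ)) θ
      ((contDiffAt_q hE).differentiableAt one_ne_zero)
      (differentiableAt_id.prodMk hu.differentiableAt)
  have hY := hqd.hasDerivAt.mul (hasDerivAt_cos θ)
  generalize hY' : deriv (fun θ => C.q (θ, u θ)) θ * cos θ + C.q (θ, u θ) * -sin θ = Y' at hY
  have hYY : Y' = C.w f (θ, u θ, ε) * (-((derivative G).eval (C.xcoord (θ, u θ))) -
      ε * f.eval (C.xcoord (θ, u θ)) * (C.q (θ, u θ) * cos θ)) := by
    by_cases hc : cos θ = 0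
    · rw [← hY', hc]
      have hden : C.den f (θ, u θ, ε) = 1 := by simp [den, hc]
      simp only [w, hden]
      have hs : sin θ = 1 ∨ sin θ = -1 := by
        have := sin_sq_add_cos_sq θ
        rw [hc] at this
        exact sq_eq_one_iff.1 (by linarith)
      have hqs := q_sq (C := C) (θ := θ) hE
      rcases hs with hs | hs
      · have hXβ : C.xcoord (θ, u θ) = C.β (u θ) := by simp only [xcoord, r, hs]; ring
        rw [hXβ] at hqs ⊢
        have := C.deriv_β _ hE
        rw [this, hs]
        field_simp
        simp only [r] at hqs ⊢
        linear_combination -hqs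
      · have hXα : C.xcoord (θ, u θ) = C.α (u θ) := by simp only [xcoord, r, hs]; ring
        rw [hXα] at hqs ⊢
        have := C.deriv_α _ hE
        rw [this, hs]
        field_simp
        simp only [r] at hqs ⊢
        linear_combination hqs
    · have hen : HasDerivAt (fun θ => (C.q (θ, u θ) * cos θ) ^ 2 / 2 + G.eval (C.xcoord (θ, u θ)))
          (ε * C.R f (θ, u θ, ε)) θ := by
        refine hu.congr_of_eventuallyEq ?_
        filter_upwards [hu.continuousAt.eventually (isOpen_Ioo.mem_nhds hE)] with t ht
        exact energy ht
      have h4 := ((hY.pow 2).div_const 2).add ((G.hasDerivAt (C.xcoord (θ, u θ))).comp θ hX)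
      have h5 := hen.unique h4
      have e3 : C.R f (θ, u θ, ε) = -(f.eval (C.xcoord (θ, u θ)) * C.w f (θ, u θ, ε) *
          (C.q (θ, u θ) * cos θ) ^ 2) := by
        simp only [R, w]; field_simp
      rw [e3] at h5
      simp only [Pi.mul_apply, Nat.cast_ofNat] at h5
      refine mul_left_cancel₀ (mul_ne_zero hq.ne' hc) ?_
      linear_combination -h5
  rw [hYY] at hY
  exact hX.prodMk hY

end WellChart

/-- The first-order averaging integral `∫ f y dx` over the upper half of a level curve. -/
noncomputable def wellIntegral (f G : ℝ[X]) (a b h : ℝ) : ℝ :=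
  ∫ x in a..b, f.eval x * √(2 * (h - G.eval x))

namespace WellChart

open Set Topology MeasureTheory intervalIntegral Real

variable {G : ℝ[X]} {a b lo hi : ℝ} {C : WellChart G a b lo hi} {f : ℝ[X]} {θ E ε : ℝ}

lemma integral_R (hE : E ∈ Ioo lo hi) :
    ∫ θ in (0 : ℝ)..2 * π, C.R f (θ, E, 0) = -2 * wellIntegral f G a b E := by
  set k : ℝ → ℝ := fun θ => f.eval (C.xcoord (θ, E)) * C.q (θ, E) * C.r E * cos θ ^ 2 with hk
  set F : ℝ → ℝ := fun x => f.eval x * √(2 * (E - G.eval x)) with hF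
  have hFc : Continuous F := by fun_prop
  have hxc : Continuous fun θ => C.xcoord (θ, E) := by
    simp only [xcoord]; fun_prop
  have hqc : Continuous fun θ => C.q (θ, E) := continuous_iff_continuousAt.2 fun θ =>
    ContinuousAt.comp (f := fun θ => (θ, E)) (contDiffAt_q hE).continuousAt (by fun_prop)
  have hkc : Continuous k := by fun_prop
  have hRk : ∀ θ, C.R f (θ, E, 0) = -k θ := fun θ => by simp [R, den, hk]
  have hkper : Function.Periodic k (2 * π) := fun θ => by
    simp only [hk, xcoord_periodic, q_periodic, cos_add_two_pi]
  have hksymm : ∀ θ, k (π - θ) = k θ := fun θ => by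
    simp only [hk, xcoord, q, sin_pi_sub, cos_pi_sub, neg_sq]
  have h1 : ∫ θ in (0 : ℝ)..2 * π, k θ =
      (∫ θ in (-(π / 2))..(π / 2), k θ) + ∫ θ in (π / 2)..(3 * π / 2), k θ := by
    have := hkper.intervalIntegral_add_eq 0 (-(π / 2))
    rw [zero_add] at this
    rw [this, integral_add_adjacent_intervals (hkc.intervalIntegrable _ _)
      (hkc.intervalIntegrable _ _)]
    congr 1; ring
  have h2 : ∫ θ in (π / 2)..(3 * π / 2), k θ = ∫ θ in (-(π / 2))..(π / 2), k θ := by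
    have := integral_comp_sub_left (a := -(π / 2)) (b := π / 2) k π
    simp only [hksymm] at this
    rw [this]
    congr 1 <;> ring
  have h3 : ∫ θ in (-(π / 2))..(π / 2), k θ = ∫ x in C.α E..C.β E, F x := by
    have h4 := integral_comp_mul_deriv (a := -(π / 2)) (b := π / 2)
      (f := fun θ => C.xcoord (θ, E)) (f' := fun θ => C.r E * cos θ) (g := F)
      (fun θ _ => by
        simpa only [xcoord] using ((hasDerivAt_sin θ).const_mul (C.r E)).const_add _)
      (by fun_prop) hFc
    have e1 : C.xcoord (-(π / 2), E) = C.α E := by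
      simp only [xcoord, r, sin_neg, sin_pi_div_two]; ring
    have e2 : C.xcoord (π / 2, E) = C.β E := by
      simp only [xcoord, r, sin_pi_div_two]; ring
    rw [e1, e2] at h4
    rw [← h4]
    refine integral_congr fun θ hθ => ?_
    rw [uIcc_of_le (by linarith [pi_pos])] at hθ
    have hy : 0 ≤ C.q (θ, E) * cos θ :=
      mul_nonneg (q_pos hE).le (cos_nonneg_of_mem_Icc hθ)
    have hen := energy (C := C) (θ := θ) hE
    have : √(2 * (E - G.eval (C.xcoord (θ, E)))) = C.q (θ, E) * cos θ := by
      rw [← sqrt_sq hy]; congr 1; linarith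
    simp only [hk, hF, Function.comp, this]
    ring
  have h5 : wellIntegral f G a b E = ∫ x in C.α E..C.β E, F x := by
    have hz : ∀ x, E ≤ G.eval x → F x = 0 := fun x hx => by
      rw [hF]; simp only
      rw [sqrt_eq_zero_of_nonpos (by linarith), mul_zero]
    have hl : ∫ x in a..C.α E, F x = 0 := by
      refine integral_zero_ae (Eventually.of_forall fun x hx => hz x ?_)
      rw [uIoc_of_le (C.a_lt E hE).le] at hx
      rcases hx.2.eq_or_lt with h | h
      · rw [h, C.eval_α E hE]
      · exact (C.lt_eval_left E hE x ⟨hx.1.le, h⟩).le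
    have hr : ∫ x in C.β E..b, F x = 0 := by
      refine integral_zero_ae (Eventually.of_forall fun x hx => hz x ?_)
      rw [uIoc_of_le (C.lt_b E hE).le] at hx
      exact (C.lt_eval_right E hE x hx).le
    have hi := fun u v : ℝ => hFc.intervalIntegrable (μ := volume) u v
    have e1 := integral_add_adjacent_intervals (hi a (C.α E)) (hi (C.α E) b)
    have e2 := integral_add_adjacent_intervals (hi (C.α E) (C.β E)) (hi (C.β E) b)
    rw [wellIntegral, ← e1, ← e2, hl, hr, zero_add, add_zero]
  simp only [hRk]
  rw [intervalIntegral.integral_neg, h1, h2, h3, h5]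
  ring

lemma differentiableAt_wellIntegral (C : WellChart G a b lo hi) (f : ℝ[X]) (hE : E ∈ Ioo lo hi) :
    DifferentiableAt ℝ (wellIntegral f G a b) E := by
  have hR : ∀ θ, ContDiffAt ℝ 1 (C.R f) (θ, E, 0) := fun θ => contDiffAt_R hE (by simp [den])
  have hJ : IsCompact (Icc 0 (2 * π)) := isCompact_Icc
  obtain ⟨δ₁, hδ₁, M, hM, L, hL, hb, hl⟩ := exists_bounds hR hJ
  obtain ⟨ρ, hρ, hs⟩ := exists_uniform_strict hR hJ
  have h := hasDerivAt_integral_uniform two_pi_pos.le subset_rfl hρ hδ₁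
    (fun θ hθ E hE => (hb θ hθ E 0 hE (by simpa using hδ₁.le)).1) hs
  have h' := (h.const_mul (-(1 / 2))).differentiableAt
  refine h'.congr_of_eventuallyEq ?_
  filter_upwards [isOpen_Ioo.mem_nhds hE] with E' hE'
  rw [integral_R hE']; ring

end WellChart

open Set Real in
/-- A simple zero of the averaging integral inside a well produces a limit cycle. -/
theorem IsWell.exists_limitCycle {f G : ℝ[X]} {a c d b lo hi E₀ D : ℝ}
    (h : IsWell G a c d b lo hi) (hE : E₀ ∈ Ioo lo hi) (h0 : wellIntegral f G a b E₀ = 0)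
    (hD : HasDerivAt (wellIntegral f G a b) D E₀) (hD0 : D ≠ 0) :
    ∃ ε₀ > 0, ∀ ε, 0 < ε → ε ≤ ε₀ →
      ∃ Γ, IsLimitCycle (lienard f (derivative G) ε) Γ ∧
        ∀ z ∈ Γ, z.1 ∈ Ioo a b ∧ z.2 ^ 2 / 2 + G.eval z.1 ∈ Ioo lo hi := by
  obtain ⟨C⟩ := h.nonempty_chart
  obtain ⟨δ, hδ, hδ'⟩ := C.exists_den_pos (f := f) hE
  have hδE : ∀ E, |E - E₀| < δ → E ∈ Ioo lo hi := fun E h =>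
    (hδ' 0 E 0 h (by simpa using hδ)).1
  obtain ⟨ε₀, hε₀, H⟩ := exists_limitCycle_of_polar (V := fun ε => lienard f (derivative G) ε)
    (Φ := C.Φ) (H := fun z => z.2 ^ 2 / 2 + G.eval z.1) (U₀ := {z | z.1 ∈ Ioo a b})
    (R := C.R f) (w := C.w f) (E₀ := E₀) (δ₀ := δ) (D := -2 * D)
    (fun ε => by
      have h1 := f.contDiff_eval.comp (contDiff_fst (𝕜 := ℝ) (E := ℝ) (F := ℝ))
      have h2 := (derivative G).contDiff_eval.comp (contDiff_fst (𝕜 := ℝ) (E := ℝ) (F := ℝ))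
      exact contDiff_snd.prodMk (h2.neg.sub ((contDiff_const.mul h1).mul contDiff_snd)))
    (by fun_prop) (isOpen_Ioo.preimage continuous_fst) hδ
    (fun θ => WellChart.contDiffAt_R hE (by simp [WellChart.den]))
    (fun θ E ε => WellChart.R_periodic) (by rw [WellChart.integral_R hE, h0, mul_zero])
    ((hD.const_mul (-2)).congr_of_eventuallyEq (by
      filter_upwards [isOpen_Ioo.mem_nhds hE] with E hE
      exact WellChart.integral_R hE))
    (mul_ne_zero (by norm_num) hD0)
    (fun θ E hE => by
      have hE' := hδE E hE
      have hx := WellChart.xcoord_mem (C := C) (θ := θ) hE'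
      exact ⟨⟨(C.a_lt E hE').trans_le hx.1, hx.2.trans_lt (C.lt_b E hE')⟩,
        WellChart.energy hE', (WellChart.contDiffAt_Φ hE').continuousAt⟩)
    (fun θ E => WellChart.Φ_periodic)
    (fun z hz hE => WellChart.exists_Φ_eq hz (hδE _ hE))
    (fun θ E ε hE hε => by
      obtain ⟨h1, h2⟩ := hδ' θ E ε hE hε
      exact ⟨WellChart.continuousAt_w h1 h2.ne',
        div_pos (WellChart.r_pos h1) (mul_pos (WellChart.q_pos h1) h2)⟩)
    (fun θ E ε => WellChart.w_periodic)
    (fun u θ ε hε hu hd => by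
      obtain ⟨h1, h2⟩ := hδ' θ (u θ) ε hu hε
      exact WellChart.hasDerivAt_flow h1 h2.ne' hd)
    (fun E E' hE hE' heq => by
      have h1 := C.α_lt_β E' (hδE _ hE') E (hδE _ hE)
      have h2 := congrArg Prod.fst heq
      simp only [WellChart.Φ, WellChart.xcoord, WellChart.r, sin_neg, sin_pi_div_two] at h2
      linarith)
  refine ⟨ε₀, hε₀, fun ε h1 h2 => ?_⟩
  obtain ⟨Γ, hΓ, hsub⟩ := H ε h1 h2
  exact ⟨Γ, hΓ, fun z hz => ⟨(hsub hz).1, hδE _ (hsub hz).2⟩⟩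

/-- The parameters of a potential well; see `IsWell`. -/
structure WellData where
  a : ℝ
  c : ℝ
  d : ℝ
  b : ℝ
  lo : ℝ
  hi : ℝ

/-- `w` is a well of `G` in which the averaging integral of `f` changes sign. -/
structure WellData.Changes (w : WellData) (f G : ℝ[X]) : Prop where
  isWell : IsWell G w.a w.c w.d w.b w.lo w.hi
  mul_neg : wellIntegral f G w.a w.b w.lo * wellIntegral f G w.a w.b w.hi < 0

/-- Two wells which are disjoint in position or in energy. -/
def WellData.Separated (w w' : WellData) : Prop :=
  Disjoint (Set.Ioo w.a w.b) (Set.Ioo w'.a w'.b) ∨ Disjoint (Set.Ioo w.lo w.hi) (Set.Ioo w'.lo w'.hi)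

/-- There are `f` and `G` of degrees at most `m` and `m + 1` with `N` separated wells in which the
averaging integral changes sign. -/
def HasWells (N m : ℕ) : Prop :=
  ∃ f G : ℝ[X], f.natDegree ≤ m ∧ G.natDegree ≤ m + 1 ∧
    Tendsto (fun x => (derivative G).eval x) atTop atTop ∧
    ∃ (ι : Type) (_ : Fintype ι) (w : ι → WellData), Fintype.card ι = N ∧
      (∀ i, (w i).Changes f G) ∧ Pairwise fun i j => (w i).Separated (w j)

section WellIntegral

open Set Topology MeasureTheory intervalIntegral Real

variable {f G : ℝ[X]} {a b c d lo hi h : ℝ}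

lemma continuous_wellIntegrand (f G : ℝ[X]) (h : ℝ) :
    Continuous fun x => f.eval x * √(2 * (h - G.eval x)) := by fun_prop

lemma continuous_wellIntegral (f G : ℝ[X]) (a b : ℝ) : Continuous (wellIntegral f G a b) := by
  unfold wellIntegral
  apply intervalIntegral.continuous_parametric_intervalIntegral_of_continuous'
  fun_prop

lemma wellIntegral_add (f₁ f₂ G : ℝ[X]) (a b h : ℝ) :
    wellIntegral (f₁ + f₂) G a b h = wellIntegral f₁ G a b h + wellIntegral f₂ G a b h := by
  unfold wellIntegral
  rw [← intervalIntegral.integral_add ((continuous_wellIntegrand _ _ _).intervalIntegrable _ _)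
    ((continuous_wellIntegrand _ _ _).intervalIntegrable _ _)]
  simp only [eval_add, add_mul]

lemma wellIntegral_C_mul (s : ℝ) (f G : ℝ[X]) (a b h : ℝ) :
    wellIntegral (C s * f) G a b h = s * wellIntegral f G a b h := by
  unfold wellIntegral
  rw [← intervalIntegral.integral_const_mul]
  simp only [eval_mul, eval_C, mul_assoc]

lemma wellIntegral_sub_C (s : ℝ) (f G : ℝ[X]) (a b h : ℝ) :
    wellIntegral (f - C s) G a b h = wellIntegral f G a b h - s * wellIntegral 1 G a b h := by
  rw [show f - C s = f + C (-s) * 1 by simp [sub_eq_add_neg], wellIntegral_add,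
    wellIntegral_C_mul]
  ring

lemma IsWell.wellIntegral_one_pos (hw : IsWell G a c d b lo hi) (hh : lo ≤ h) :
    0 < wellIntegral 1 G a b h := by
  have h1 := hw.a_lt_c
  have h2 := hw.c_le_d
  have h3 := hw.d_lt_b
  refine intervalIntegral.integral_pos (by linarith)
    (continuous_wellIntegrand _ _ _).continuousOn (fun x _ => by simp)
    ⟨c, ⟨h1.le, by linarith⟩, ?_⟩
  have := hw.lt_lo c (left_mem_Icc.2 h2)
  simp only [eval_one, one_mul]
  exact sqrt_pos.2 (by linarith)

lemma volume_image_critical_eq_zero {ρ ρ' : ℝ → ℝ} {s : Set ℝ} (h : ∀ x ∈ s, HasDerivAt ρ (ρ' x) x)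
    (h0 : ∀ x ∈ s, ρ' x = 0) : volume (ρ '' s) = 0 := by
  refine addHaar_image_eq_zero_of_det_fderivWithin_eq_zero (f' := fun _ => 0) volume (fun x hx => ?_)
    (fun x _ => ?_)
  · have := (h x hx).hasDerivWithinAt (s := s)
    rw [h0 x hx] at this
    simpa using this.hasFDerivWithinAt
  · simp [ContinuousLinearMap.det]

/-- For almost every constant `s`, all zeros of the averaging integral of `f - s` are simple. -/
lemma IsWell.ae_simple_zeros (hw : IsWell G a c d b lo hi) (f : ℝ[X]) :
    ∀ᵐ s : ℝ, ∀ E ∈ Ioo lo hi, wellIntegral (f - C s) G a b E = 0 →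
      ∃ D, D ≠ 0 ∧ HasDerivAt (wellIntegral (f - C s) G a b) D E := by
  obtain ⟨K⟩ := hw.nonempty_chart
  set ρ : ℝ → ℝ := fun E => wellIntegral f G a b E / wellIntegral 1 G a b E with hρ
  set S := {E | E ∈ Ioo lo hi ∧ HasDerivAt ρ 0 E} with hS
  have h1 : ∀ᵐ s : ℝ, s ∉ ρ '' S := measure_eq_zero_iff_ae_notMem.1
    (volume_image_critical_eq_zero (ρ' := fun _ => 0) (fun x hx => hx.2) (fun _ _ => rfl))
  filter_upwards [h1] with s hs E hE h0
  have hd1 := (K.differentiableAt_wellIntegral f hE).hasDerivAt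
  have hd2 := (K.differentiableAt_wellIntegral 1 hE).hasDerivAt
  have hpos := hw.wellIntegral_one_pos hE.1.le
  have hd3 := hd1.sub (hd2.const_mul s)
  have heq : wellIntegral (f - C s) G a b =
      fun E => wellIntegral f G a b E - s * wellIntegral 1 G a b E := by
    ext E; exact wellIntegral_sub_C _ _ _ _ _ _
  rw [heq] at h0 ⊢
  refine ⟨_, fun hz => hs ⟨E, ⟨hE, ?_⟩, ?_⟩, hd3⟩
  · refine (hd1.div hd2 hpos.ne').congr_deriv ?_
    rw [div_eq_zero_iff]; left
    simp only at h0
    linear_combination wellIntegral 1 G a b E * hz - deriv (wellIntegral 1 G a b) E * h0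
  · simp only at h0
    rw [hρ]; simp only
    rw [div_eq_iff hpos.ne']; linarith

end WellIntegral

section LimitCycles

open Set Topology MeasureTheory Real

theorem HasWells.hGe {N m : ℕ} (h : HasWells N m) : HGe m m N := by
  obtain ⟨f, G, hf, hG, -, ι, _, w, hcard, hw, hsep⟩ := h
  have hev : ∀ᶠ s : ℝ in 𝓝 0, ∀ i, wellIntegral (f - C s) G (w i).a (w i).b (w i).lo *
      wellIntegral (f - C s) G (w i).a (w i).b (w i).hi < 0 := by
    refine eventually_all.2 fun i => ?_
    simp only [wellIntegral_sub_C]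
    have hc : Continuous fun s => (wellIntegral f G (w i).a (w i).b (w i).lo -
        s * wellIntegral 1 G (w i).a (w i).b (w i).lo) *
      (wellIntegral f G (w i).a (w i).b (w i).hi -
        s * wellIntegral 1 G (w i).a (w i).b (w i).hi) := by fun_prop
    exact hc.continuousAt.eventually (gt_mem_nhds (by simpa using (hw i).mul_neg))
  have hae : ∀ᵐ s : ℝ, ∀ i, ∀ E ∈ Ioo (w i).lo (w i).hi,
      wellIntegral (f - C s) G (w i).a (w i).b E = 0 →
      ∃ D, D ≠ 0 ∧ HasDerivAt (wellIntegral (f - C s) G (w i).a (w i).b) D E :=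
    ae_all_iff.2 fun i => (hw i).isWell.ae_simple_zeros f
  obtain ⟨U, hU, hUo, hU0⟩ := eventually_nhds_iff.1 hev
  obtain ⟨s, hsU, hs⟩ : ∃ s ∈ U, ∀ i, ∀ E ∈ Ioo (w i).lo (w i).hi,
      wellIntegral (f - C s) G (w i).a (w i).b E = 0 →
      ∃ D, D ≠ 0 ∧ HasDerivAt (wellIntegral (f - C s) G (w i).a (w i).b) D E := by
    by_contra! hcon
    have : U ⊆ {s | ¬ ∀ i, ∀ E ∈ Ioo (w i).lo (w i).hi,
      wellIntegral (f - C s) G (w i).a (w i).b E = 0 →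
      ∃ D, D ≠ 0 ∧ HasDerivAt (wellIntegral (f - C s) G (w i).a (w i).b) D E} := fun s hs => by
      simp only [mem_ofPred_eq]; push Not; exact hcon s hs
    exact (hUo.measure_pos volume ⟨0, hU0⟩).ne' (measure_mono_null this hae)
  have hcyc : ∀ i, ∀ᶠ ε in 𝓝[>] (0 : ℝ), ∃ Γ, IsLimitCycle (lienard (f - C s) (derivative G) ε) Γ ∧
      ∀ z ∈ Γ, z.1 ∈ Ioo (w i).a (w i).b ∧
        z.2 ^ 2 / 2 + G.eval z.1 ∈ Ioo (w i).lo (w i).hi := by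
    intro i
    have hneg := hU s hsU i
    obtain ⟨E, hE, hE0⟩ : ∃ E ∈ Ioo (w i).lo (w i).hi,
        wellIntegral (f - C s) G (w i).a (w i).b E = 0 := by
      have hlt := (hw i).isWell.lo_lt_hi.le
      have hc := (continuous_wellIntegral (f - C s) G (w i).a (w i).b).continuousOn
        (s := Icc (w i).lo (w i).hi)
      rcases mul_neg_iff.1 hneg with ⟨h1, h2⟩ | ⟨h1, h2⟩
      · exact intermediate_value_Ioo' hlt hc ⟨h2, h1⟩
      · exact intermediate_value_Ioo hlt hc ⟨h1, h2⟩
    obtain ⟨D, hD0, hD⟩ := hs i E hE hE0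
    obtain ⟨ε₀, hε₀, H⟩ := (hw i).isWell.exists_limitCycle hE hE0 hD hD0
    filter_upwards [Ioc_mem_nhdsGT hε₀] with ε hε
    exact H ε hε.1 hε.2
  obtain ⟨ε₀, hε₀, H⟩ := mem_nhdsGT_iff_exists_Ioc_subset.1 (eventually_all.2 hcyc)
  refine ⟨f - C s, derivative G, natDegree_sub_C.trans_le hf, ?_, ε₀, hε₀, fun ε h1 h2 => ?_⟩
  · exact (natDegree_derivative_le G).trans (by omega)
  choose Γ hΓ hΓw using H ⟨h1, h2⟩
  classical
  refine ⟨Finset.univ.image Γ, by simpa using hΓ, ?_⟩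
  rw [Finset.card_image_of_injective, Finset.card_univ, hcard]
  intro i j hij
  by_contra hne
  obtain ⟨γ, -, -, -, hγ⟩ := (hΓ i).1
  have hz : γ 0 ∈ Γ i := hγ ▸ mem_range_self 0
  have hi := hΓw i _ hz
  have hj := hΓw j _ (hij ▸ hz)
  rcases hsep hne with h | h
  · exact disjoint_left.1 h hi.1 hj.1
  · exact disjoint_left.1 h hi.2 hj.2

end LimitCycles

section OuterWells

open Set Topology MeasureTheory Real

variable {f G : ℝ[X]} {a b c d lo hi h : ℝ}

lemma wellIntegral_interval_add (f G : ℝ[X]) (a b c h : ℝ) :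
    wellIntegral f G a b h + wellIntegral f G b c h = wellIntegral f G a c h :=
  intervalIntegral.integral_add_adjacent_intervals
    ((continuous_wellIntegrand _ _ _).intervalIntegrable _ _)
    ((continuous_wellIntegrand _ _ _).intervalIntegrable _ _)

lemma wellIntegral_eq_zero (hab : a ≤ b) (hG : ∀ x ∈ Ioo a b, h ≤ G.eval x) :
    wellIntegral f G a b h = 0 := by
  rcases hab.eq_or_lt with rfl | hlt
  · simp [wellIntegral]
  have hG' : Icc a b ⊆ {x | h ≤ G.eval x} := by
    rw [← closure_Ioo hlt.ne]
    exact closure_minimal hG (isClosed_le continuous_const G.continuous)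
  refine intervalIntegral.integral_zero_ae (Eventually.of_forall fun x hx => ?_)
  rw [uIoc_of_le hab] at hx
  rw [sqrt_eq_zero_of_nonpos, mul_zero]
  have : h ≤ G.eval x := hG' (Ioc_subset_Icc_self hx)
  linarith

lemma wellIntegral_symm_eq {B₀ B : ℝ} (hB : B₀ ≤ B)
    (hG : ∀ x, B₀ ≤ |x| → h ≤ G.eval x) :
    wellIntegral f G (-B) B h = wellIntegral f G (-B₀) B₀ h := by
  rw [← wellIntegral_interval_add f G (-B) (-B₀) B, ← wellIntegral_interval_add f G (-B₀) B₀ B,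
    wellIntegral_eq_zero (by linarith), wellIntegral_eq_zero hB, zero_add, add_zero]
  · exact fun x hx => hG x (hx.1.le.trans (le_abs_self x))
  · exact fun x hx => hG x ((by linarith [hx.2] : B₀ ≤ -x).trans (neg_le_abs x))

lemma wellIntegral_nonneg (hab : a ≤ b) (hf : ∀ x ∈ Icc a b, 0 ≤ f.eval x) :
    0 ≤ wellIntegral f G a b h :=
  intervalIntegral.integral_nonneg hab fun x hx => mul_nonneg (hf x hx) (sqrt_nonneg _)

/-- If `f ≥ 1` outside a compact set, the averaging integral is positive at high energies. -/
lemma exists_wellIntegral_pos (G : ℝ[X]) {R : ℝ} (hf : ∀ x, R ≤ |x| → 1 ≤ f.eval x) :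
    ∃ L h₁, ∀ h, h₁ ≤ h → ∀ A B, L ≤ A → L ≤ B → 0 < wellIntegral f G (-A) B h := by
  wlog hR : 0 ≤ R
  · exact this G (R := 0) (fun x hx => hf x ((not_le.1 hR).le.trans hx)) le_rfl
  obtain ⟨M, hM⟩ := isCompact_Icc.exists_bound_of_continuousOn (f := fun x => f.eval x)
    (s := Icc (-R) R) f.continuous.continuousOn
  have hM0 : 0 ≤ M := (norm_nonneg _).trans (hM 0 ⟨by linarith, hR⟩)
  set L := R + 4 * M * R + 1 with hL
  have hMR : 0 ≤ M * R := mul_nonneg hM0 hR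
  have hRL : R ≤ L := by nlinarith
  obtain ⟨M₁, hM₁⟩ := isCompact_Icc.exists_bound_of_continuousOn (f := fun x => G.eval x)
    (s := Icc (-L) L) G.continuous.continuousOn
  simp only [Real.norm_eq_abs] at hM hM₁
  have hM₁0 : 0 ≤ M₁ := (abs_nonneg _).trans (hM₁ 0 ⟨by linarith, by linarith⟩)
  refine ⟨L, 2 * M₁ + 1, fun h hh A B hA hB => ?_⟩
  have h0 : 0 < h := by linarith
  have hs0 : 0 < √h := sqrt_pos.2 h0
  have hsq4 : √(4 * h) = 2 * √h := by
    rw [sqrt_mul (by norm_num), show (4 : ℝ) = 2 ^ 2 by norm_num, sqrt_sq (by norm_num)]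
  have hpos : ∀ u v, u ≤ v → (∀ x ∈ Icc u v, R ≤ |x|) → 0 ≤ wellIntegral f G u v h :=
    fun u v huv hx => wellIntegral_nonneg huv fun x hx' => by linarith [hf x (hx x hx')]
  have e1 := wellIntegral_interval_add f G (-A) (-R) B h
  have e2 := wellIntegral_interval_add f G (-R) R B h
  have e3 := wellIntegral_interval_add f G R L B h
  have p1 := hpos (-A) (-R) (by linarith) fun x hx =>
    (by linarith [hx.2] : R ≤ -x).trans (neg_le_abs x)
  have p2 := hpos L B hB fun x hx => (hRL.trans hx.1).trans (le_abs_self x)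
  have p3 : -(M * (2 * √h)) * (R - -R) ≤ wellIntegral f G (-R) R h := by
    have := intervalIntegral.integral_mono_on (μ := volume) (f := fun _ => -(M * (2 * √h)))
      (g := fun x => f.eval x * √(2 * (h - G.eval x))) (by linarith : -R ≤ R)
      intervalIntegrable_const ((continuous_wellIntegrand _ _ _).intervalIntegrable _ _) (fun x hx => by
        have h1 := hM x hx
        have h2 := hM₁ x ⟨by linarith [hx.1], by linarith [hx.2]⟩
        have h3 : √(2 * (h - G.eval x)) ≤ 2 * √h := by
          rw [← hsq4]; exact sqrt_le_sqrt (by linarith [(abs_le.1 h2).1])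
        have h4 := mul_le_mul h1 h3 (sqrt_nonneg _) hM0
        have h5 := (abs_le.1 (le_refl |f.eval x * √(2 * (h - G.eval x))|)).1
        rw [abs_mul, abs_of_nonneg (sqrt_nonneg _)] at h5
        linarith)
    rw [intervalIntegral.integral_const, smul_eq_mul] at this
    unfold wellIntegral
    linarith
  have p4 : √h * (L - R) ≤ wellIntegral f G R L h := by
    have := intervalIntegral.integral_mono_on (μ := volume) (f := fun _ => √h)
      (g := fun x => f.eval x * √(2 * (h - G.eval x))) hRL
      intervalIntegrable_const ((continuous_wellIntegrand _ _ _).intervalIntegrable _ _) (fun x hx => by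
        have h1 := hf x (hx.1.trans (le_abs_self x))
        have h2 := hM₁ x ⟨by linarith [hx.1], hx.2⟩
        have h3 : √h ≤ √(2 * (h - G.eval x)) :=
          sqrt_le_sqrt (by linarith [(abs_le.1 h2).2])
        nlinarith [sqrt_nonneg (2 * (h - G.eval x))])
    rw [intervalIntegral.integral_const, smul_eq_mul] at this
    unfold wellIntegral
    linarith
  have : √h * (L - R) - M * (2 * √h) * (2 * R) = √h := by rw [hL]; ring
  linarith

lemma wellIntegral_comp_neg {f f' : ℝ[X]} {s : ℝ} (hf : ∀ x, f.eval (-x) = s * f'.eval x)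
    (hG : ∀ x, G.eval (-x) = G.eval x) :
    wellIntegral f G (-b) (-a) h = s * wellIntegral f' G a b h := by
  unfold wellIntegral
  rw [← intervalIntegral.integral_comp_neg, ← intervalIntegral.integral_const_mul]
  simp only [hf, hG, mul_assoc]

lemma wellIntegral_odd {f : ℝ[X]} {B : ℝ} (hf : ∀ x, f.eval (-x) = -f.eval x)
    (hG : ∀ x, G.eval (-x) = G.eval x) : wellIntegral f G (-B) B h = 0 := by
  have := wellIntegral_comp_neg (f := f) (f' := f) (s := -1) (a := -B) (b := B) (h := h)
    (fun x => by rw [hf]; ring) hG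
  rw [neg_neg] at this
  linarith

lemma eval_derivative_neg (hG : ∀ x, G.eval (-x) = G.eval x) (x : ℝ) :
    (derivative G).eval (-x) = -(derivative G).eval x := by
  have h1 := (G.hasDerivAt (-x)).comp x (hasDerivAt_neg x)
  have h2 : (fun x => G.eval x) ∘ Neg.neg = fun x => G.eval x := by ext x; exact hG x
  rw [h2] at h1
  have := h1.unique (G.hasDerivAt x)
  linarith

lemma IsWell.neg (hG : ∀ x, G.eval (-x) = G.eval x) (hw : IsWell G a c d b lo hi) :
    IsWell G (-b) (-d) (-c) (-a) lo hi where
  a_lt_c := neg_lt_neg hw.d_lt_b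
  c_le_d := neg_le_neg hw.c_le_d
  d_lt_b := neg_lt_neg hw.a_lt_c
  lo_lt_hi := hw.lo_lt_hi
  deriv_neg x hx := by
    have := hw.deriv_pos (-x) ⟨by linarith [hx.2], by linarith [hx.1]⟩
    rw [eval_derivative_neg hG] at this
    linarith
  deriv_pos x hx := by
    have := hw.deriv_neg (-x) ⟨by linarith [hx.2], by linarith [hx.1]⟩
    rw [eval_derivative_neg hG] at this
    linarith
  lt_lo x hx := by
    rw [← hG]; exact hw.lt_lo (-x) ⟨by linarith [hx.2], by linarith [hx.1]⟩
  hi_lt_left := by rw [hG]; exact hw.hi_lt_right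
  hi_lt_right := by rw [hG]; exact hw.hi_lt_left

/-- Even polynomials of degree `2 k` whose averaging integrals alternate in sign along `k + 1`
increasing energies. -/
lemma exists_alternating (hG : ∀ M, ∃ B, ∀ x, B ≤ |x| → M ≤ G.eval x) (H₀ : ℝ) (k : ℕ) :
    ∃ (r : ℝ[X]) (h : ℕ → ℝ) (B₀ : ℝ), r.natDegree ≤ k ∧ H₀ ≤ h 0 ∧ StrictMonoOn h (Iic k) ∧
      0 ≤ B₀ ∧ (∀ x, B₀ ≤ |x| → h k ≤ G.eval x) ∧
      ∀ j ≤ k, 0 < (-1) ^ j * wellIntegral (r.comp (X ^ 2)) G (-B₀) B₀ (h j) := by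
  induction k with
  | zero =>
    obtain ⟨L, h₁, hpos⟩ := exists_wellIntegral_pos (f := 1) G (R := 0) (fun x _ => by simp)
    obtain ⟨B, hB⟩ := hG (max H₀ h₁)
    refine ⟨1, fun _ => max H₀ h₁, max 0 (max L B), by simp, le_max_left _ _, ?_,
      le_max_left _ _, fun x hx => hB x ?_, fun j hj => ?_⟩
    · intro x hx y hy hxy
      simp only [mem_Iic, Nat.le_zero] at hx hy
      omega
    · exact ((le_max_right _ _).trans (le_max_right _ _)).trans hx
    · obtain rfl := Nat.le_zero.1 hj
      have hL : L ≤ max 0 (max L B) := (le_max_left _ _).trans (le_max_right _ _)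
      simpa using hpos _ (le_max_right _ _) _ _ hL hL
  | succ k ih =>
    obtain ⟨r, h, B₀, hr, hH, hmono, hB₀, hGB, hsign⟩ := ih
    set s : ℝ := (-1) ^ (k + 1) with hs
    have hss : s * s = 1 := by rw [hs, ← pow_add, Even.neg_one_pow ⟨_, rfl⟩]
    set r' : ℝ → ℝ[X] := fun η => r + C (s * η) * X ^ (k + 1) with hr'
    have hW : ∀ η A B E, wellIntegral ((r' η).comp (X ^ 2)) G A B E =
        wellIntegral (r.comp (X ^ 2)) G A B E +
          s * η * wellIntegral ((X ^ (k + 1) : ℝ[X]).comp (X ^ 2)) G A B E := by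
      intro η A B E
      rw [hr']; simp only
      rw [add_comp, mul_comp, C_comp, wellIntegral_add, wellIntegral_C_mul]
    have hev : ∀ᶠ η in 𝓝 (0 : ℝ), ∀ j ∈ Finset.range (k + 1),
        0 < (-1) ^ j * wellIntegral ((r' η).comp (X ^ 2)) G (-B₀) B₀ (h j) := by
      refine (eventually_all_finset _).2 fun j hj => ?_
      simp only [hW]
      have hc : Continuous fun η : ℝ => (-1 : ℝ) ^ j *
          (wellIntegral (r.comp (X ^ 2)) G (-B₀) B₀ (h j) +
            s * η * wellIntegral ((X ^ (k + 1) : ℝ[X]).comp (X ^ 2)) G (-B₀) B₀ (h j)) := by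
        fun_prop
      refine hc.continuousAt.eventually (lt_mem_nhds ?_)
      simpa using hsign j (Nat.lt_succ_iff.1 (Finset.mem_range.1 hj))
    obtain ⟨η, hη, hη0⟩ := ((hev.filter_mono nhdsWithin_le_nhds).and
      (self_mem_nhdsWithin (s := Ioi (0 : ℝ)))).exists
    have hη0 : 0 < η := hη0
    have htend : Tendsto (fun x => (C s * r' η).eval x) atTop atTop := by
      have e : C s * r' η = C η * X ^ (k + 1) + C s * r := by
        rw [hr']; simp only
        rw [mul_add, ← mul_assoc, ← C_mul, ← mul_assoc, hss, one_mul, add_comm]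
      have hd : (C s * r).degree < (C η * X ^ (k + 1) : ℝ[X]).degree := by
        rw [degree_C_mul_X_pow _ hη0.ne']
        exact (degree_le_of_natDegree_le ((natDegree_C_mul_le _ _).trans hr)).trans_lt
          (by exact_mod_cast Nat.lt_succ_self k)
      rw [e]
      refine tendsto_atTop_of_leadingCoeff_nonneg _ ?_ ?_
      · rw [degree_add_eq_left_of_degree_lt hd, degree_C_mul_X_pow _ hη0.ne']
        exact_mod_cast Nat.succ_pos k
      · rw [leadingCoeff_add_of_degree_lt' hd, leadingCoeff_C_mul_X_pow]
        exact hη0.le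
    obtain ⟨A, hA⟩ := eventually_atTop.1 (htend.eventually_ge_atTop 1)
    obtain ⟨L, h₁, hpos⟩ := exists_wellIntegral_pos (f := (C s * r' η).comp (X ^ 2)) G
      (R := max 1 |A|) (fun x hx => by
        have h1 : 1 ≤ |x| := (le_max_left _ _).trans hx
        have h2 : |A| ≤ |x| := (le_max_right _ _).trans hx
        rw [eval_comp, eval_pow, eval_X]
        refine hA _ ?_
        rw [← sq_abs]
        nlinarith [le_abs_self A])
    set hn := max (h k + 1) h₁ with hhn
    obtain ⟨B, hB⟩ := hG hn
    set B₁ := max B₀ (max L B) with hB₁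
    have hkn : h k < hn := (lt_add_one _).trans_le (le_max_left _ _)
    refine ⟨r' η, fun j => if j ≤ k then h j else hn, B₁, ?_, by simpa using hH, ?_,
      hB₀.trans (le_max_left _ _), fun x hx => ?_, fun j hj => ?_⟩
    · refine (natDegree_add_le _ _).trans (max_le (hr.trans (Nat.le_succ k)) ?_)
      exact natDegree_C_mul_X_pow_le _ _
    · intro i hi j hj hij
      simp only [mem_Iic] at hi hj
      rcases Nat.lt_or_ge k j with hkj | hkj
      · have hik : i ≤ k := by omega
        simp only [hik, if_true, not_le.2 hkj, if_false]
        exact (hmono.monotoneOn hik (mem_Iic.2 le_rfl) hik).trans_lt hkn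
      · have hik : i ≤ k := by omega
        simp only [hik, if_true, hkj]
        exact hmono hik hkj hij
    · simp only [not_le.2 (Nat.lt_succ_self k), if_false]
      exact hB x (((le_max_right _ _).trans (le_max_right _ _)).trans hx)
    · rcases Nat.lt_or_ge k j with hkj | hkj
      · obtain rfl : j = k + 1 := by omega
        simp only [not_le.2 hkj, if_false]
        have hL : L ≤ B₁ := (le_max_left _ _).trans (le_max_right _ _)
        have := hpos hn (le_max_right _ _) B₁ B₁ hL hL
        rwa [mul_comp, C_comp, wellIntegral_C_mul] at this
      · simp only [hkj, if_true]
        rw [wellIntegral_symm_eq (le_max_left _ _) fun x hx =>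
          (hmono.monotoneOn hkj (mem_Iic.2 le_rfl) hkj).trans (hGB x hx)]
        exact hη j (Finset.mem_range.2 (by omega))

end OuterWells

/-- The lift of a well along the right branch of `u ↦ u ^ 2 - κ`. -/
noncomputable def WellData.liftRight (κ : ℝ) (w : WellData) : WellData :=
  ⟨√(w.a + κ), √(w.c + κ), √(w.d + κ), √(w.b + κ), w.lo, w.hi⟩

/-- The mirror image of a well. -/
def WellData.mirror (w : WellData) : WellData :=
  ⟨-w.b, -w.d, -w.c, -w.a, w.lo, w.hi⟩

section Doubling

open Set Topology MeasureTheory Real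

variable {f G : ℝ[X]} {a b c d lo hi h κ : ℝ}

lemma WellData.Separated.symm {w w' : WellData} (h : w.Separated w') : w'.Separated w :=
  h.imp (fun h => h.symm) fun h => h.symm

lemma eval_comp_sq_sub (P : ℝ[X]) (κ x : ℝ) : (P.comp (X ^ 2 - C κ)).eval x = P.eval (x ^ 2 - κ) := by
  simp

lemma eval_derivative_comp_sq_sub (P : ℝ[X]) (κ x : ℝ) :
    (derivative (P.comp (X ^ 2 - C κ))).eval x = 2 * x * (derivative P).eval (x ^ 2 - κ) := by
  simp only [derivative_comp, derivative_sub, derivative_C, sub_zero, derivative_X_pow, eval_mul,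
    eval_comp, eval_sub, eval_C, eval_pow, eval_X]
  norm_num

lemma IsWell.lift (hw : IsWell G a c d b lo hi) (ha : 0 < a + κ) :
    IsWell (G.comp (X ^ 2 - C κ)) √(a + κ) √(c + κ) √(d + κ) √(b + κ) lo hi := by
  have h1 := hw.a_lt_c
  have h2 := hw.c_le_d
  have h3 := hw.d_lt_b
  have sa := sq_sqrt ha.le
  have sc := sq_sqrt (by linarith : 0 ≤ c + κ)
  have sd := sq_sqrt (by linarith : 0 ≤ d + κ)
  have sb := sq_sqrt (by linarith : 0 ≤ b + κ)
  have pa := sqrt_pos.2 ha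
  have pc := sqrt_nonneg (c + κ)
  have pd := sqrt_nonneg (d + κ)
  have pb := sqrt_nonneg (b + κ)
  refine ⟨sqrt_lt_sqrt ha.le (by linarith), sqrt_le_sqrt (by linarith),
    sqrt_lt_sqrt (by linarith) (by linarith), hw.lo_lt_hi, fun x hx => ?_, fun x hx => ?_,
    fun x hx => ?_, ?_, ?_⟩
  · have := hw.deriv_neg (x ^ 2 - κ) ⟨by nlinarith [hx.1], by nlinarith [hx.1, hx.2]⟩
    rw [eval_derivative_comp_sq_sub]
    nlinarith [hx.1]
  · have := hw.deriv_pos (x ^ 2 - κ) ⟨by nlinarith [hx.1], by nlinarith [hx.1, hx.2]⟩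
    rw [eval_derivative_comp_sq_sub]
    have : 0 < x := by linarith [hx.1]
    positivity
  · rw [eval_comp_sq_sub]
    exact hw.lt_lo (x ^ 2 - κ) ⟨by nlinarith [hx.1], by nlinarith [hx.1, hx.2]⟩
  · rw [eval_comp_sq_sub, sa, add_sub_cancel_right]; exact hw.hi_lt_left
  · rw [eval_comp_sq_sub, sb, add_sub_cancel_right]; exact hw.hi_lt_right

lemma wellIntegral_lift (f G : ℝ[X]) (ha : 0 ≤ a + κ) (hb : 0 ≤ b + κ) (h : ℝ) :
    wellIntegral (f.comp (X ^ 2 - C κ) * (C 2 * X)) (G.comp (X ^ 2 - C κ)) √(a + κ) √(b + κ) h =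
      wellIntegral f G a b h := by
  have := intervalIntegral.integral_comp_mul_deriv (a := √(a + κ)) (b := √(b + κ))
    (f := fun x => x ^ 2 - κ) (f' := fun x => 2 * x) (g := fun x => f.eval x * √(2 * (h - G.eval x)))
    (fun x _ => by simpa using (hasDerivAt_pow 2 x).sub_const κ) (by fun_prop) (by fun_prop)
  rw [sq_sqrt ha, sq_sqrt hb, add_sub_cancel_right, add_sub_cancel_right] at this
  unfold wellIntegral
  rw [← this]
  refine intervalIntegral.integral_congr fun x _ => ?_
  simp
  ring

lemma tendsto_atTop_of_tendsto_derivative {P : ℝ[X]}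
    (hP : Tendsto (fun x => (derivative P).eval x) atTop atTop) :
    Tendsto (fun x => P.eval x) atTop atTop := by
  obtain ⟨A, hA⟩ := eventually_atTop.1 (hP.eventually_ge_atTop 1)
  refine tendsto_atTop_mono' atTop (f₁ := fun x => P.eval A + (x - A)) ?_
    (tendsto_atTop_add_const_left _ _ (tendsto_atTop_add_const_right _ _ tendsto_id))
  filter_upwards [eventually_ge_atTop A] with x hx
  have := (convex_Ici A).mul_sub_le_image_sub_of_le_deriv (f := fun x => P.eval x) (C := 1)
    P.continuous.continuousOn P.differentiable.differentiableOn (fun y hy => by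
      rw [interior_Ici] at hy
      rw [Polynomial.deriv]
      exact hA y (le_of_lt hy)) A self_mem_Ici x hx hx
  linarith

lemma WellData.Changes.congr_sign {w w' : WellData} {f f' G G' : ℝ[X]}
    (hw : IsWell G' w'.a w'.c w'.d w'.b w'.lo w'.hi)
    {s : ℝ} (hs : s ≠ 0)
    (hlo : wellIntegral f' G' w'.a w'.b w'.lo = s * wellIntegral f G w.a w.b w.lo)
    (hhi : wellIntegral f' G' w'.a w'.b w'.hi = s * wellIntegral f G w.a w.b w.hi)
    (h : w.Changes f G) : w'.Changes f' G' := by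
  refine ⟨hw, ?_⟩
  rw [hlo, hhi]
  have := mul_neg_of_pos_of_neg (mul_self_pos.2 hs) h.mul_neg
  linarith

lemma WellData.Changes.eventually_perturb {w : WellData} (hw : w.Changes f G) (r : ℝ[X]) :
    ∀ᶠ δ in 𝓝 (0 : ℝ), w.Changes (f + C δ * r) G := by
  have hc : Continuous fun δ : ℝ =>
      (wellIntegral f G w.a w.b w.lo + δ * wellIntegral r G w.a w.b w.lo) *
      (wellIntegral f G w.a w.b w.hi + δ * wellIntegral r G w.a w.b w.hi) := by fun_prop
  filter_upwards [(hc.tendsto 0).eventually_lt_const (u := 0) (by simpa using hw.mul_neg)]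
    with δ hδ
  refine ⟨hw.isWell, ?_⟩
  simp only [wellIntegral_add, wellIntegral_C_mul]
  exact hδ

lemma WellData.Changes.liftRight {w : WellData} (hw : w.Changes f G) (hκ : 0 < w.a + κ) :
    (w.liftRight κ).Changes (f.comp (X ^ 2 - C κ) * (C 2 * X)) (G.comp (X ^ 2 - C κ)) := by
  have hb : 0 ≤ w.b + κ := by
    linarith [hw.isWell.a_lt_c, hw.isWell.c_le_d, hw.isWell.d_lt_b]
  refine WellData.Changes.congr_sign (w := w) (f := f) (G := G) (s := 1) (hw.isWell.lift hκ)
    one_ne_zero ?_ ?_ hw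
  · rw [one_mul]; exact wellIntegral_lift _ _ hκ.le hb _
  · rw [one_mul]; exact wellIntegral_lift _ _ hκ.le hb _

lemma WellData.Changes.mirror {w : WellData} (hw : w.Changes f G)
    (hf : ∀ x, f.eval (-x) = -f.eval x) (hG : ∀ x, G.eval (-x) = G.eval x) :
    w.mirror.Changes f G := by
  refine WellData.Changes.congr_sign (w := w) (f := f) (G := G) (s := -1) (hw.isWell.neg hG)
    (by norm_num) ?_ ?_ hw
  · exact wellIntegral_comp_neg (fun x => by rw [hf]; ring) hG
  · exact wellIntegral_comp_neg (fun x => by rw [hf]; ring) hG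

lemma WellData.Separated.liftRight {w w' : WellData} (h : w.Separated w')
    (hw : 0 < w.a + κ) (hw' : 0 < w'.a + κ) :
    (w.liftRight κ).Separated (w'.liftRight κ) := by
  refine h.imp (fun h => Set.disjoint_left.2 fun x hx hx' => ?_) id
  simp only [WellData.liftRight] at hx hx'
  have key : ∀ v : WellData, 0 < v.a + κ → x ∈ Ioo √(v.a + κ) √(v.b + κ) →
      x ^ 2 - κ ∈ Ioo v.a v.b := fun v hv hx => by
    have h0 : 0 < x := (sqrt_nonneg _).trans_lt hx.1
    have h1 := (sqrt_lt' h0).1 hx.1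
    have h2 := (lt_sqrt h0.le).1 hx.2
    exact ⟨by linarith, by linarith⟩
  exact Set.disjoint_left.1 h (key w hw hx) (key w' hw' hx')

lemma WellData.Separated.mirror {w w' : WellData} (h : w.Separated w') :
    w.mirror.Separated w'.mirror := by
  refine h.imp (fun h => Set.disjoint_left.2 fun x hx hx' => ?_) id
  simp only [WellData.mirror, mem_Ioo] at hx hx'
  exact Set.disjoint_left.1 h (show -x ∈ _ from ⟨by linarith [hx.2], by linarith [hx.1]⟩)
    ⟨by linarith [hx'.2], by linarith [hx'.1]⟩

lemma WellData.separated_of_le {w w' : WellData} (h : w.hi ≤ w'.lo) : w.Separated w' :=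
  Or.inr (Set.disjoint_left.2 fun _ hx hx' => by linarith [hx.2, hx'.1])

/-- Composition with `u ↦ u ^ 2 - κ` doubles the wells, and an even perturbation adds outer ones. -/
theorem HasWells.double {N m : ℕ} (H : HasWells N m) : HasWells (2 * N + m) (2 * m + 1) := by
  obtain ⟨f, G, hf, hG, hg, ι, _, w, hcard, hw, hsep⟩ := H
  set κ : ℝ := 1 + ∑ i, |(w i).a| with hκ
  have hκw : ∀ i, 0 < (w i).a + κ := fun i => by
    have := Finset.single_le_sum (f := fun i => |(w i).a|) (fun i _ => abs_nonneg _)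
      (Finset.mem_univ i)
    have h2 := neg_abs_le (w i).a
    linarith
  set F : ℝ[X] := f.comp (X ^ 2 - C κ) * (C 2 * X) with hF
  set G' : ℝ[X] := G.comp (X ^ 2 - C κ) with hG'
  have hFodd : ∀ x, F.eval (-x) = -F.eval x := fun x => by simp [hF]
  have hGeven : ∀ x, G'.eval (-x) = G'.eval x := fun x => by simp [hG']
  have hderiv : Tendsto (fun x => (derivative G').eval x) atTop atTop := by
    simp only [hG', eval_derivative_comp_sq_sub]
    refine (tendsto_id.const_mul_atTop (by norm_num)).atTop_mul_atTop₀ (hg.comp ?_)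
    exact tendsto_atTop_add_const_right _ _ (tendsto_pow_atTop (by norm_num))
  have hGtop := tendsto_atTop_of_tendsto_derivative hderiv
  have hGabs : ∀ x, G'.eval |x| = G'.eval x := fun x => by
    rcases abs_choice x with h | h <;> rw [h]
    exact hGeven x
  have hGlarge : ∀ M, ∃ B, ∀ x, B ≤ |x| → M ≤ G'.eval x := fun M => by
    obtain ⟨B, hB⟩ := eventually_atTop.1 (hGtop.eventually_ge_atTop M)
    exact ⟨B, fun x hx => by rw [← hGabs]; exact hB _ hx⟩
  obtain ⟨A, hA⟩ := eventually_atTop.1 (hderiv.eventually_gt_atTop 0)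
  set R : ℝ := max A 0 with hR
  have hR0 : 0 ≤ R := le_max_right _ _
  obtain ⟨M, hM⟩ := isCompact_Icc.exists_bound_of_continuousOn (f := fun x => G'.eval x)
    (s := Icc (-R) R) G'.continuous.continuousOn
  set H₀ : ℝ := (M + 1) + ∑ i, |(w i).hi| with hH₀
  have hM0 : 0 ≤ M := (norm_nonneg _).trans (hM 0 ⟨by linarith, hR0⟩)
  have hH₀M : M < H₀ := by
    have : 0 ≤ ∑ i, |(w i).hi| := Finset.sum_nonneg fun i _ => abs_nonneg _
    linarith
  have hH₀w : ∀ i, (w i).hi ≤ H₀ := fun i => by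
    have := Finset.single_le_sum (f := fun i => |(w i).hi|) (fun i _ => abs_nonneg _)
      (Finset.mem_univ i)
    have h2 := le_abs_self (w i).hi
    linarith
  obtain ⟨r, h, B₀, hr, hh0, hmono, hB₀, hGB, hsign⟩ := exists_alternating hGlarge H₀ m
  obtain ⟨B₁, hB₁⟩ := eventually_atTop.1 (hGtop.eventually_gt_atTop (h m))
  set B : ℝ := max (max B₀ B₁) (R + 1) with hB
  have hBB₀ : B₀ ≤ B := (le_max_left _ _).trans (le_max_left _ _)
  have hBR : R < B := (lt_add_one R).trans_le (le_max_right _ _)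
  have hGBm : h m < G'.eval B := hB₁ B ((le_max_right _ _).trans (le_max_left _ _))
  have hev : ∀ᶠ δ in 𝓝 (0 : ℝ), ∀ i,
      ((w i).liftRight κ).Changes (F + C δ * r.comp (X ^ 2)) G' ∧
      ((w i).liftRight κ).mirror.Changes (F + C δ * r.comp (X ^ 2)) G' :=
    eventually_all.2 fun i => ((hw i).liftRight (hκw i)).eventually_perturb _ |>.and
      ((((hw i).liftRight (hκw i)).mirror hFodd hGeven).eventually_perturb _)
  obtain ⟨δ, hδ, hδ0⟩ := ((hev.filter_mono nhdsWithin_le_nhds).and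
    (self_mem_nhdsWithin (s := Ioi (0 : ℝ)))).exists
  have hδ0 : 0 < δ := hδ0
  have hle : ∀ k ≤ m, H₀ ≤ h k := fun k hk =>
    hh0.trans (hmono.monotoneOn (mem_Iic.2 (Nat.zero_le _)) (mem_Iic.2 hk) (Nat.zero_le _))
  have houter : ∀ k : Fin m, (⟨-B, -R, R, B, h k, h (k + 1)⟩ : WellData).Changes
      (F + C δ * r.comp (X ^ 2)) G' := fun k => by
    have hk1 : (k : ℕ) + 1 ≤ m := k.2
    have hkm : h (k + 1) ≤ h m := hmono.monotoneOn (mem_Iic.2 hk1) (mem_Iic.2 le_rfl) hk1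
    have hWk : ∀ j ≤ m, wellIntegral (F + C δ * r.comp (X ^ 2)) G' (-B) B (h j) =
        δ * wellIntegral (r.comp (X ^ 2)) G' (-B₀) B₀ (h j) := fun j hj => by
      rw [wellIntegral_add, wellIntegral_C_mul, wellIntegral_odd hFodd hGeven, zero_add,
        wellIntegral_symm_eq hBB₀ fun x hx =>
          (hmono.monotoneOn (mem_Iic.2 hj) (mem_Iic.2 le_rfl) hj).trans (hGB x hx)]
    refine ⟨⟨by simpa using hBR, by simpa using hR0, hBR,
      hmono (mem_Iic.2 (Nat.le_of_lt k.2)) (mem_Iic.2 hk1) (Nat.lt_succ_self _), fun x hx => ?_,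
      fun x hx => ?_, fun x hx => ?_, ?_, hkm.trans_lt hGBm⟩, ?_⟩
    · have := hA (-x) (by linarith [hx.2, le_max_left A 0])
      rw [eval_derivative_neg hGeven] at this
      linarith
    · exact hA x ((le_max_left A 0).trans hx.1.le)
    · have h1 : |G'.eval x| ≤ M := hM x hx
      change G'.eval x < h k
      have := hle k (Nat.le_of_lt k.2)
      linarith [le_abs_self (G'.eval x)]
    · simp only [hGeven]
      exact hkm.trans_lt hGBm
    · simp only
      rw [hWk _ (Nat.le_of_lt k.2), hWk _ hk1]
      have h1 := hsign k (Nat.le_of_lt k.2)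
      have h2 := hsign (k + 1) hk1
      have h3 := mul_pos (mul_pos hδ0 hδ0) (mul_pos h1 h2)
      have h4 : (-1 : ℝ) ^ (k : ℕ) * (-1) ^ (k : ℕ) = 1 := by
        rw [← pow_add, Even.neg_one_pow ⟨_, rfl⟩]
      rw [pow_succ (-1 : ℝ) (k : ℕ)] at h3
      generalize wellIntegral _ _ _ _ (h k) = x at *
      generalize wellIntegral _ _ _ _ (h (k + 1)) = y at *
      have h5 : δ * x * (δ * y) = -(δ * δ * ((-1) ^ (k : ℕ) * x * ((-1) ^ (k : ℕ) * -1 * y))) := by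
        linear_combination -(δ * δ * x * y) * h4
      rw [h5]
      linarith
  have hpos : ∀ i, Ioo ((w i).liftRight κ).a ((w i).liftRight κ).b ⊆ Ioi 0 := fun i x hx =>
    (sqrt_nonneg _).trans_lt hx.1
  have hneg : ∀ i, Ioo ((w i).liftRight κ).mirror.a ((w i).liftRight κ).mirror.b ⊆ Iio 0 :=
    fun i x hx => hx.2.trans_le (neg_nonpos.2 (sqrt_nonneg _))
  have hLR : ∀ i j, ((w i).liftRight κ).Separated ((w j).liftRight κ).mirror := fun i j =>
    Or.inl ((Set.disjoint_left.2 fun x hx hx' => lt_asymm (mem_Ioi.1 hx) (mem_Iio.1 hx') :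
      Disjoint (Ioi (0 : ℝ)) (Iio 0)).mono (hpos i) (hneg j))
  refine ⟨F + C δ * r.comp (X ^ 2), G', ?_, ?_, hderiv, ι ⊕ ι ⊕ Fin m, inferInstance,
    Sum.elim (fun i => (w i).liftRight κ) (Sum.elim (fun i => ((w i).liftRight κ).mirror)
      fun k => ⟨-B, -R, R, B, h k, h (k + 1)⟩), ?_, ?_, ?_⟩
  · have h1 : (X ^ 2 - C κ : ℝ[X]).natDegree = 2 := natDegree_X_pow_sub_C
    refine (natDegree_add_le _ _).trans (max_le ?_ ?_)
    · refine natDegree_mul_le.trans ?_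
      rw [natDegree_comp, h1]
      have := (natDegree_C_mul_le (2 : ℝ) X).trans natDegree_X_le
      omega
    · refine (natDegree_C_mul_le _ _).trans ?_
      rw [natDegree_comp, natDegree_X_pow]
      omega
  · rw [hG', natDegree_comp, natDegree_X_pow_sub_C]
    omega
  · simp only [Fintype.card_sum, Fintype.card_fin, hcard]
    ring
  · rintro (i | i | k)
    · exact (hδ i).1
    · exact (hδ i).2
    · exact houter k
  · rintro (i | i | k) (j | j | l) hij
    · exact (hsep fun e => hij (by rw [e])).liftRight (hκw i) (hκw j)
    · exact hLR i j
    · exact WellData.separated_of_le ((hH₀w i).trans (hle l l.2.le))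
    · exact (hLR j i).symm
    · exact ((hsep fun e => hij (by rw [e])).liftRight (hκw i) (hκw j)).mirror
    · exact WellData.separated_of_le ((hH₀w i).trans (hle l l.2.le))
    · exact WellData.Separated.symm (WellData.separated_of_le ((hH₀w j).trans (hle k k.2.le)))
    · exact WellData.Separated.symm (WellData.separated_of_le ((hH₀w j).trans (hle k k.2.le)))
    · have hkl : (k : ℕ) ≠ l := fun e => hij (by rw [Fin.ext e])
      rcases hkl.lt_or_gt with hkl | hkl
      · exact WellData.separated_of_le (hmono.monotoneOn (mem_Iic.2 k.2) (mem_Iic.2 l.2.le) hkl)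
      · exact (WellData.separated_of_le
          (hmono.monotoneOn (mem_Iic.2 l.2) (mem_Iic.2 k.2.le) hkl)).symm

end Doubling

section SaddleLoop

open Set Topology MeasureTheory Real

lemma hasDerivAt_sqrt_pow_three (u : ℝ) :
    HasDerivAt (fun u : ℝ => √u ^ 3) (3 / 2 * √u) u := by
  have key : ∀ u : ℝ, u ≠ 0 → HasDerivAt (fun u : ℝ => √u ^ 3) (3 / 2 * √u) u := fun u hu => by
    rcases hu.lt_or_gt with hu | hu
    · have h1 : (fun u : ℝ => √u ^ 3) =ᶠ[𝓝 u] fun _ => 0 := by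
        filter_upwards [gt_mem_nhds hu] with w hw
        rw [sqrt_eq_zero_of_nonpos (le_of_lt hw), zero_pow three_ne_zero]
      rw [sqrt_eq_zero_of_nonpos hu.le, mul_zero]
      exact (hasDerivAt_const u (0 : ℝ)).congr_of_eventuallyEq h1
    · have h0 := (sqrt_pos.2 hu).ne'
      have h1 : 3 / 2 * √u = 3 * √u ^ 2 * (1 / (2 * √u)) := by field_simp
      rw [h1]
      simpa using (hasDerivAt_sqrt hu.ne').fun_pow 3
  by_cases hu : u = 0
  · subst hu
    exact hasDerivAt_of_hasDerivAt_of_ne (f := fun u : ℝ => √u ^ 3) (g := fun u => 3 / 2 * √u) key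
      (by fun_prop) (by fun_prop)
  · exact key u hu

/-- Minus twice the potential `x ^ 2 * ((x + μ) ^ 2 - 1) / 2` of an asymmetric Duffing oscillator. -/
def duffing (μ x : ℝ) : ℝ := x ^ 2 * (1 - (x + μ) ^ 2)

@[fun_prop]
lemma continuous_duffing (μ : ℝ) : Continuous (duffing μ) := by unfold duffing; fun_prop

lemma hasDerivAt_duffing (μ x : ℝ) :
    HasDerivAt (duffing μ) (2 * x * (1 - μ ^ 2 - 3 * μ * x - 2 * x ^ 2)) x := by
  have h1 : HasDerivAt (fun x : ℝ => x ^ 2) (2 * x) x := by simpa using hasDerivAt_pow 2 x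
  have h2 : HasDerivAt (fun x : ℝ => 1 - (x + μ) ^ 2) (-(2 * (x + μ))) x := by
    simpa using (((hasDerivAt_id x).add_const μ).pow 2).const_sub 1
  have h3 : 2 * x * (1 - μ ^ 2 - 3 * μ * x - 2 * x ^ 2) =
      2 * x * (1 - (x + μ) ^ 2) + x ^ 2 * (-(2 * (x + μ))) := by ring
  rw [h3]
  exact h1.mul h2

lemma exists_bezout {μ a : ℝ} (hμ0 : 0 ≤ μ) (hμ1 : μ < 1) (ha : 0 ≤ a) :
    ∃ Q S : ℝ[X], 0 < S.eval 0 ∧ (derivative Q).eval 0 + 3 * S.eval 0 = 0 ∧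
      ∀ x, x + a = -(Q.eval x * (1 - μ ^ 2 - 3 * μ * x - 2 * x ^ 2)) +
        S.eval x * (x * (1 - (x + μ) ^ 2)) := by
  have hL : 0 < 1 - μ ^ 2 := by nlinarith
  set k := -a / (1 - μ ^ 2) with hk
  set s := (1 - 3 * μ * k) / (4 * (1 - μ ^ 2)) with hs
  set δ := 7 * s + μ * (11 * μ * s - 2 * k) / (1 - μ ^ 2) with hδ
  set γ := μ * δ + (11 * μ * s - 2 * k) / (1 - μ ^ 2) with hγ
  have hk0 : k * (1 - μ ^ 2) = -a := by rw [hk]; field_simp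
  have hs0 : s * (4 * (1 - μ ^ 2)) = 1 - 3 * μ * k := by rw [hs]; field_simp
  have hγ0 : γ * (1 - μ ^ 2) = μ * δ * (1 - μ ^ 2) + (11 * μ * s - 2 * k) := by rw [hγ]; field_simp
  have hδ0 : δ = 7 * s + μ * (γ - μ * δ) := by rw [hγ, hδ]; ring
  refine ⟨C k + C (-3 * s) * X + C γ * X ^ 2 + C δ * X ^ 3,
    C s + C (2 * γ - μ * δ) * X + C (2 * δ) * X ^ 2, ?_, ?_, fun x => ?_⟩
  · have hk1 : k ≤ 0 := div_nonpos_of_nonpos_of_nonneg (by linarith) hL.le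
    have : 0 < s := div_pos (by nlinarith) (by linarith)
    simpa using this
  · simp
  · simp only [eval_add, eval_mul, eval_C, eval_X, eval_pow]
    clear_value γ δ s k
    linear_combination hk0 - x * hs0 - x ^ 2 * hγ0 - x ^ 3 * hδ0

end SaddleLoop

/-- The logarithmically divergent factor of the second order term of `∫ f y` at a saddle loop. -/
noncomputable def saddleKernel (α H : ℝ) : ℝ :=
  ∫ θ in -(Real.pi / 2)..Real.pi / 2, Real.cos θ /
    (√(H + ((Real.sin θ - Real.sin α) * Real.cos θ) ^ 2) + |(Real.sin θ - Real.sin α) * Real.cos θ|)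

section SaddleLoopExpansion

open Set Topology MeasureTheory Real

variable {α a H R μ : ℝ} {Q S P : ℝ[X]}

lemma integral_bezout (hid : ∀ x, x + a = -(Q.eval x * (1 - μ ^ 2 - 3 * μ * x - 2 * x ^ 2)) +
      S.eval x * (x * (1 - (x + μ) ^ 2)))
    (hl : H + duffing μ (-R) ≤ 0) (hr : H + duffing μ R ≤ 0) :
    ∫ x in -R..R, x * (x + a) * √(H + duffing μ x) =
      ∫ x in -R..R, ((C (1 / 3) * derivative Q + S).eval x * √(H + duffing μ x) ^ 3 -
        H * S.eval x * √(H + duffing μ x)) := by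
  have hd : ∀ x, HasDerivAt (fun x => -(1 / 3) * (Q.eval x * √(H + duffing μ x) ^ 3))
      (x * (x + a) * √(H + duffing μ x) -
        ((C (1 / 3) * derivative Q + S).eval x * √(H + duffing μ x) ^ 3 -
        H * S.eval x * √(H + duffing μ x))) x := fun x => by
    have h1 := (hasDerivAt_sqrt_pow_three (H + duffing μ x)).comp x
      ((hasDerivAt_duffing μ x).const_add H)
    have h2 := ((Q.hasDerivAt x).mul h1).const_mul (-(1 / 3) : ℝ)
    refine h2.congr_deriv ?_
    have h3 : S.eval x * √(H + duffing μ x) * (√(H + duffing μ x) ^ 2 - (H + duffing μ x)) = 0 := by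
      rcases le_total 0 (H + duffing μ x) with h0 | h0
      · rw [sq_sqrt h0]; ring
      · rw [sqrt_eq_zero_of_nonpos h0]; ring
    simp only [eval_add, eval_mul, eval_C, Function.comp]
    unfold duffing at *
    generalize √(H + x ^ 2 * (1 - (x + μ) ^ 2)) = Y at *
    rw [hid]
    linear_combination h3
  have hcont : Continuous fun x => x * (x + a) * √(H + duffing μ x) := by fun_prop
  have hcont' : Continuous fun x => ((C (1 / 3) * derivative Q + S).eval x * √(H + duffing μ x) ^ 3 -
      H * S.eval x * √(H + duffing μ x)) := by fun_prop
  have := intervalIntegral.integral_eq_sub_of_hasDerivAt (a := -R) (b := R) (fun x _ => hd x)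
    ((hcont.sub hcont').intervalIntegrable _ _)
  rw [sqrt_eq_zero_of_nonpos hl, sqrt_eq_zero_of_nonpos hr,
    intervalIntegral.integral_sub (hcont.intervalIntegrable _ _)
      (hcont'.intervalIntegrable _ _)] at this
  simp only [ne_eq, OfNat.ofNat_ne_zero, not_false_eq_true, zero_pow, mul_zero, sub_zero] at this
  linarith

lemma abs_integral_le_of_eq_zero {φ : ℝ → ℝ} (hφ : Continuous φ) {e R w B : ℝ} (heR : e ≤ R)
    (hw : 0 ≤ w) (hB : 0 ≤ B) (hb : ∀ x ∈ Icc e R, |φ x| ≤ B)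
    (h0 : ∀ x ∈ Icc e R, e + w ≤ x → φ x = 0) : |∫ x in e..R, φ x| ≤ B * w := by
  have h1 : ∫ x in min (e + w) R..R, φ x = 0 := by
    refine intervalIntegral.integral_zero_ae (Eventually.of_forall fun x hx => ?_)
    rw [uIoc_of_le (min_le_right _ _)] at hx
    rcases min_lt_iff.1 hx.1 with h | h
    · exact h0 x ⟨by linarith, hx.2⟩ h.le
    · exact absurd hx.2 (not_le.2 h)
  have hem : e ≤ min (e + w) R := le_min (by linarith) heR
  rw [← intervalIntegral.integral_add_adjacent_intervals (hφ.intervalIntegrable e (min (e + w) R))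
    (hφ.intervalIntegrable _ _), h1, add_zero]
  refine (intervalIntegral.norm_integral_le_of_norm_le_const (f := φ) (C := B) fun x hx => ?_).trans ?_
  · rw [uIoc_of_le hem] at hx
    exact hb x ⟨hx.1.le, hx.2.trans (min_le_right _ _)⟩
  · rw [abs_of_nonneg (by linarith)]
    gcongr
    linarith [min_le_left (e + w) R]

lemma integral_comp_sin (F : ℝ → ℝ) (hF : Continuous F) (α : ℝ) :
    ∫ x in (-1 - sin α)..(1 - sin α), F x =
      ∫ θ in -(π / 2)..π / 2, F (sin θ - sin α) * cos θ := by
  have := intervalIntegral.integral_comp_mul_deriv (a := -(π / 2)) (b := π / 2)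
    (f := fun θ => sin θ - sin α) (f' := cos) (g := F)
    (fun x _ => (hasDerivAt_sin x).sub_const _) (by fun_prop) hF
  simp only [sin_neg, sin_pi_div_two] at this
  exact this.symm

lemma duffing_sin (α θ : ℝ) :
    duffing (sin α) (sin θ - sin α) = ((sin θ - sin α) * cos θ) ^ 2 := by
  unfold duffing
  rw [mul_pow, cos_sq']
  ring

lemma continuous_kernel (α : ℝ) (hH : 0 < H) : Continuous fun θ => cos θ /
    (√(H + ((sin θ - sin α) * cos θ) ^ 2) + |(sin θ - sin α) * cos θ|) := by
  refine continuous_cos.div (by fun_prop) fun θ => ?_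
  have : 0 < √(H + ((sin θ - sin α) * cos θ) ^ 2) := sqrt_pos.2 (by positivity)
  positivity

/-- Second order expansion of the part of the integral between the two vertices of the saddle
loops. -/
lemma inner_expansion {M : ℝ} (hP : ∀ x, |x| ≤ 2 → |P.eval x| ≤ M * |x|)
    (hS : ∀ x, |x| ≤ 2 → |S.eval x - S.eval 0| ≤ M * |x|) (hH : 0 < H) :
    |(∫ θ in -(π / 2)..π / 2, (P.eval (sin θ - sin α) * √(H + ((sin θ - sin α) * cos θ) ^ 2) ^ 3 -
        H * S.eval (sin θ - sin α) * √(H + ((sin θ - sin α) * cos θ) ^ 2)) * cos θ) -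
      (∫ θ in -(π / 2)..π / 2, P.eval (sin θ - sin α) * |(sin θ - sin α) * cos θ| ^ 3 * cos θ) -
      H * (∫ θ in -(π / 2)..π / 2, (3 / 2 * P.eval (sin θ - sin α) - S.eval (sin θ - sin α)) *
        |(sin θ - sin α) * cos θ| * cos θ) + H ^ 2 * (S.eval 0 * saddleKernel α H)| ≤
      2 * π * M * H ^ 2 := by
  unfold saddleKernel
  have hk := continuous_kernel α hH
  set z : ℝ → ℝ := fun θ => |(sin θ - sin α) * cos θ| with hz
  set s : ℝ → ℝ := fun θ => √(H + ((sin θ - sin α) * cos θ) ^ 2) with hs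
  have hzc : Continuous z := by fun_prop
  have hsc : Continuous s := by fun_prop
  have hPc : Continuous fun θ => P.eval (sin θ - sin α) := by fun_prop
  have hSc : Continuous fun θ => S.eval (sin θ - sin α) := by fun_prop
  change |(∫ θ in -(π / 2)..π / 2, (P.eval (sin θ - sin α) * s θ ^ 3 -
        H * S.eval (sin θ - sin α) * s θ) * cos θ) -
      (∫ θ in -(π / 2)..π / 2, P.eval (sin θ - sin α) * z θ ^ 3 * cos θ) -
      H * (∫ θ in -(π / 2)..π / 2, (3 / 2 * P.eval (sin θ - sin α) - S.eval (sin θ - sin α)) *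
        z θ * cos θ) + H ^ 2 * (S.eval 0 * ∫ θ in -(π / 2)..π / 2, cos θ / (s θ + z θ))| ≤ _
  rw [← intervalIntegral.integral_sub, ← intervalIntegral.integral_const_mul,
    ← intervalIntegral.integral_sub, ← intervalIntegral.integral_const_mul,
    ← intervalIntegral.integral_const_mul, ← intervalIntegral.integral_add]
  rotate_left
  · exact Continuous.intervalIntegrable (by fun_prop) _ _
  · exact Continuous.intervalIntegrable (by fun_prop) _ _
  · exact Continuous.intervalIntegrable (by fun_prop) _ _
  · exact Continuous.intervalIntegrable (by fun_prop) _ _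
  · exact Continuous.intervalIntegrable (by fun_prop) _ _
  · exact Continuous.intervalIntegrable (by fun_prop) _ _
  refine (Real.norm_eq_abs _).symm.trans_le ?_
  refine (intervalIntegral.norm_integral_le_of_norm_le_const (C := 2 * M * H ^ 2)
    fun θ hθ => ?_).trans_eq ?_
  · rw [uIoc_of_le (by linarith [pi_pos])] at hθ
    have hc : 0 ≤ cos θ := cos_nonneg_of_neg_pi_div_two_le_of_le hθ.1.le hθ.2
    have hx2 : |sin θ - sin α| ≤ 2 := abs_le.2
      ⟨by linarith [neg_one_le_sin θ, sin_le_one α], by linarith [neg_one_le_sin α, sin_le_one θ]⟩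
    have hp := hP _ hx2
    have hq := hS _ hx2
    have hzx : z θ = |sin θ - sin α| * cos θ := by simp only [hz]; rw [abs_mul, abs_of_nonneg hc]
    have hz0 : 0 ≤ z θ := abs_nonneg _
    have hs0 : 0 < s θ := sqrt_pos.2 (by positivity)
    have hs2 : s θ ^ 2 = H + z θ ^ 2 := by
      simp only [hs, hz]; rw [sq_sqrt (by positivity), sq_abs]
    have hM : 0 ≤ M := by
      have := (abs_nonneg _).trans (hP 1 (by norm_num))
      simpa using this
    generalize P.eval (sin θ - sin α) = p at *
    generalize S.eval (sin θ - sin α) = q at *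
    generalize s θ = s at *
    generalize z θ = z at *
    have hsz : 0 < s + z := by linarith
    have key : (p * s ^ 3 - H * q * s) * cos θ - p * z ^ 3 * cos θ -
        H * ((3 / 2 * p - q) * z * cos θ) + H ^ 2 * (S.eval 0 * (cos θ / (s + z))) =
        H ^ 2 * ((p * cos θ) * ((s + z / 2) / (s + z) ^ 2) -
          ((q - S.eval 0) * cos θ) * (1 / (s + z))) := by
      have hHe : H = (s - z) * (s + z) := by linear_combination -hs2
      rw [hHe]
      field_simp
      ring
    rw [key, Real.norm_eq_abs, abs_mul, abs_of_nonneg (sq_nonneg H), mul_comm (2 * M)]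
    refine mul_le_mul_of_nonneg_left ?_ (sq_nonneg H)
    have h1 : |p * cos θ| ≤ M * z := by
      rw [abs_mul, abs_of_nonneg hc, hzx, ← mul_assoc]
      exact mul_le_mul_of_nonneg_right hp hc
    have h2 : |(q - S.eval 0) * cos θ| ≤ M * z := by
      rw [abs_mul, abs_of_nonneg hc, hzx, ← mul_assoc]
      exact mul_le_mul_of_nonneg_right hq hc
    have h3 : z * ((s + z / 2) / (s + z) ^ 2) ≤ 1 := by
      rw [← mul_div_assoc, div_le_one (by positivity)]
      nlinarith
    have h4 : z * (1 / (s + z)) ≤ 1 := by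
      rw [← mul_div_assoc, div_le_one hsz]
      linarith
    refine (abs_sub _ _).trans ?_
    rw [abs_mul (p * cos θ), abs_mul ((q - S.eval 0) * cos θ), abs_of_pos (show 0 < (s + z / 2) / (s + z) ^ 2 by positivity),
      abs_of_pos (show 0 < 1 / (s + z) by positivity)]
    have h5 := mul_le_mul_of_nonneg_right h1 (show 0 ≤ (s + z / 2) / (s + z) ^ 2 by positivity)
    have h6 := mul_le_mul_of_nonneg_right h2 (show 0 ≤ 1 / (s + z) by positivity)
    have h7 := mul_le_mul_of_nonneg_left h3 hM
    have h8 := mul_le_mul_of_nonneg_left h4 hM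
    linarith
  · rw [abs_of_pos (by linarith [pi_pos])]
    ring

end SaddleLoopExpansion

/-- The coefficient of the linear term of `∫ x (x + a) y` at a saddle loop. -/
noncomputable def saddleSlope (α a : ℝ) : ℝ := Real.cos α + (Real.sin α - a) * α

section SaddleLoopOuter

open Set Topology MeasureTheory Real

variable {α a H R μ : ℝ} {Q S P : ℝ[X]}

lemma sin_sub_sin_mul_cos_nonneg {θ : ℝ} (hα : α ∈ Icc 0 (π / 2)) (hθ : θ ∈ Icc α (π / 2)) :
    0 ≤ (sin θ - sin α) * cos θ :=
  mul_nonneg (sub_nonneg.2 (sin_le_sin_of_le_of_le_pi_div_two (by linarith [hα.1, pi_pos]) hθ.2 hθ.1))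
    (cos_nonneg_of_neg_pi_div_two_le_of_le (by linarith [hα.1, hθ.1, pi_pos]) hθ.2)

lemma sin_sub_sin_mul_cos_nonpos {θ : ℝ} (hα : α ∈ Icc 0 (π / 2)) (hθ : θ ∈ Icc (-(π / 2)) α) :
    (sin θ - sin α) * cos θ ≤ 0 :=
  mul_nonpos_of_nonpos_of_nonneg
    (sub_nonpos.2 (sin_le_sin_of_le_of_le_pi_div_two hθ.1 hα.2 hθ.2))
    (cos_nonneg_of_neg_pi_div_two_le_of_le hθ.1 (hθ.2.trans hα.2))

lemma integral_eq_saddleSlope (hα : α ∈ Icc 0 (π / 2))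
    (hid : ∀ x, x + a = -(Q.eval x * (1 - sin α ^ 2 - 3 * sin α * x - 2 * x ^ 2)) +
      S.eval x * (x * (1 - (x + sin α) ^ 2))) :
    ∫ θ in -(π / 2)..π / 2, (3 / 2 * (C (1 / 3) * derivative Q + S).eval (sin θ - sin α) -
      S.eval (sin θ - sin α)) * |(sin θ - sin α) * cos θ| * cos θ = saddleSlope α a := by
  set Φ : ℝ → ℝ := fun θ => 1 / 2 * (Q.eval (sin θ - sin α) * ((sin θ - sin α) * cos θ) - cos θ +
    (a - sin α) * θ) with hΦ
  set F : ℝ → ℝ := fun θ => (3 / 2 * (C (1 / 3) * derivative Q + S).eval (sin θ - sin α) -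
      S.eval (sin θ - sin α)) * ((sin θ - sin α) * cos θ) * cos θ with hF
  have hFc : Continuous F := by fun_prop
  have hd : ∀ θ, HasDerivAt Φ (F θ) θ := fun θ => by
    have h1 : HasDerivAt (fun θ => sin θ - sin α) (cos θ) θ := (hasDerivAt_sin θ).sub_const _
    have h2 := (Q.hasDerivAt (sin θ - sin α)).comp θ h1
    have h3 := (((h2.mul (h1.mul (hasDerivAt_cos θ))).sub (hasDerivAt_cos θ)).add
      ((hasDerivAt_id θ).const_mul (a - sin α))).const_mul (1 / 2 : ℝ)
    refine h3.congr_deriv ?_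
    simp only [hF, eval_add, eval_mul, eval_C, Function.comp, Pi.mul_apply]
    have h4 := hid (sin θ - sin α)
    have h5 : cos θ ^ 2 = 1 - sin θ ^ 2 := cos_sq' θ
    generalize cos θ = c at *
    linear_combination (1 / 2 : ℝ) * h4 + (1 / 2 * Q.eval (sin θ - sin α) -
      1 / 2 * S.eval (sin θ - sin α) * (sin θ - sin α)) * h5
  have hcont : Continuous fun θ => (3 / 2 * (C (1 / 3) * derivative Q + S).eval (sin θ - sin α) -
      S.eval (sin θ - sin α)) * |(sin θ - sin α) * cos θ| * cos θ := by fun_prop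
  rw [← intervalIntegral.integral_add_adjacent_intervals (hcont.intervalIntegrable (-(π / 2)) α)
    (hcont.intervalIntegrable _ _)]
  have e1 : ∫ θ in α..π / 2, (3 / 2 * (C (1 / 3) * derivative Q + S).eval (sin θ - sin α) -
      S.eval (sin θ - sin α)) * |(sin θ - sin α) * cos θ| * cos θ = ∫ θ in α..π / 2, F θ := by
    refine intervalIntegral.integral_congr fun θ hθ => ?_
    rw [uIcc_of_le hα.2] at hθ
    simp only [hF]
    rw [abs_of_nonneg (sin_sub_sin_mul_cos_nonneg hα hθ)]
  have e2 : ∫ θ in -(π / 2)..α, (3 / 2 * (C (1 / 3) * derivative Q + S).eval (sin θ - sin α) -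
      S.eval (sin θ - sin α)) * |(sin θ - sin α) * cos θ| * cos θ =
      -∫ θ in -(π / 2)..α, F θ := by
    rw [← intervalIntegral.integral_neg]
    refine intervalIntegral.integral_congr fun θ hθ => ?_
    rw [uIcc_of_le (by linarith [hα.1, pi_pos])] at hθ
    simp only [hF]
    rw [abs_of_nonpos (sin_sub_sin_mul_cos_nonpos hα hθ)]
    ring
  rw [e1, e2, intervalIntegral.integral_eq_sub_of_hasDerivAt (fun θ _ => hd θ)
    (hFc.intervalIntegrable _ _), intervalIntegral.integral_eq_sub_of_hasDerivAt (fun θ _ => hd θ)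
    (hFc.intervalIntegrable _ _)]
  simp only [hΦ, cos_neg, cos_pi_div_two, sub_self, zero_mul, mul_zero, saddleSlope]
  ring

lemma outer_estimate (hμ0 : 0 ≤ μ) (hμ1 : μ < 1) (hR : 2 ≤ R) {M : ℝ}
    (hP : ∀ x ∈ Icc (-R) R, |P.eval x| ≤ M) (hS : ∀ x ∈ Icc (-R) R, |S.eval x| ≤ M)
    (hH : H ∈ Icc (0 : ℝ) 1) :
    |∫ x in (1 - μ)..R, (P.eval x * √(H + duffing μ x) ^ 3 - H * S.eval x * √(H + duffing μ x))| ≤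
      M / (1 - μ) ^ 2 * H ^ 2 ∧
    |∫ x in -R..(-1 - μ), (P.eval x * √(H + duffing μ x) ^ 3 -
      H * S.eval x * √(H + duffing μ x))| ≤ M / (1 - μ) ^ 2 * H ^ 2 := by
  obtain ⟨hH0, hH1⟩ := hH
  have hμ' : 0 < 1 - μ := by linarith
  have hM : 0 ≤ M := (abs_nonneg _).trans (hP 0 ⟨by linarith, by linarith⟩)
  set φ : ℝ → ℝ := fun x => P.eval x * √(H + duffing μ x) ^ 3 -
    H * S.eval x * √(H + duffing μ x) with hφ
  have hφc : Continuous φ := by fun_prop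
  have hb : ∀ x ∈ Icc (-R) R, duffing μ x ≤ 0 → |φ x| ≤ 2 * M * H := fun x hx hv => by
    have h1 : √(H + duffing μ x) ≤ 1 := sqrt_le_one.2 (by linarith)
    have h2 : √(H + duffing μ x) ^ 2 ≤ H := by
      rcases le_total 0 (H + duffing μ x) with h0 | h0
      · rw [sq_sqrt h0]; linarith
      · rw [sqrt_eq_zero_of_nonpos h0]; simpa using hH0
    have h0 := sqrt_nonneg (H + duffing μ x)
    have hp := hP x hx
    have hs := hS x hx
    simp only [hφ]
    generalize √(H + duffing μ x) = Y at *
    have h3 : Y ^ 3 ≤ H := by nlinarith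
    have h3' : 0 ≤ Y ^ 3 := by positivity
    have h4 := mul_le_mul hp h3 h3' hM
    have h5 := mul_le_mul (mul_le_mul_of_nonneg_left hs hH0) h1 h0 (mul_nonneg hH0 hM)
    refine (abs_sub _ _).trans ?_
    rw [abs_mul, abs_mul, abs_mul, abs_of_nonneg h3', abs_of_nonneg hH0, abs_of_nonneg h0]
    linarith
  have h0 : ∀ x, duffing μ x ≤ -H → φ x = 0 := fun x hx => by
    simp only [hφ]
    rw [sqrt_eq_zero_of_nonpos (by linarith)]
    simp
  have hw : 0 ≤ H / (2 * (1 - μ) ^ 2) := by positivity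
  have hfin : 2 * M * H * (H / (2 * (1 - μ) ^ 2)) = M / (1 - μ) ^ 2 * H ^ 2 := by field_simp
  have hwid : ∀ y, H / (2 * (1 - μ) ^ 2) ≤ y → H ≤ (1 - μ) ^ 2 * (2 * y) := fun y hy => by
    rw [div_le_iff₀ (by positivity)] at hy
    linarith
  constructor
  · rw [← hfin]
    refine abs_integral_le_of_eq_zero hφc (by linarith) hw (by positivity) (fun x hx => ?_)
      fun x hx hxw => h0 x ?_
    · refine hb x ⟨by linarith [hx.1], hx.2⟩ ?_
      unfold duffing
      exact mul_nonpos_of_nonneg_of_nonpos (sq_nonneg x) (by nlinarith [hx.1])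
    · have h1 := hwid (x - (1 - μ)) (by linarith)
      have h2 : (1 - μ) ^ 2 * (2 * (x - (1 - μ))) ≤ x ^ 2 * ((x + μ) ^ 2 - 1) :=
        mul_le_mul (by nlinarith [hx.1]) (by nlinarith [hx.1]) (by linarith [hx.1]) (sq_nonneg x)
      unfold duffing
      linarith
  · have := intervalIntegral.integral_comp_neg (a := 1 + μ) (b := R) φ
    rw [show -1 - μ = -(1 + μ) by ring, ← this, ← hfin]
    refine abs_integral_le_of_eq_zero (hφc.comp continuous_neg) (by linarith) hw (by positivity)
      (fun x hx => ?_) fun x hx hxw => h0 (-x) ?_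
    · refine hb (-x) ⟨by linarith [hx.2], by linarith [hx.1]⟩ ?_
      unfold duffing
      exact mul_nonpos_of_nonneg_of_nonpos (sq_nonneg _) (by nlinarith [hx.1])
    · have h1 := hwid (x - (1 + μ)) (by linarith)
      have h2 : (1 - μ) ^ 2 * (2 * (x - (1 + μ))) ≤ (-x) ^ 2 * ((-x + μ) ^ 2 - 1) :=
        mul_le_mul (by nlinarith [hx.1]) (by nlinarith [hx.1]) (by linarith [hx.1]) (sq_nonneg _)
      unfold duffing
      linarith

lemma exists_abs_eval_le_of_eval_zero (p : ℝ[X]) (hp : p.eval 0 = 0) (r : ℝ) :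
    ∃ M, ∀ x, |x| ≤ r → |p.eval x| ≤ M * |x| := by
  obtain ⟨q, rfl⟩ : X ∣ p := by
    rw [X_dvd_iff, coeff_zero_eq_eval_zero, hp]
  obtain ⟨M, hM⟩ := isCompact_Icc.exists_bound_of_continuousOn (f := fun x => q.eval x)
    (s := Icc (-r) r) q.continuous.continuousOn
  refine ⟨M, fun x hx => ?_⟩
  rw [eval_mul, eval_X, abs_mul, mul_comm]
  exact mul_le_mul_of_nonneg_right (hM x (abs_le.1 hx)) (abs_nonneg x)

/-- Expansion of `∫ x (x + a) y` just outside a saddle loop. -/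
theorem saddleLoop_expansion (hα : α ∈ Ico 0 (π / 2)) (ha : 0 ≤ a) (hR : 3 ≤ R) :
    ∃ σ K : ℝ, 0 < σ ∧ ∀ H ∈ Ioc (0 : ℝ) 1,
      |(∫ x in -R..R, x * (x + a) * √(H + duffing (sin α) x)) -
        (∫ x in -R..R, x * (x + a) * √(duffing (sin α) x)) - H * saddleSlope α a +
        H ^ 2 * (σ * saddleKernel α H)| ≤ K * H ^ 2 := by
  have hμ0 : 0 ≤ sin α := sin_nonneg_of_nonneg_of_le_pi hα.1 (by linarith [hα.2, pi_pos])
  have hμ1 : sin α < 1 := by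
    rw [← sin_pi_div_two]
    exact sin_lt_sin_of_lt_of_le_pi_div_two (by linarith [hα.1, pi_pos]) le_rfl hα.2
  obtain ⟨Q, S, hσ, hP0, hid⟩ := exists_bezout hμ0 hμ1 ha
  have hslope := integral_eq_saddleSlope ⟨hα.1, hα.2.le⟩ hid
  have hneg : ∀ x, 9 ≤ x ^ 2 → 4 ≤ (x + sin α) ^ 2 → ∀ H ≤ 1, H + duffing (sin α) x ≤ 0 :=
    fun x h1 h2 H hH => by
      unfold duffing
      nlinarith [mul_le_mul h1 (show 3 ≤ (x + sin α) ^ 2 - 1 by linarith) (by norm_num) (sq_nonneg x)]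
  have hred := fun (H : ℝ) (hH : H ≤ 1) => integral_bezout (R := R) (H := H) hid
    (hneg (-R) (by nlinarith) (by nlinarith) H hH) (hneg R (by nlinarith) (by nlinarith) H hH)
  set P := C (1 / 3) * derivative Q + S with hP
  obtain ⟨M₁, hM₁⟩ := exists_abs_eval_le_of_eval_zero P (by simp [hP]; linarith) 2
  obtain ⟨M₂, hM₂⟩ := exists_abs_eval_le_of_eval_zero (S - C (S.eval 0)) (by simp) 2
  obtain ⟨N₁, hN₁⟩ := isCompact_Icc.exists_bound_of_continuousOn (f := fun x => P.eval x)
    (s := Icc (-R) R) P.continuous.continuousOn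
  obtain ⟨N₂, hN₂⟩ := isCompact_Icc.exists_bound_of_continuousOn (f := fun x => S.eval x)
    (s := Icc (-R) R) S.continuous.continuousOn
  have hout := fun H hH => outer_estimate (μ := sin α) (H := H) (R := R) (P := P) (S := S)
    (M := max N₁ N₂) hμ0 hμ1 (by linarith) (fun x hx => (hN₁ x hx).trans (le_max_left _ _))
    (fun x hx => (hN₂ x hx).trans (le_max_right _ _)) hH
  have hin := fun H hH => inner_expansion (α := α) (H := H) (P := P) (S := S) (M := max M₁ M₂)
    (fun x hx => (hM₁ x hx).trans (mul_le_mul_of_nonneg_right (le_max_left _ _) (abs_nonneg _)))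
    (fun x hx => by
      have := hM₂ x hx
      rw [eval_sub, eval_C] at this
      exact this.trans (mul_le_mul_of_nonneg_right (le_max_right _ _) (abs_nonneg _))) hH
  have hsplit : ∀ H, ∫ x in -R..R, (P.eval x * √(H + duffing (sin α) x) ^ 3 -
      H * S.eval x * √(H + duffing (sin α) x)) =
      (∫ x in -R..(-1 - sin α), (P.eval x * √(H + duffing (sin α) x) ^ 3 -
        H * S.eval x * √(H + duffing (sin α) x))) +
      (∫ θ in -(π / 2)..π / 2, (P.eval (sin θ - sin α) * √(H + ((sin θ - sin α) * cos θ) ^ 2) ^ 3 -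
        H * S.eval (sin θ - sin α) * √(H + ((sin θ - sin α) * cos θ) ^ 2)) * cos θ) +
      ∫ x in (1 - sin α)..R, (P.eval x * √(H + duffing (sin α) x) ^ 3 -
        H * S.eval x * √(H + duffing (sin α) x)) := fun H => by
    have hc : Continuous fun x => P.eval x * √(H + duffing (sin α) x) ^ 3 -
      H * S.eval x * √(H + duffing (sin α) x) := by fun_prop
    have := integral_comp_sin _ hc α
    simp only [duffing_sin] at this
    rw [← this, intervalIntegral.integral_add_adjacent_intervals (hc.intervalIntegrable _ _)
      (hc.intervalIntegrable _ _), intervalIntegral.integral_add_adjacent_intervals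
      (hc.intervalIntegrable _ _) (hc.intervalIntegrable _ _)]
  refine ⟨S.eval 0, 2 * π * max M₁ M₂ + 2 * (max N₁ N₂ / (1 - sin α) ^ 2), hσ, fun H hH => ?_⟩
  have hi := hin H hH.1
  obtain ⟨ho1, ho2⟩ := hout H ⟨hH.1.le, hH.2⟩
  obtain ⟨hz1, hz2⟩ := hout 0 ⟨le_rfl, zero_le_one⟩
  have hr := hred H hH.2
  have hr0 := hred 0 zero_le_one
  rw [hsplit] at hr hr0
  simp only [zero_add, zero_mul, sub_zero, sqrt_sq_eq_abs] at hr0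
  simp only [zero_add, zero_mul, sub_zero, ne_eq, OfNat.ofNat_ne_zero, not_false_eq_true, zero_pow,
    mul_zero, abs_nonpos_iff] at hz1 hz2
  rw [hslope] at hi
  rw [hr, hr0, hz1, hz2]
  rw [abs_le] at *
  constructor <;> linarith

end SaddleLoopOuter

section SaddleLoopSigns

open Set Topology MeasureTheory Real

variable {α a H R : ℝ}

lemma saddleKernel_integrand_nonneg {θ : ℝ} (hθ : θ ∈ Icc (-(π / 2)) (π / 2)) (α H : ℝ) :
    0 ≤ cos θ / (√(H + ((sin θ - sin α) * cos θ) ^ 2) + |(sin θ - sin α) * cos θ|) :=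
  div_nonneg (cos_nonneg_of_mem_Icc hθ) (by positivity)

lemma log_le_saddleKernel (hα : α ∈ Ico 0 (π / 2)) (hH : 0 < H) :
    1 / 2 * log ((√H + 2 * (1 - sin α)) / √H) ≤ saddleKernel α H := by
  have hs : 0 < √H := sqrt_pos.2 hH
  have hc := continuous_kernel α hH
  have hpos : ∀ θ ∈ Icc α (π / 2), 0 < √H + 2 * (sin θ - sin α) := fun θ hθ => by
    have := sin_le_sin_of_le_of_le_pi_div_two (by linarith [hα.1, pi_pos]) hθ.2 hθ.1
    linarith
  have hcont : ContinuousOn (fun θ => cos θ / (√H + 2 * (sin θ - sin α))) (uIcc α (π / 2)) := by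
    rw [uIcc_of_le hα.2.le]
    exact continuousOn_cos.div (by fun_prop) fun θ hθ => (hpos θ hθ).ne'
  have h1 : ∫ θ in α..π / 2, cos θ / (√H + 2 * (sin θ - sin α)) =
      1 / 2 * log ((√H + 2 * (1 - sin α)) / √H) := by
    have hp := hpos (π / 2) ⟨hα.2.le, le_rfl⟩
    rw [sin_pi_div_two] at hp
    rw [intervalIntegral.integral_eq_sub_of_hasDerivAt
      (f := fun θ => 1 / 2 * log (√H + 2 * (sin θ - sin α))) _ hcont.intervalIntegrable,
      log_div hp.ne' hs.ne']
    · simp only [sin_pi_div_two, sub_self, mul_zero, add_zero]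
      ring
    · intro θ hθ
      rw [uIcc_of_le hα.2.le] at hθ
      have h := ((((hasDerivAt_sin θ).sub_const (sin α)).const_mul 2).const_add (√H)).log
        (hpos θ hθ).ne'
      refine (h.const_mul (1 / 2)).congr_deriv ?_
      ring
  rw [← h1]
  unfold saddleKernel
  rw [← intervalIntegral.integral_add_adjacent_intervals (hc.intervalIntegrable (-(π / 2)) α)
    (hc.intervalIntegrable _ _)]
  refine (intervalIntegral.integral_mono_on hα.2.le hcont.intervalIntegrable
    (hc.intervalIntegrable _ _) fun θ hθ => ?_).trans (le_add_of_nonneg_left ?_)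
  · have hcos := cos_nonneg_of_mem_Icc ⟨by linarith [hα.1, hθ.1, pi_pos], hθ.2⟩
    have hx := hpos θ hθ
    have hx0 : 0 ≤ sin θ - sin α :=
      sub_nonneg.2 (sin_le_sin_of_le_of_le_pi_div_two (by linarith [hα.1, pi_pos]) hθ.2 hθ.1)
    have hz : |(sin θ - sin α) * cos θ| ≤ sin θ - sin α := by
      rw [abs_of_nonneg (mul_nonneg hx0 hcos)]
      exact mul_le_of_le_one_right hx0 (cos_le_one θ)
    have hsq : √(H + ((sin θ - sin α) * cos θ) ^ 2) ≤ √H + |(sin θ - sin α) * cos θ| := by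
      rw [← sq_abs]
      refine sqrt_le_iff.2 ⟨by positivity, ?_⟩
      nlinarith [sq_sqrt hH.le, mul_nonneg hs.le (abs_nonneg ((sin θ - sin α) * cos θ))]
    have hd : 0 < √(H + ((sin θ - sin α) * cos θ) ^ 2) := sqrt_pos.2 (by positivity)
    refine div_le_div_of_nonneg_left hcos (by positivity) ?_
    linarith
  · exact intervalIntegral.integral_nonneg (by linarith [hα.1, pi_pos]) fun θ hθ =>
      saddleKernel_integrand_nonneg ⟨hθ.1, hθ.2.trans hα.2.le⟩ α H

lemma tendsto_saddleKernel (hα : α ∈ Ico 0 (π / 2)) :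
    Tendsto (saddleKernel α) (𝓝[>] 0) atTop := by
  have hμ1 : sin α < 1 := by
    rw [← sin_pi_div_two]
    exact sin_lt_sin_of_lt_of_le_pi_div_two (by linarith [hα.1, pi_pos]) le_rfl hα.2
  have h1 : Tendsto (fun H : ℝ => √H) (𝓝[>] 0) (𝓝[>] 0) := by
    refine tendsto_nhdsWithin_iff.2 ⟨?_, ?_⟩
    · have := (continuous_sqrt.tendsto 0).mono_left (nhdsWithin_le_nhds (s := Ioi (0 : ℝ)))
      rwa [sqrt_zero] at this
    · filter_upwards [self_mem_nhdsWithin] with H hH using sqrt_pos.2 hH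
  have h2 : Tendsto (fun H : ℝ => (√H + 2 * (1 - sin α)) / √H) (𝓝[>] 0) atTop := by
    have h3 : Tendsto (fun H : ℝ => √H + 2 * (1 - sin α)) (𝓝[>] 0) (𝓝 (0 + 2 * (1 - sin α))) :=
      (h1.mono_right nhdsWithin_le_nhds).add_const _
    simp only [div_eq_mul_inv]
    exact h3.pos_mul_atTop (by linarith) (tendsto_inv_nhdsGT_zero.comp h1)
  refine tendsto_atTop_mono' _ ?_ ((tendsto_log_atTop.comp h2).const_mul_atTop
    (show (0 : ℝ) < 1 / 2 by norm_num))
  filter_upwards [self_mem_nhdsWithin] with H hH using log_le_saddleKernel hα hH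

lemma saddleKernel_nonneg (α H : ℝ) : 0 ≤ saddleKernel α H :=
  intervalIntegral.integral_nonneg (by linarith [pi_pos]) fun _ hθ =>
    saddleKernel_integrand_nonneg hθ α H

lemma mul_saddleKernel_le (α : ℝ) (hH : 0 < H) : H * saddleKernel α H ≤ π * √H := by
  have hs : 0 < √H := sqrt_pos.2 hH
  have h1 : saddleKernel α H ≤ ∫ _ in -(π / 2)..π / 2, 1 / √H := by
    refine intervalIntegral.integral_mono_on (by linarith [pi_pos])
      ((continuous_kernel α hH).intervalIntegrable _ _) intervalIntegrable_const fun θ hθ => ?_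
    refine div_le_div₀ zero_le_one (cos_le_one θ) hs ?_
    have := sqrt_le_sqrt (show H ≤ H + ((sin θ - sin α) * cos θ) ^ 2 from
      le_add_of_nonneg_right (sq_nonneg _))
    linarith [abs_nonneg ((sin θ - sin α) * cos θ)]
  rw [intervalIntegral.integral_const, smul_eq_mul] at h1
  calc H * saddleKernel α H ≤ H * ((π / 2 - -(π / 2)) * (1 / √H)) :=
        mul_le_mul_of_nonneg_left h1 hH.le
    _ = π * (H / √H) := by ring
    _ = π * √H := by rw [div_sqrt]

lemma tendsto_mul_saddleKernel (α : ℝ) :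
    Tendsto (fun H => H * saddleKernel α H) (𝓝[>] 0) (𝓝 0) := by
  have h1 : Tendsto (fun H : ℝ => π * √H) (𝓝[>] 0) (𝓝 0) := by
    have := ((show Continuous fun H : ℝ => π * √H by fun_prop).tendsto 0).mono_left (nhdsWithin_le_nhds (s := Ioi (0 : ℝ)))
    simpa using this
  refine tendsto_of_tendsto_of_tendsto_of_le_of_le' tendsto_const_nhds h1 ?_ ?_
  · filter_upwards [self_mem_nhdsWithin] with H hH using
      mul_nonneg (le_of_lt hH) (saddleKernel_nonneg α H)
  · filter_upwards [self_mem_nhdsWithin] with H hH using mul_saddleKernel_le α hH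

lemma mul_saddleKernel_le_integral_sub (hα : α ∈ Ico 0 (π / 2)) (hR : 3 ≤ R) (hH : 0 < H) :
    H * saddleKernel α H ≤ (∫ x in -R..R, √(H + duffing (sin α) x)) -
      ∫ x in -R..R, √(duffing (sin α) x) := by
  have hμ0 : 0 ≤ sin α := sin_nonneg_of_nonneg_of_le_pi hα.1 (by linarith [hα.2, pi_pos])
  have hc : Continuous fun x => √(H + duffing (sin α) x) - √(duffing (sin α) x) := by fun_prop
  have hnn : ∀ x, 0 ≤ √(H + duffing (sin α) x) - √(duffing (sin α) x) := fun x =>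
    sub_nonneg.2 (sqrt_le_sqrt (by linarith))
  rw [← intervalIntegral.integral_sub
    (Continuous.intervalIntegrable (by fun_prop) _ _)
    (Continuous.intervalIntegrable (by fun_prop) _ _),
    ← intervalIntegral.integral_add_adjacent_intervals (hc.intervalIntegrable (-R) (-1 - sin α))
      (hc.intervalIntegrable _ _),
    ← intervalIntegral.integral_add_adjacent_intervals
      (hc.intervalIntegrable (-1 - sin α) (1 - sin α)) (hc.intervalIntegrable _ _),
    integral_comp_sin _ hc α]
  have h1 : 0 ≤ ∫ x in -R..(-1 - sin α), (√(H + duffing (sin α) x) - √(duffing (sin α) x)) :=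
    intervalIntegral.integral_nonneg (by linarith [sin_le_one α]) fun x _ => hnn x
  have h2 : 0 ≤ ∫ x in (1 - sin α)..R, (√(H + duffing (sin α) x) - √(duffing (sin α) x)) :=
    intervalIntegral.integral_nonneg (by linarith) fun x _ => hnn x
  have h3 : ∫ θ in -(π / 2)..π / 2, (√(H + duffing (sin α) (sin θ - sin α)) -
      √(duffing (sin α) (sin θ - sin α))) * cos θ = H * saddleKernel α H := by
    unfold saddleKernel
    rw [← intervalIntegral.integral_const_mul]
    refine intervalIntegral.integral_congr fun θ _ => ?_
    simp only [duffing_sin, sqrt_sq_eq_abs]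
    have hp : 0 < √(H + ((sin θ - sin α) * cos θ) ^ 2) := sqrt_pos.2 (by positivity)
    have hsq : √(H + ((sin θ - sin α) * cos θ) ^ 2) ^ 2 = H + ((sin θ - sin α) * cos θ) ^ 2 :=
      sq_sqrt (by positivity)
    have ha := sq_abs ((sin θ - sin α) * cos θ)
    have ha0 := abs_nonneg ((sin θ - sin α) * cos θ)
    rw [← ha] at hsq hp ⊢
    generalize |(sin θ - sin α) * cos θ| = z at *
    generalize √(H + z ^ 2) = s at *
    field_simp
    linear_combination cos θ * hsq
  linarith

/-- Just outside a saddle loop of vanishing integral and vanishing slope, the integral is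
negative. -/
theorem eventually_neg_of_saddleSlope_eq_zero (hα : α ∈ Ico 0 (π / 2)) (ha : 0 ≤ a) (hR : 3 ≤ R)
    (hs : saddleSlope α a = 0) (h0 : ∫ x in -R..R, x * (x + a) * √(duffing (sin α) x) = 0) :
    ∀ᶠ H in 𝓝[>] 0, ∫ x in -R..R, x * (x + a) * √(H + duffing (sin α) x) < 0 := by
  obtain ⟨σ, K, hσ, hK⟩ := saddleLoop_expansion hα ha hR
  filter_upwards [(tendsto_saddleKernel hα).eventually_gt_atTop (K / σ), Ioc_mem_nhdsGT zero_lt_one]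
    with H hJ hH
  have h1 := (abs_le.1 (hK H hH)).2
  rw [h0, hs] at h1
  rw [div_lt_iff₀ hσ] at hJ
  nlinarith [pow_pos hH.1 2]

/-- Just outside a saddle loop of vanishing integral and positive slope, the integral is
positive. -/
theorem eventually_pos_of_saddleSlope_pos (hα : α ∈ Ico 0 (π / 2)) (ha : 0 ≤ a) (hR : 3 ≤ R)
    (hs : 0 < saddleSlope α a) (h0 : ∫ x in -R..R, x * (x + a) * √(duffing (sin α) x) = 0) :
    ∀ᶠ H in 𝓝[>] 0, 0 < ∫ x in -R..R, x * (x + a) * √(H + duffing (sin α) x) := by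
  obtain ⟨σ, K, hσ, hK⟩ := saddleLoop_expansion hα ha hR
  have hlim : Tendsto (fun H => K * H + σ * (H * saddleKernel α H)) (𝓝[>] 0)
      (𝓝 (K * 0 + σ * 0)) :=
    ((tendsto_id.mono_left nhdsWithin_le_nhds).const_mul K).add
      ((tendsto_mul_saddleKernel α).const_mul σ)
  filter_upwards [hlim.eventually_lt_const (show K * 0 + σ * 0 < saddleSlope α a by simpa using hs),
    Ioc_mem_nhdsGT zero_lt_one] with H hJ hH
  have h1 := (abs_le.1 (hK H hH)).1
  rw [h0] at h1
  nlinarith [mul_pos hH.1 (sub_pos.2 hJ)]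

/-- A negative constant term makes the integral negative just outside a saddle loop. -/
theorem eventually_neg_of_const_neg (hα : α ∈ Ico 0 (π / 2)) (ha : 0 ≤ a) (hR : 3 ≤ R)
    {a₀ : ℝ} (ha₀ : a₀ < 0) (h0 : (∫ x in -R..R, x * (x + a) * √(duffing (sin α) x)) +
      a₀ * ∫ x in -R..R, √(duffing (sin α) x) = 0) :
    ∀ᶠ H in 𝓝[>] 0, (∫ x in -R..R, x * (x + a) * √(H + duffing (sin α) x)) +
      a₀ * ∫ x in -R..R, √(H + duffing (sin α) x) < 0 := by
  obtain ⟨σ, K, hσ, hK⟩ := saddleLoop_expansion hα ha hR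
  filter_upwards [(tendsto_saddleKernel hα).eventually_gt_atTop ((saddleSlope α a + |K|) / -a₀),
    Ioc_mem_nhdsGT zero_lt_one] with H hJ hH
  have h1 := (abs_le.1 (hK H hH)).2
  have h2 := mul_saddleKernel_le_integral_sub hα hR hH.1
  rw [div_lt_iff₀ (by linarith)] at hJ
  have h3 := mul_le_mul_of_nonpos_left h2 ha₀.le
  have h4 : 0 ≤ H ^ 2 * (σ * saddleKernel α H) :=
    mul_nonneg (sq_nonneg _) (mul_nonneg hσ.le (saddleKernel_nonneg α H))
  have h5 : K * H ^ 2 ≤ |K| * H := by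
    have : K * H ^ 2 ≤ |K| * H ^ 2 := mul_le_mul_of_nonneg_right (le_abs_self K) (sq_nonneg H)
    have h6 : |K| * H ^ 2 ≤ |K| * H :=
      mul_le_mul_of_nonneg_left (by nlinarith [hH.1, hH.2]) (abs_nonneg K)
    linarith
  have h6 := mul_pos hH.1 (sub_pos.2 hJ)
  linarith

end SaddleLoopSigns

/-- The moments `∫ x ^ k y` of the figure-eight formed by the two saddle loops. -/
noncomputable def loopMoment (k : ℕ) (α : ℝ) : ℝ :=
  ∫ θ in -(Real.pi / 2)..Real.pi / 2, (Real.sin θ - Real.sin α) ^ k *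
    |(Real.sin θ - Real.sin α) * Real.cos θ| * Real.cos θ

/-- The contribution of the right loop to `loopMoment`. -/
noncomputable def rightMoment (k : ℕ) (α : ℝ) : ℝ :=
  ∫ θ in α..Real.pi / 2, (Real.sin θ - Real.sin α) ^ (k + 1) * Real.cos θ ^ 2

section LoopMoments

open Set Topology MeasureTheory Real

variable {α a R μ : ℝ}

lemma continuous_loopMoment (k : ℕ) : Continuous (loopMoment k) := by
  unfold loopMoment
  exact intervalIntegral.continuous_parametric_intervalIntegral_of_continuous' (by fun_prop) _ _

lemma loopMoment_eq (hα : α ∈ Icc 0 (π / 2)) (k : ℕ) :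
    loopMoment k α = 2 * rightMoment k α -
      ∫ θ in -(π / 2)..π / 2, (sin θ - sin α) ^ (k + 1) * cos θ ^ 2 := by
  have hc : Continuous fun θ => (sin θ - sin α) ^ k * |(sin θ - sin α) * cos θ| * cos θ := by
    fun_prop
  have hc' : Continuous fun θ => (sin θ - sin α) ^ (k + 1) * cos θ ^ 2 := by fun_prop
  unfold loopMoment rightMoment
  rw [← intervalIntegral.integral_add_adjacent_intervals (hc.intervalIntegrable (-(π / 2)) α)
    (hc.intervalIntegrable _ _),
    ← intervalIntegral.integral_add_adjacent_intervals (hc'.intervalIntegrable (-(π / 2)) α)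
    (hc'.intervalIntegrable _ _)]
  have e1 : ∫ θ in α..π / 2, (sin θ - sin α) ^ k * |(sin θ - sin α) * cos θ| * cos θ =
      ∫ θ in α..π / 2, (sin θ - sin α) ^ (k + 1) * cos θ ^ 2 := by
    refine intervalIntegral.integral_congr fun θ hθ => ?_
    rw [uIcc_of_le hα.2] at hθ
    rw [abs_of_nonneg (sin_sub_sin_mul_cos_nonneg hα hθ)]
    ring
  have e2 : ∫ θ in -(π / 2)..α, (sin θ - sin α) ^ k * |(sin θ - sin α) * cos θ| * cos θ =
      -∫ θ in -(π / 2)..α, (sin θ - sin α) ^ (k + 1) * cos θ ^ 2 := by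
    rw [← intervalIntegral.integral_neg]
    refine intervalIntegral.integral_congr fun θ hθ => ?_
    rw [uIcc_of_le (by linarith [hα.1, pi_pos])] at hθ
    rw [abs_of_nonpos (sin_sub_sin_mul_cos_nonpos hα hθ)]
    ring
  rw [e1, e2]
  ring

lemma integral_sin_sub_sq_mul_cos_sq (μ : ℝ) :
    ∫ θ in -(π / 2)..π / 2, (sin θ - μ) ^ 2 * cos θ ^ 2 = π / 8 + μ ^ 2 * π / 2 := by
  have hd : ∀ θ, HasDerivAt (fun θ => θ / 8 - sin θ * cos θ * (cos θ ^ 2 - sin θ ^ 2) / 8 +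
      2 * μ * cos θ ^ 3 / 3 + μ ^ 2 * (θ + sin θ * cos θ) / 2)
      ((sin θ - μ) ^ 2 * cos θ ^ 2) θ := fun θ => by
    have hs := hasDerivAt_sin θ
    have hc := hasDerivAt_cos θ
    have h := ((((hasDerivAt_id θ).div_const 8).sub
      (((hs.mul hc).mul ((hc.fun_pow 2).sub (hs.fun_pow 2))).div_const 8)).add
      (((hc.fun_pow 3).const_mul (2 * μ)).div_const 3)).add
      ((((hasDerivAt_id θ).add (hs.mul hc)).const_mul (μ ^ 2)).div_const 2)
    refine h.congr_deriv ?_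
    simp only [Pi.mul_apply, Pi.sub_apply]
    have h5 : cos θ ^ 2 = 1 - sin θ ^ 2 := cos_sq' θ
    have h6 : cos θ ^ 4 = (1 - sin θ ^ 2) ^ 2 := by rw [← h5]; ring
    push_cast
    ring_nf
    rw [h5, h6]
    ring
  rw [intervalIntegral.integral_eq_sub_of_hasDerivAt (fun θ _ => hd θ)
    (Continuous.intervalIntegrable (by fun_prop) _ _)]
  simp only [cos_neg, cos_pi_div_two]
  ring

lemma integral_sin_sub_cube_mul_cos_sq (μ : ℝ) :
    ∫ θ in -(π / 2)..π / 2, (sin θ - μ) ^ 3 * cos θ ^ 2 =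
      -(3 * μ * π / 8 + μ ^ 3 * π / 2) := by
  have hd : ∀ θ, HasDerivAt (fun θ => -cos θ ^ 3 / 3 + cos θ ^ 5 / 5 -
      3 * μ * (θ / 8 - sin θ * cos θ * (cos θ ^ 2 - sin θ ^ 2) / 8) -
      μ ^ 2 * cos θ ^ 3 - μ ^ 3 * (θ + sin θ * cos θ) / 2)
      ((sin θ - μ) ^ 3 * cos θ ^ 2) θ := fun θ => by
    have hs := hasDerivAt_sin θ
    have hc := hasDerivAt_cos θ
    have h := (((((hc.fun_pow 3).neg.div_const 3).add ((hc.fun_pow 5).div_const 5)).sub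
      ((((hasDerivAt_id θ).div_const 8).sub
      (((hs.mul hc).mul ((hc.fun_pow 2).sub (hs.fun_pow 2))).div_const 8)).const_mul (3 * μ))).sub
      ((hc.fun_pow 3).const_mul (μ ^ 2))).sub
      ((((hasDerivAt_id θ).add (hs.mul hc)).const_mul (μ ^ 3)).div_const 2)
    refine h.congr_deriv ?_
    simp only [Pi.mul_apply, Pi.sub_apply]
    have h5 : cos θ ^ 2 = 1 - sin θ ^ 2 := cos_sq' θ
    have h6 : cos θ ^ 4 = (1 - sin θ ^ 2) ^ 2 := by rw [← h5]; ring
    push_cast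
    ring_nf
    rw [h5, h6]
    ring
  rw [intervalIntegral.integral_eq_sub_of_hasDerivAt (fun θ _ => hd θ)
    (Continuous.intervalIntegrable (by fun_prop) _ _)]
  simp only [cos_neg, cos_pi_div_two]
  ring

lemma loopMoment_one (hα : α ∈ Icc 0 (π / 2)) :
    loopMoment 1 α = 2 * rightMoment 1 α - (π / 8 + sin α ^ 2 * π / 2) := by
  rw [loopMoment_eq hα, integral_sin_sub_sq_mul_cos_sq]

lemma loopMoment_two (hα : α ∈ Icc 0 (π / 2)) :
    loopMoment 2 α = 2 * rightMoment 2 α + (3 * sin α * π / 8 + sin α ^ 3 * π / 2) := by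
  rw [loopMoment_eq hα, integral_sin_sub_cube_mul_cos_sq, sub_neg_eq_add]

lemma rightMoment_nonneg (hα : α ∈ Icc 0 (π / 2)) (k : ℕ) : 0 ≤ rightMoment k α :=
  intervalIntegral.integral_nonneg hα.2 fun _ hθ => mul_nonneg (pow_nonneg (sub_nonneg.2
    (sin_le_sin_of_le_of_le_pi_div_two (by linarith [hα.1, pi_pos]) hθ.2 hθ.1)) _) (sq_nonneg _)

lemma le_sin_of_mem (hα : α ∈ Icc (π / 3) (π / 2)) : 0.866 ≤ sin α := by
  have h1 := sin_le_sin_of_le_of_le_pi_div_two (by linarith [pi_pos]) hα.2 hα.1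
  rw [sin_pi_div_three] at h1
  have : 1.732 ≤ √3 := le_sqrt_of_sq_le (by norm_num)
  linarith

lemma rightMoment_le (hα : α ∈ Icc (π / 3) (π / 2)) (k : ℕ) :
    rightMoment k α ≤ 0.134 ^ (k + 1) * (π / 6) := by
  have h1 : rightMoment k α ≤ ∫ _ in α..π / 2, (0.134 : ℝ) ^ (k + 1) := by
    refine intervalIntegral.integral_mono_on hα.2 (Continuous.intervalIntegrable (by fun_prop) _ _)
      intervalIntegrable_const fun θ hθ => ?_
    have h0 : 0 ≤ sin θ - sin α := sub_nonneg.2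
      (sin_le_sin_of_le_of_le_pi_div_two (by linarith [hα.1, pi_pos]) hθ.2 hθ.1)
    have h2 : sin θ - sin α ≤ 0.134 := by linarith [sin_le_one θ, le_sin_of_mem hα]
    exact (mul_le_of_le_one_right (pow_nonneg h0 _) (cos_sq_le_one θ)).trans
      (pow_le_pow_left₀ h0 h2 _)
  rw [intervalIntegral.integral_const, smul_eq_mul, mul_comm] at h1
  exact h1.trans (mul_le_mul_of_nonneg_left (by linarith [hα.1]) (by positivity))

lemma loopMoment_one_neg (hα : α ∈ Icc (π / 3) (π / 2)) : loopMoment 1 α < 0 := by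
  have h := rightMoment_le hα 1
  rw [loopMoment_one ⟨by linarith [hα.1, pi_pos], hα.2⟩]
  have : 0 ≤ sin α ^ 2 * π / 2 := by positivity
  norm_num at h
  linarith [pi_pos]

lemma loopMoment_two_pos (hα : α ∈ Icc (π / 3) (π / 2)) : 0 < loopMoment 2 α := by
  have hα' : α ∈ Icc 0 (π / 2) := ⟨by linarith [hα.1, pi_pos], hα.2⟩
  have h := rightMoment_nonneg hα' 2
  rw [loopMoment_two hα']
  have hs : 0 < sin α := by linarith [le_sin_of_mem hα]
  have : 0 < 3 * sin α * π / 8 + sin α ^ 3 * π / 2 := by positivity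
  linarith

/-- The coefficient for which `∫ x (x + a) y` vanishes on the figure-eight. -/
noncomputable def loopCoeff (α : ℝ) : ℝ := -loopMoment 2 α / loopMoment 1 α

lemma loopCoeff_pos (hα : α ∈ Icc (π / 3) (π / 2)) : 0 < loopCoeff α :=
  div_pos_of_neg_of_neg (neg_neg_of_pos (loopMoment_two_pos hα)) (loopMoment_one_neg hα)

lemma continuousOn_loopCoeff : ContinuousOn loopCoeff (Icc (π / 3) (π / 2)) :=
  (continuous_loopMoment 2).neg.continuousOn.div (continuous_loopMoment 1).continuousOn
    fun _ hα => (loopMoment_one_neg hα).ne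

lemma saddleSlope_loopCoeff_pi_div_three : 0 < saddleSlope (π / 3) (loopCoeff (π / 3)) := by
  have hm : π / 3 ∈ Icc (π / 3) (π / 2) := ⟨le_rfl, by linarith [pi_pos]⟩
  have hm' : π / 3 ∈ Icc 0 (π / 2) := ⟨by linarith [pi_pos], hm.2⟩
  have hneg := loopMoment_one_neg hm
  have h1 := rightMoment_le hm 1
  have h2 := rightMoment_le hm 2
  have h3 := rightMoment_nonneg hm' 1
  have h4 := rightMoment_nonneg hm' 2
  have hs2 : √3 ^ 2 = 3 := sq_sqrt (by norm_num)
  have hsu : √3 ≤ 1.7321 := sqrt_le_iff.2 (by norm_num)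
  have hsl : 0 ≤ √3 := sqrt_nonneg 3
  have hpl := pi_gt_d2
  have hpu := pi_lt_d4
  have hT1 : rightMoment 1 (π / 3) ≤ 0.0095 := h1.trans (by norm_num; linarith)
  have hT2 : rightMoment 2 (π / 3) ≤ 0.0013 := h2.trans (by norm_num; linarith)
  have key : 0 < -loopMoment 1 (π / 3) * (1 / 2 + √3 / 2 * (π / 3)) -
      loopMoment 2 (π / 3) * (π / 3) := by
    rw [loopMoment_one hm', loopMoment_two hm', sin_pi_div_three]
    generalize rightMoment 1 (π / 3) = T₁ at *
    generalize rightMoment 2 (π / 3) = T₂ at *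
    have e : -(2 * T₁ - (π / 8 + (√3 / 2) ^ 2 * π / 2)) * (1 / 2 + √3 / 2 * (π / 3)) -
        (2 * T₂ + (3 * (√3 / 2) * π / 8 + (√3 / 2) ^ 3 * π / 2)) * (π / 3) =
        π / 4 * (1 - √3 * π / 6) - T₁ * (1 + √3 * π / 3) - 2 * π / 3 * T₂ := by
      linear_combination (π / 16) * hs2
    rw [e]
    have hsp : √3 * π ≤ 1.7321 * 3.1416 := mul_le_mul hsu hpu.le pi_pos.le (by norm_num)
    have hsp0 : 0 ≤ √3 * π := by positivity
    have b1 : 3.14 / 4 * (1 - 1.7321 * 3.1416 / 6) ≤ π / 4 * (1 - √3 * π / 6) :=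
      mul_le_mul (by linarith) (by linarith) (by norm_num) (by positivity)
    have b2 : T₁ * (1 + √3 * π / 3) ≤ 0.0095 * (1 + 1.7321 * 3.1416 / 3) :=
      mul_le_mul hT1 (by linarith) (by positivity) (by norm_num)
    have b3 : 2 * π / 3 * T₂ ≤ 2 * 3.1416 / 3 * 0.0013 :=
      mul_le_mul (by linarith) hT2 h4 (by norm_num)
    norm_num at b1 b2 b3
    linarith
  unfold saddleSlope loopCoeff
  rw [cos_pi_div_three, sin_pi_div_three]
  have hne := hneg.ne
  generalize loopMoment 1 (π / 3) = k₁ at *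
  generalize loopMoment 2 (π / 3) = k₂ at *
  have : 1 / 2 + (√3 / 2 - -k₂ / k₁) * (π / 3) =
      (-k₁ * (1 / 2 + √3 / 2 * (π / 3)) -
      k₂ * (π / 3)) / -k₁ := by
    field_simp
    ring
  rw [this]
  exact div_pos key (by linarith)

lemma saddleSlope_loopCoeff_pi_div_two : saddleSlope (π / 2) (loopCoeff (π / 2)) < 0 := by
  have hm' : π / 2 ∈ Icc 0 (π / 2) := ⟨by linarith [pi_pos], le_rfl⟩
  have h : ∀ k, rightMoment k (π / 2) = 0 := fun k => intervalIntegral.integral_same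
  unfold saddleSlope loopCoeff
  rw [loopMoment_one hm', loopMoment_two hm', h, h, cos_pi_div_two, sin_pi_div_two]
  have hp := pi_pos.ne'
  have : -(2 * 0 + (3 * 1 * π / 8 + 1 ^ 3 * π / 2)) / (2 * 0 - (π / 8 + 1 ^ 2 * π / 2)) = 7 / 5 := by
    field_simp
    ring
  rw [this]
  linarith [pi_pos]

/-- The first angle at which both the integral and the slope vanish. -/
lemma exists_first_zero_saddleSlope : ∃ α₀ ∈ Ioo (π / 3) (π / 2),
    saddleSlope α₀ (loopCoeff α₀) = 0 ∧
      ∀ α ∈ Ico (π / 3) α₀, 0 < saddleSlope α (loopCoeff α) := by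
  set φ : ℝ → ℝ := fun α => saddleSlope α (loopCoeff α) with hφ
  have hc : ContinuousOn φ (Icc (π / 3) (π / 2)) := by
    simp only [hφ]
    unfold saddleSlope
    exact continuousOn_cos.add
      ((continuousOn_sin.sub continuousOn_loopCoeff).mul continuousOn_id)
  have hle : π / 3 ≤ π / 2 := by linarith [pi_pos]
  have h3 : 0 < φ (π / 3) := saddleSlope_loopCoeff_pi_div_three
  have h2 : φ (π / 2) < 0 := saddleSlope_loopCoeff_pi_div_two
  have hcl : IsClosed (Icc (π / 3) (π / 2) ∩ φ ⁻¹' {0}) :=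
    hc.preimage_isClosed_of_isClosed isClosed_Icc isClosed_singleton
  have hcomp := isCompact_Icc.of_isClosed_subset hcl inter_subset_left
  obtain ⟨z, hz, hz0⟩ := intermediate_value_Icc' hle hc ⟨h2.le, h3.le⟩
  obtain ⟨α₀, ⟨hm, h0⟩, hleast⟩ := hcomp.exists_isLeast ⟨z, hz, hz0⟩
  have h0 : φ α₀ = 0 := h0
  refine ⟨α₀, ⟨lt_of_le_of_ne hm.1 ?_, lt_of_le_of_ne hm.2 ?_⟩, h0, fun α hα => ?_⟩
  · rintro rfl; linarith
  · rintro rfl; linarith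
  · by_contra hn
    push Not at hn
    obtain ⟨y, hy, hy0⟩ := intermediate_value_Icc' hα.1
      (hc.mono (Icc_subset_Icc_right (hα.2.le.trans hm.2))) ⟨hn, h3.le⟩
    have := hleast ⟨⟨hy.1, hy.2.trans (hα.2.le.trans hm.2)⟩, hy0⟩
    linarith [hα.2, hy.2]

end LoopMoments

/-- The integral `∫ (x ^ 2 + a₁ x + a₀) y` on the level curve `y ^ 2 = H + duffing μ x`, with
`p = (μ, a₁, a₀)`. -/
noncomputable def duffingIntegral (A B : ℝ) (p : ℝ × ℝ × ℝ) (H : ℝ) : ℝ :=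
  ∫ x in A..B, (x ^ 2 + p.2.1 * x + p.2.2) * √(H + duffing p.1 x)

/-- The abscissa of the bottom of the left well. -/
noncomputable def leftCenter (μ : ℝ) : ℝ := (-3 * μ - √(μ ^ 2 + 8)) / 4

section LeftWell

open Set Topology MeasureTheory Real

variable {α a μ R H A B : ℝ}

lemma continuous_duffingIntegral (A B : ℝ) :
    Continuous fun q : (ℝ × ℝ × ℝ) × ℝ => duffingIntegral A B q.1 q.2 := by
  unfold duffingIntegral duffing
  exact intervalIntegral.continuous_parametric_intervalIntegral_of_continuous' (by fun_prop) _ _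

lemma continuous_duffingIntegrand (p : ℝ × ℝ × ℝ) (H : ℝ) :
    Continuous fun x => (x ^ 2 + p.2.1 * x + p.2.2) * √(H + duffing p.1 x) := by fun_prop

lemma duffingIntegral_add (A B D : ℝ) (p : ℝ × ℝ × ℝ) (H : ℝ) :
    duffingIntegral A B p H + duffingIntegral B D p H = duffingIntegral A D p H :=
  intervalIntegral.integral_add_adjacent_intervals
    ((continuous_duffingIntegrand p H).intervalIntegrable _ _)
    ((continuous_duffingIntegrand p H).intervalIntegrable _ _)

lemma duffingIntegral_eq_zero {p : ℝ × ℝ × ℝ} (hAB : A ≤ B)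
    (h : ∀ x ∈ Icc A B, H + duffing p.1 x ≤ 0) : duffingIntegral A B p H = 0 := by
  unfold duffingIntegral
  rw [intervalIntegral.integral_congr (g := fun _ => 0), intervalIntegral.integral_zero]
  intro x hx
  rw [uIcc_of_le hAB] at hx
  simp only [sqrt_eq_zero_of_nonpos (h x hx), mul_zero]

lemma duffingIntegral_pos {p : ℝ × ℝ × ℝ} {z : ℝ} (hz : z ∈ Ioo A B)
    (hf : ∀ x ∈ Icc A B, 0 ≤ x ^ 2 + p.2.1 * x + p.2.2) (hfz : 0 < z ^ 2 + p.2.1 * z + p.2.2)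
    (hHz : 0 < H + duffing p.1 z) : 0 < duffingIntegral A B p H :=
  intervalIntegral.integral_pos (hz.1.trans hz.2) (continuous_duffingIntegrand p H).continuousOn
    (fun x hx => mul_nonneg (hf x (Ioc_subset_Icc_self hx)) (sqrt_nonneg _))
    ⟨z, Ioo_subset_Icc_self hz, mul_pos hfz (sqrt_pos.2 hHz)⟩

lemma integral_pow_mul_sqrt_duffing (α : ℝ) (hα : 0 ≤ sin α) (hR : 3 ≤ R) (k : ℕ) :
    ∫ x in -R..R, x ^ k * √(duffing (sin α) x) = loopMoment k α := by
  have hc : Continuous fun x => x ^ k * √(duffing (sin α) x) := by fun_prop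
  have h1 := sin_le_one α
  rw [← intervalIntegral.integral_add_adjacent_intervals
      (hc.intervalIntegrable (-R) (-1 - sin α)) (hc.intervalIntegrable _ _),
    ← intervalIntegral.integral_add_adjacent_intervals
      (hc.intervalIntegrable (-1 - sin α) (1 - sin α)) (hc.intervalIntegrable _ _),
    integral_comp_sin _ hc α]
  have hz : ∀ A B, A ≤ B → (∀ x ∈ Icc A B, 1 ≤ (x + sin α) ^ 2) →
      ∫ x in A..B, x ^ k * √(duffing (sin α) x) = 0 := fun A B hAB h => by
    rw [intervalIntegral.integral_congr (g := fun _ => 0), intervalIntegral.integral_zero]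
    intro x hx
    rw [uIcc_of_le hAB] at hx
    have : duffing (sin α) x ≤ 0 :=
      mul_nonpos_of_nonneg_of_nonpos (sq_nonneg x) (by linarith [h x hx])
    simp only [sqrt_eq_zero_of_nonpos this, mul_zero]
  rw [hz (-R) _ (by linarith) fun x hx => by nlinarith [hx.2],
    hz _ R (by linarith) fun x hx => by nlinarith [hx.1], zero_add, add_zero]
  unfold loopMoment
  refine intervalIntegral.integral_congr fun θ _ => ?_
  simp only [duffing_sin, sqrt_sq_eq_abs]

lemma duffingIntegral_zero (hα : 0 ≤ sin α) (hR : 3 ≤ R) (a₁ a₀ : ℝ) :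
    duffingIntegral (-R) R (sin α, a₁, a₀) 0 =
      loopMoment 2 α + a₁ * loopMoment 1 α + a₀ * loopMoment 0 α := by
  have hi : ∀ k : ℕ, IntervalIntegrable (fun x => x ^ k * √(duffing (sin α) x)) volume (-R) R :=
    fun k => Continuous.intervalIntegrable (by fun_prop) _ _
  rw [← integral_pow_mul_sqrt_duffing α hα hR, ← integral_pow_mul_sqrt_duffing α hα hR,
    ← integral_pow_mul_sqrt_duffing α hα hR, ← intervalIntegral.integral_const_mul,
    ← intervalIntegral.integral_const_mul,
    ← intervalIntegral.integral_add (hi 2) ((hi 1).const_mul a₁),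
    ← intervalIntegral.integral_add ((hi 2).add ((hi 1).const_mul a₁)) ((hi 0).const_mul a₀)]
  refine intervalIntegral.integral_congr fun x _ => ?_
  simp only [zero_add]
  ring

lemma duffingIntegral_eq_add (p : ℝ × ℝ × ℝ) (H : ℝ) :
    duffingIntegral (-R) R p H = (∫ x in -R..R, x * (x + p.2.1) * √(H + duffing p.1 x)) +
      p.2.2 * ∫ x in -R..R, √(H + duffing p.1 x) := by
  rw [← intervalIntegral.integral_const_mul, ← intervalIntegral.integral_add
    (Continuous.intervalIntegrable (by fun_prop) _ _)
    (Continuous.intervalIntegrable (by fun_prop) _ _)]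
  refine intervalIntegral.integral_congr fun x _ => ?_
  ring

lemma leftCenter_factor (μ x : ℝ) : 2 * x ^ 2 + 3 * μ * x + μ ^ 2 - 1 =
    2 * (x - leftCenter μ) * (x - (-3 * μ + √(μ ^ 2 + 8)) / 4) := by
  have h : √(μ ^ 2 + 8) ^ 2 = μ ^ 2 + 8 := sq_sqrt (by positivity)
  unfold leftCenter
  linear_combination (1 / 8 : ℝ) * h

lemma rightCenter_pos (hμ0 : 0 ≤ μ) (hμ1 : μ < 1) : 0 < (-3 * μ + √(μ ^ 2 + 8)) / 4 := by
  have : 3 * μ < √(μ ^ 2 + 8) := lt_sqrt_of_sq_lt (by nlinarith)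
  linarith

lemma leftCenter_le (hμ1 : μ ≤ 1) : leftCenter μ ≤ -μ - 1 / 2 := by
  unfold leftCenter
  have : μ + 2 ≤ √(μ ^ 2 + 8) := le_sqrt_of_sq_le (by nlinarith)
  linarith

lemma lt_leftCenter (hμ0 : 0 ≤ μ) : -1 - μ < leftCenter μ := by
  unfold leftCenter
  have : √(μ ^ 2 + 8) < μ + 4 := (sqrt_lt' (by linarith)).2 (by nlinarith)
  linarith

lemma continuous_leftCenter : Continuous leftCenter := by
  unfold leftCenter
  fun_prop

lemma strictAntiOn_duffing (hμ0 : 0 ≤ μ) (hμ1 : μ < 1) :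
    StrictAntiOn (duffing μ) (Icc (leftCenter μ) 0) := by
  refine strictAntiOn_of_deriv_neg (convex_Icc _ _) (continuous_duffing μ).continuousOn
    fun x hx => ?_
  rw [interior_Icc] at hx
  rw [(hasDerivAt_duffing μ x).deriv]
  have h1 := leftCenter_factor μ x
  have h2 := rightCenter_pos hμ0 hμ1
  have h3 : 0 < (x - leftCenter μ) * ((-3 * μ + √(μ ^ 2 + 8)) / 4 - x) :=
    mul_pos (sub_pos.2 hx.1) (by linarith [hx.2])
  nlinarith [hx.2]

/-- At a figure-eight where both the integral and the slope vanish, the integral changes sign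
inside the left loop. -/
lemma exists_leftWell (hα : α ∈ Ioo (π / 3) (π / 2)) (hs : saddleSlope α (loopCoeff α) = 0)
    (hR : 3 ≤ R) : ∃ b H H', b < 0 ∧ leftCenter (sin α) < b ∧
      -duffing (sin α) (leftCenter (sin α)) < H ∧ H < H' ∧ H' < 0 ∧ H' < -duffing (sin α) b ∧
      0 < duffingIntegral (-R) b (sin α, loopCoeff α, 0) H ∧
      duffingIntegral (-R) b (sin α, loopCoeff α, 0) H' < 0 := by
  have hα' : α ∈ Icc (π / 3) (π / 2) := ⟨hα.1.le, hα.2.le⟩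
  have hα0 : 0 < α := by linarith [hα.1, pi_pos]
  have hμ0 : 0 ≤ sin α := by linarith [le_sin_of_mem hα']
  have hμ1 : sin α < 1 := by
    rw [← sin_pi_div_two]
    exact sin_lt_sin_of_lt_of_le_pi_div_two (by linarith [pi_pos]) le_rfl hα.2
  have ha0 := loopCoeff_pos hα'
  have hsum := duffingIntegral_zero (α := α) hμ0 hR (loopCoeff α) 0
  have hm := (loopMoment_one_neg hα').ne
  rw [show loopMoment 2 α + loopCoeff α * loopMoment 1 α + 0 * loopMoment 0 α = 0 by
    unfold loopCoeff; field_simp; ring] at hsum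
  have haxc : leftCenter (sin α) < -loopCoeff α := by
    have h1 : cos α ≤ 1 / 2 := by
      rw [← cos_pi_div_three]
      exact cos_le_cos_of_nonneg_of_le_pi (by positivity) (by linarith [hα.2, pi_pos]) hα.1.le
    have h2 := leftCenter_le hμ1.le
    have h3 : loopCoeff α - sin α < 1 / 2 := by
      unfold saddleSlope at hs
      have := pi_gt_three
      nlinarith [hα.1]
    linarith
  generalize loopCoeff α = a at *
  generalize sin α = μ at *
  have hlc := lt_leftCenter hμ0
  have hanti := strictAntiOn_duffing hμ0 hμ1
  have hright : 0 < duffingIntegral 0 R (μ, a, 0) 0 := by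
    refine duffingIntegral_pos (z := (1 - μ) / 2) ⟨by linarith, by linarith⟩ (fun x hx => ?_) ?_ ?_
    · have := hx.1
      positivity
    · have : 0 < 1 - μ := by linarith
      positivity
    · simp only [duffing, zero_add]
      have : 0 < 1 - μ := by linarith
      exact mul_pos (by positivity) (by nlinarith)
  have hleft : duffingIntegral (-R) 0 (μ, a, 0) 0 < 0 := by
    linarith [duffingIntegral_add (-R) 0 R (μ, a, 0) 0]
  have hd : 0 < duffing μ (-a) := by
    unfold duffing
    exact mul_pos (by nlinarith) (by nlinarith)
  have hcont : Continuous fun H => duffingIntegral (-R) 0 (μ, a, 0) H :=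
    (continuous_duffingIntegral (-R) 0).comp
      (g := fun q : (ℝ × ℝ × ℝ) × ℝ => duffingIntegral (-R) 0 q.1 q.2)
      (f := fun H => ((μ, a, 0), H)) (by fun_prop)
  obtain ⟨H', ⟨hH1, hH2⟩, hH3⟩ := ((((hcont.tendsto 0).eventually_lt_const hleft).and
    (lt_mem_nhds (show -duffing μ (-a) < 0 by linarith))).filter_mono
      (nhdsWithin_le_nhds (s := Iio (0 : ℝ)))).and self_mem_nhdsWithin |>.exists
  have hH3 : H' < 0 := hH3
  have hz : duffing μ 0 = 0 := by simp [duffing]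
  obtain ⟨b, ⟨hb1, hb2⟩, hb3⟩ := (((((continuous_duffing μ).tendsto 0).eventually_lt_const
    (show duffing μ 0 < -H' by linarith)).and (lt_mem_nhds (show -a < 0 by linarith))).filter_mono
      (nhdsWithin_le_nhds (s := Iio (0 : ℝ)))).and self_mem_nhdsWithin |>.exists
  have hb3 : b < 0 := hb3
  refine ⟨b, -duffing μ (-a), H', hb3, by linarith, neg_lt_neg (hanti ⟨le_rfl, by linarith⟩
    ⟨haxc.le, by linarith⟩ haxc), hH2, hH3, by linarith, ?_, ?_⟩
  · rw [← duffingIntegral_add (-R) (-a) b, duffingIntegral_eq_zero hb2.le fun x hx => ?_, add_zero]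
    · refine duffingIntegral_pos (z := leftCenter μ) ⟨by linarith, haxc⟩ (fun x hx => ?_) ?_ ?_
      · simp only [add_zero]
        nlinarith [hx.2]
      · simp only [add_zero]
        nlinarith
      · have := hanti ⟨le_rfl, by linarith⟩ ⟨haxc.le, by linarith⟩ haxc
        linarith
    · have := hanti.antitoneOn ⟨haxc.le, by linarith⟩
        ⟨by linarith [hx.1], by linarith [hx.2]⟩ hx.1
      linarith
  · have h1 := duffingIntegral_add (-R) b 0 (μ, a, 0) H'
    rw [duffingIntegral_eq_zero (A := b) hb3.le fun x hx => ?_, add_zero] at h1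
    · rw [h1]
      exact hH1
    · have := hanti.antitoneOn ⟨by linarith, by linarith⟩
        ⟨by linarith [hx.1], by linarith [hx.2]⟩ hx.1
      linarith

end LeftWell

section FiveWells

open Set Topology MeasureTheory Real

variable {α a μ R H A B : ℝ}

/-- The potential with a saddle at `0` and energy `y ^ 2 = 2 h + duffing μ x`. -/
noncomputable def duffingPotential (μ : ℝ) : ℝ[X] := C (1 / 2) * (X ^ 2 * ((X + C μ) ^ 2 - 1))

/-- The quadratic `x ^ 2 + a₁ x + a₀`. -/
noncomputable def quadraticDamping (a₁ a₀ : ℝ) : ℝ[X] := X ^ 2 + C a₁ * X + C a₀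

lemma eval_duffingPotential (μ x : ℝ) : (duffingPotential μ).eval x = -duffing μ x / 2 := by
  simp only [duffingPotential, duffing, eval_mul, eval_C, eval_pow, eval_X, eval_sub, eval_add,
    eval_one]
  ring

lemma eval_derivative_duffingPotential (μ x : ℝ) :
    (derivative (duffingPotential μ)).eval x = x * (2 * x ^ 2 + 3 * μ * x + μ ^ 2 - 1) := by
  have h1 := (duffingPotential μ).hasDerivAt x
  have h2 := ((hasDerivAt_duffing μ x).neg.div_const 2)
  rw [h1.unique (h2.congr_of_eventuallyEq (Eventually.of_forall fun y =>
    eval_duffingPotential μ y))]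
  ring

lemma wellIntegral_duffing (p : ℝ × ℝ × ℝ) (A B H : ℝ) :
    wellIntegral (quadraticDamping p.2.1 p.2.2) (duffingPotential p.1) A B (H / 2) =
      duffingIntegral A B p H := by
  refine intervalIntegral.integral_congr fun x _ => ?_
  simp only [eval_duffingPotential, quadraticDamping, eval_add, eval_mul, eval_C, eval_pow, eval_X]
  rw [show 2 * (H / 2 - -duffing p.1 x / 2) = H + duffing p.1 x by ring]

lemma isWell_left {b HL HL' : ℝ} (hμ0 : 0 < μ) (hμ1 : μ < 1) (hR : 3 ≤ R) (hb : b < 0)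
    (hcb : leftCenter μ < b) (hl : -duffing μ (leftCenter μ) < HL) (hLL : HL < HL') (hL0 : HL' < 0)
    (hr : HL' < -duffing μ b) : IsWell (duffingPotential μ) (-R) (leftCenter μ) (leftCenter μ) b
      (HL / 2) (HL' / 2) := by
  have hrc := rightCenter_pos hμ0.le hμ1
  refine ⟨by linarith [lt_leftCenter hμ0.le], le_rfl, hcb, by linarith, fun x hx => ?_,
    fun x hx => ?_, fun x hx => ?_, ?_, ?_⟩
  · rw [eval_derivative_duffingPotential, leftCenter_factor]
    refine mul_neg_of_neg_of_pos (by linarith [hx.2]) ?_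
    exact mul_pos_of_neg_of_neg (by linarith [hx.2]) (by linarith [hx.2])
  · rw [eval_derivative_duffingPotential, leftCenter_factor]
    refine mul_pos_of_neg_of_neg (by linarith [hx.2]) ?_
    exact mul_neg_of_pos_of_neg (by linarith [hx.1]) (by linarith [hx.2])
  · obtain rfl : x = leftCenter μ := le_antisymm hx.2 hx.1
    rw [eval_duffingPotential]
    linarith
  · rw [eval_duffingPotential]
    have : duffing μ (-R) ≤ 0 :=
      mul_nonpos_of_nonneg_of_nonpos (sq_nonneg _) (by nlinarith)
    linarith
  · rw [eval_duffingPotential]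
    linarith

lemma isWell_outer {H H' : ℝ} (hμ0 : 0 < μ) (hμ1 : μ < 1) (hR : 3 ≤ R) (h0 : 0 < H)
    (hHH : H < H') (hHR : H' < R) :
    IsWell (duffingPotential μ) (-R) (-1 - μ) (1 - μ) R (H / 2) (H' / 2) := by
  refine ⟨by linarith, by linarith, by linarith, by linarith, fun x hx => ?_, fun x hx => ?_,
    fun x hx => ?_, ?_, ?_⟩
  · rw [eval_derivative_duffingPotential]
    exact mul_neg_of_neg_of_pos (by linarith [hx.2]) (by nlinarith [hx.2])
  · rw [eval_derivative_duffingPotential]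
    exact mul_pos (by linarith [hx.1]) (by nlinarith [hx.1])
  · rw [eval_duffingPotential]
    have : 0 ≤ duffing μ x := mul_nonneg (sq_nonneg _) (by nlinarith [hx.1, hx.2])
    linarith
  · rw [eval_duffingPotential]
    have : R * 1 ≤ (-R) ^ 2 * ((-R + μ) ^ 2 - 1) :=
      mul_le_mul (by nlinarith) (by nlinarith) zero_le_one (sq_nonneg _)
    unfold duffing
    linarith
  · rw [eval_duffingPotential]
    have : R * 1 ≤ R ^ 2 * ((R + μ) ^ 2 - 1) :=
      mul_le_mul (by nlinarith) (by nlinarith) zero_le_one (sq_nonneg _)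
    unfold duffing
    linarith

lemma tendsto_derivative_duffingPotential (hμ0 : 0 < μ) (hμ1 : μ < 1) :
    Tendsto (fun x => (derivative (duffingPotential μ)).eval x) atTop atTop := by
  refine tendsto_atTop_mono' _ ?_ tendsto_id
  filter_upwards [eventually_ge_atTop 1] with x hx
  rw [eval_derivative_duffingPotential, id]
  exact le_mul_of_one_le_right (by linarith) (by nlinarith)

lemma hasWells_five_of_signs {p : ℝ × ℝ × ℝ} {b HL HL' HE HD HC HA HB : ℝ} (hμ0 : 0 < p.1)
    (hμ1 : p.1 < 1) (hR : 3 ≤ R) (hb : b < 0) (hcb : leftCenter p.1 < b)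
    (hl : -duffing p.1 (leftCenter p.1) < HL) (hLL : HL < HL') (hL0 : HL' < 0)
    (hr : HL' < -duffing p.1 b) (h0E : 0 < HE) (hED : HE < HD) (hDC : HD < HC) (hCA : HC < HA)
    (hAB : HA < HB) (hBR : HB < R) (sL : 0 < duffingIntegral (-R) b p HL)
    (sL' : duffingIntegral (-R) b p HL' < 0) (sE : 0 < duffingIntegral (-R) R p HE)
    (sD : duffingIntegral (-R) R p HD < 0) (sC : 0 < duffingIntegral (-R) R p HC)
    (sA : duffingIntegral (-R) R p HA < 0) (sB : 0 < duffingIntegral (-R) R p HB) :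
    HasWells 5 3 := by
  set outer : ℝ → ℝ → WellData := fun H H' => ⟨-R, -1 - p.1, 1 - p.1, R, H / 2, H' / 2⟩ with hout
  have houter : ∀ H H', 0 < H → H < H' → H' < R →
      duffingIntegral (-R) R p H * duffingIntegral (-R) R p H' < 0 →
      (outer H H').Changes (quadraticDamping p.2.1 p.2.2) (duffingPotential p.1) :=
    fun H H' h1 h2 h3 h4 => ⟨isWell_outer hμ0 hμ1 hR h1 h2 h3, by
      simp only [hout, wellIntegral_duffing]
      exact h4⟩
  refine ⟨quadraticDamping p.2.1 p.2.2, duffingPotential p.1, ?_, ?_,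
    tendsto_derivative_duffingPotential hμ0 hμ1, Fin 5, inferInstance,
    ![⟨-R, leftCenter p.1, leftCenter p.1, b, HL / 2, HL' / 2⟩, outer HE HD, outer HD HC,
      outer HC HA, outer HA HB], Fintype.card_fin 5, ?_, ?_⟩
  · unfold quadraticDamping
    compute_degree!
  · unfold duffingPotential
    compute_degree!
  · intro i
    fin_cases i
    · refine ⟨isWell_left hμ0 hμ1 hR hb hcb hl hLL hL0 hr, ?_⟩
      exact (congrArg₂ (· * ·) (wellIntegral_duffing p (-R) b HL)
        (wellIntegral_duffing p (-R) b HL')).trans_lt (mul_neg_of_pos_of_neg sL sL')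
    · exact houter HE HD h0E hED (by linarith) (mul_neg_of_pos_of_neg sE sD)
    · exact houter HD HC (by linarith) hDC (by linarith) (mul_neg_of_neg_of_pos sD sC)
    · exact houter HC HA (by linarith) hCA (by linarith) (mul_neg_of_pos_of_neg sC sA)
    · exact houter HA HB (by linarith) hAB hBR (mul_neg_of_neg_of_pos sA sB)
  · set w : Fin 5 → WellData := ![⟨-R, leftCenter p.1, leftCenter p.1, b, HL / 2, HL' / 2⟩,
      outer HE HD, outer HD HC, outer HC HA, outer HA HB] with hw
    have hlt : ∀ i j : Fin 5, i < j → (w i).hi ≤ (w j).lo := by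
      intro i j hij
      fin_cases i <;> fin_cases j <;> first
        | exact absurd hij (by decide)
        | (simp [hw, hout]; linarith)
        | simp [hw, hout]
    intro i j hij
    rcases lt_or_gt_of_ne hij with h | h
    · exact WellData.separated_of_le (hlt i j h)
    · exact (WellData.separated_of_le (hlt j i h)).symm

lemma exists_duffingIntegral_pos (p : ℝ × ℝ × ℝ) :
    ∃ R H, 3 ≤ R ∧ 0 < H ∧ H < R ∧ 0 < duffingIntegral (-R) R p H := by
  obtain ⟨L, h₁, hpos⟩ := exists_wellIntegral_pos (f := quadraticDamping p.2.1 p.2.2)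
    (duffingPotential p.1) (R := 1 + |p.2.1| + |p.2.2|) fun x hx => by
      simp only [quadraticDamping, eval_add, eval_mul, eval_C, eval_pow, eval_X]
      have h1 : -(|p.2.1| * |x|) ≤ p.2.1 * x := by
        rw [← abs_mul]
        exact neg_abs_le _
      have h2 := neg_abs_le p.2.2
      have h3 := abs_nonneg p.2.1
      have h4 := abs_nonneg p.2.2
      rw [← sq_abs x]
      nlinarith
  refine ⟨max (max 3 L) (2 * max 1 h₁ + 1), 2 * max 1 h₁, (le_max_left _ _).trans (le_max_left _ _),
    ?_, (lt_add_one _).trans_le (le_max_right _ _), ?_⟩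
  · have := le_max_left 1 h₁
    linarith
  · rw [← wellIntegral_duffing]
    exact hpos _ (by rw [mul_div_cancel_left₀ _ two_ne_zero]; exact le_max_right _ _) _ _
      ((le_max_right _ _).trans (le_max_left _ _)) ((le_max_right _ _).trans (le_max_left _ _))

lemma continuousAt_duffingIntegral (A B H : ℝ) (p : ℝ × ℝ × ℝ) :
    ContinuousAt (fun p => duffingIntegral A B p H) p :=
  ((continuous_duffingIntegral A B).comp (g := fun q : (ℝ × ℝ × ℝ) × ℝ => duffingIntegral A B q.1 q.2)
    (f := fun p => (p, H)) (by fun_prop)).continuousAt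

/-- A quartic Hamiltonian and a quadratic damping with five sign changes. -/
theorem hasWells_five : HasWells 5 3 := by
  obtain ⟨α₀, hα₀, hs₀, hpos₀⟩ := exists_first_zero_saddleSlope
  have hp3 := pi_pos
  have hmem : ∀ {α}, α ∈ Icc (π / 3) (π / 2) → 0 ≤ sin α := fun hα => by
    linarith [le_sin_of_mem hα]
  have hα₀' : α₀ ∈ Icc (π / 3) (π / 2) := Ioo_subset_Icc_self hα₀
  have hzero : ∀ {R α}, 3 ≤ R → α ∈ Icc (π / 3) (π / 2) →
      ∫ x in -R..R, x * (x + loopCoeff α) * √(duffing (sin α) x) = 0 := fun {R α} hR hα => by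
    have h1 := duffingIntegral_zero (hmem hα) hR (loopCoeff α) 0
    have hm := (loopMoment_one_neg hα).ne
    rw [show loopMoment 2 α + loopCoeff α * loopMoment 1 α + 0 * loopMoment 0 α = 0 by
      unfold loopCoeff; field_simp; ring, duffingIntegral_eq_add] at h1
    simpa using h1
  obtain ⟨R, HB, hR, hB0, hBR, sB⟩ := exists_duffingIntegral_pos (sin α₀, loopCoeff α₀, 0)
  obtain ⟨b, HL, HL', hb, hcb, hl, hLL, hL0, hr, sL, sL'⟩ := exists_leftWell hα₀ hs₀ hR
  obtain ⟨HA, sA, hA⟩ := ((eventually_neg_of_saddleSlope_eq_zero ⟨by linarith [hα₀.1], hα₀.2⟩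
    (loopCoeff_pos hα₀').le hR hs₀ (hzero hR hα₀')).and (Ioo_mem_nhdsGT hB0)).exists
  have sA : duffingIntegral (-R) R (sin α₀, loopCoeff α₀, 0) HA < 0 := by
    rw [duffingIntegral_eq_add]
    simpa using sA
  set good : ℝ × ℝ × ℝ → Prop := fun p => leftCenter p.1 < b ∧
    -duffing p.1 (leftCenter p.1) < HL ∧ HL' < -duffing p.1 b ∧
    0 < duffingIntegral (-R) b p HL ∧ duffingIntegral (-R) b p HL' < 0 ∧
    duffingIntegral (-R) R p HA < 0 ∧ 0 < duffingIntegral (-R) R p HB with hgood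
  have hopen : IsOpen {p | good p} := by
    have c1 : Continuous fun p : ℝ × ℝ × ℝ => leftCenter p.1 :=
      continuous_leftCenter.comp continuous_fst
    have c2 : Continuous fun p : ℝ × ℝ × ℝ => -duffing p.1 (leftCenter p.1) := by
      unfold duffing
      fun_prop
    have c3 : Continuous fun p : ℝ × ℝ × ℝ => -duffing p.1 b := by
      unfold duffing
      fun_prop
    have c4 : ∀ A B H, Continuous fun p => duffingIntegral A B p H := fun A B H =>
      continuous_iff_continuousAt.2 fun p => continuousAt_duffingIntegral A B H p
    exact (isOpen_lt c1 continuous_const).and ((isOpen_lt c2 continuous_const).and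
      ((isOpen_lt continuous_const c3).and ((isOpen_lt continuous_const (c4 _ _ _)).and
      ((isOpen_lt (c4 _ _ _) continuous_const).and ((isOpen_lt (c4 _ _ _) continuous_const).and
      (isOpen_lt continuous_const (c4 _ _ _)))))))
  have good₀ : good (sin α₀, loopCoeff α₀, 0) := ⟨hcb, hl, hr, sL, sL', sA, sB⟩
  -- decrease the angle
  obtain ⟨α, hα, good₁⟩ : ∃ α ∈ Ioo (π / 3) α₀, good (sin α, loopCoeff α, 0) := by
    have hc : ContinuousAt (fun α => (sin α, loopCoeff α, (0 : ℝ))) α₀ :=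
      continuous_sin.continuousAt.prodMk
        ((continuousOn_loopCoeff.continuousAt (Icc_mem_nhds hα₀.1 hα₀.2)).prodMk continuousAt_const)
    obtain ⟨α, h1, h2⟩ := (((hc.eventually (hopen.mem_nhds good₀)).filter_mono
      (nhdsWithin_le_nhds (s := Iio α₀))).and (Ioo_mem_nhdsLT hα₀.1)).exists
    exact ⟨α, h2, h1⟩
  have hα' : α ∈ Icc (π / 3) (π / 2) := ⟨hα.1.le, (hα.2.trans hα₀.2).le⟩
  have hα'' : α ∈ Ico 0 (π / 2) := ⟨by linarith [hα.1], hα.2.trans hα₀.2⟩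
  have hk := loopMoment_one_neg hα'
  obtain ⟨HC, sC, hC⟩ := ((eventually_pos_of_saddleSlope_pos hα'' (loopCoeff_pos hα').le hR
    (hpos₀ α ⟨hα.1.le, hα.2⟩) (hzero hR hα')).and (Ioo_mem_nhdsGT hA.1)).exists
  have sC : 0 < duffingIntegral (-R) R (sin α, loopCoeff α, 0) HC := by
    rw [duffingIntegral_eq_add]
    simpa using sC
  -- move the saddle off the zero set of the damping
  obtain ⟨a₀, a₁, ha₀, ha₁, hrel, good₂, sC₂⟩ : ∃ a₀ a₁, a₀ < 0 ∧ 0 ≤ a₁ ∧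
      loopMoment 2 α + a₁ * loopMoment 1 α + a₀ * loopMoment 0 α = 0 ∧
      good (sin α, a₁, a₀) ∧ 0 < duffingIntegral (-R) R (sin α, a₁, a₀) HC := by
    have hc : Continuous fun a₀ : ℝ => (sin α,
        (-loopMoment 2 α - a₀ * loopMoment 0 α) / loopMoment 1 α, a₀) := by fun_prop
    have h0 : (sin α, (-loopMoment 2 α - 0 * loopMoment 0 α) / loopMoment 1 α, (0 : ℝ)) =
        (sin α, loopCoeff α, 0) := by simp [loopCoeff]
    have e1 := (hc.tendsto 0).eventually (hopen.mem_nhds (by rw [h0]; exact good₁))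
    have e2 := ((continuousAt_duffingIntegral (-R) R HC _).comp hc.continuousAt).eventually
      (lt_mem_nhds (show 0 < duffingIntegral (-R) R (sin α, (-loopMoment 2 α - 0 * loopMoment 0 α) /
        loopMoment 1 α, (0 : ℝ)) HC by rw [h0]; exact sC))
    have e3 := ((hc.snd.fst).tendsto 0).eventually (lt_mem_nhds (show 0 < (-loopMoment 2 α -
      0 * loopMoment 0 α) / loopMoment 1 α by simpa [loopCoeff] using loopCoeff_pos hα'))
    obtain ⟨a₀, ⟨h1, h2, h3⟩, h4⟩ := (((e1.and (e2.and e3)).filter_mono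
      (nhdsWithin_le_nhds (s := Iio (0 : ℝ)))).and self_mem_nhdsWithin).exists
    refine ⟨a₀, _, h4, le_of_lt h3, ?_, h1, h2⟩
    have := hk.ne
    field_simp
    ring
  obtain ⟨HD, sD, hD⟩ := ((eventually_neg_of_const_neg hα'' ha₁ hR ha₀ (by
    rw [← hrel, ← duffingIntegral_zero (hmem hα') hR, duffingIntegral_eq_add]
    simp only [zero_add])).and (Ioo_mem_nhdsGT hC.1)).exists
  have sD : duffingIntegral (-R) R (sin α, a₁, a₀) HD < 0 := by
    rw [duffingIntegral_eq_add]
    exact sD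
  -- break the loop
  obtain ⟨t, ht, good₃, sC₃, sD₃⟩ : ∃ t < a₁, good (sin α, t, a₀) ∧
      0 < duffingIntegral (-R) R (sin α, t, a₀) HC ∧
      duffingIntegral (-R) R (sin α, t, a₀) HD < 0 := by
    have hc : Continuous fun t : ℝ => (sin α, t, a₀) := by fun_prop
    have e1 := (hc.tendsto a₁).eventually (hopen.mem_nhds good₂)
    have e2 := ((continuousAt_duffingIntegral (-R) R HC _).comp hc.continuousAt).eventually
      (lt_mem_nhds sC₂)
    have e3 := ((continuousAt_duffingIntegral (-R) R HD _).comp hc.continuousAt).eventually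
      (gt_mem_nhds sD)
    obtain ⟨t, ⟨h1, h2, h3⟩, h4⟩ := (((e1.and (e2.and e3)).filter_mono
      (nhdsWithin_le_nhds (s := Iio a₁))).and self_mem_nhdsWithin).exists
    exact ⟨t, h4, h1, h2, h3⟩
  have s0 : 0 < duffingIntegral (-R) R (sin α, t, a₀) 0 := by
    rw [duffingIntegral_zero (hmem hα') hR]
    nlinarith
  have hcH : Continuous fun H => duffingIntegral (-R) R (sin α, t, a₀) H :=
    (continuous_duffingIntegral (-R) R).comp
      (g := fun q : (ℝ × ℝ × ℝ) × ℝ => duffingIntegral (-R) R q.1 q.2)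
      (f := fun H => ((sin α, t, a₀), H)) (by fun_prop)
  obtain ⟨HE, sE, hE⟩ := ((((hcH.tendsto 0).eventually_const_lt s0).filter_mono
    (nhdsWithin_le_nhds (s := Ioi (0 : ℝ)))).and (Ioo_mem_nhdsGT hD.1)).exists
  obtain ⟨g1, g2, g3, g4, g5, g6, g7⟩ := good₃
  have hμ1 : sin α < 1 := by
    rw [← sin_pi_div_two]
    exact sin_lt_sin_of_lt_of_le_pi_div_two (by linarith [hα''.1]) le_rfl hα''.2
  exact hasWells_five_of_signs (p := (sin α, t, a₀)) (by linarith [le_sin_of_mem hα']) hμ1 hR hb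
    g1 g2 hLL hL0 g3 hE.1 hE.2 hD.2 hC.2 hA.2 hBR g4 g5 sE sD₃ sC₃ g6 g7

end FiveWells

theorem hasWells_pow (p : ℕ) (hp : 1 ≤ p) :
    HasWells (2 ^ p * (p + 1) + 1) (2 ^ (p + 1) - 1) := by
  induction p, hp using Nat.le_induction with
  | base => exact hasWells_five
  | succ p hp ih =>
    have h1 : 1 ≤ 2 ^ p := Nat.one_le_two_pow
    have e1 : 2 * (2 ^ (p + 1) - 1) + 1 = 2 ^ (p + 1 + 1) - 1 := by
      rw [pow_succ 2 (p + 1), pow_succ 2 p]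
      omega
    have e2 : 2 * (2 ^ p * (p + 1) + 1) + (2 ^ (p + 1) - 1) = 2 ^ (p + 1) * (p + 1 + 1) + 1 := by
      rw [pow_succ 2 p]
      generalize 2 ^ p = q at *
      have : q * 2 * (p + 1 + 1) = 2 * (q * (p + 1)) + q * 2 := by ring
      omega
    rw [← e1, ← e2]
    exact ih.double

theorem stmt9 (p : ℕ) (hp : 1 ≤ p) (m : ℕ) (hm : m = 2 ^ (p + 1) - 1) :
    HGe m m (((m : ℝ) + 1) * Real.log ((m : ℝ) + 1) / (2 * Real.log 2) + 1) := by
  have hm1 : (m : ℝ) + 1 = 2 ^ (p + 1) := by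
    rw [hm, Nat.cast_sub Nat.one_le_two_pow]
    push_cast
    ring
  have hl : Real.log 2 ≠ 0 := (Real.log_pos one_lt_two).ne'
  have : ((m : ℝ) + 1) * Real.log ((m : ℝ) + 1) / (2 * Real.log 2) + 1 =
      ((2 ^ p * (p + 1) + 1 : ℕ) : ℝ) := by
    rw [hm1, Real.log_pow]
    push_cast
    field_simp
    ring
  rw [this, hm]
  exact (hasWells_pow p hp).hGe
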